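/- arXiv:2108.02364 — 2 statements merged into one kernel-verified Lean document; each statement's English description precedes it below -/
import Mathlib

section
/- Let t ≥ 4 and 2 ≤ s ≤ t. There exists n₀ such that for all n ≥ n₀ the following holds: with G⋆ and K as in the extremal setup, for every integer i with 1 ≤ i ≤ t+3 and i ≠ t, the number of connected components of G⋆ − K having exactly i vertices is less than t. -/
open SimpleGraph

/-- `H` is a minor of `G` (branch-set definition). -/
def MinorOf {α β : Type} (H : SimpleGraph α) (G : SimpleGraph β) : Prop :=
  ∃ φ : α → Set β,
    (∀ a, (G.induce (φ a)).Connected) ∧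
    (Pairwise fun a b => Disjoint (φ a) (φ b)) ∧
    (∀ a b, H.Adj a b → ∃ x ∈ φ a, ∃ y ∈ φ b, G.Adj x y)

/-- Adjacency matrix over ℝ. -/
noncomputable def adjMat {V : Type} [Fintype V] (G : SimpleGraph V) : Matrix V V ℝ :=
  letI := Classical.decRel G.Adj
  SimpleGraph.adjMatrix ℝ G

theorem adjMat_herm {V : Type} [Fintype V] (G : SimpleGraph V) : (adjMat G).IsHermitian := by
  letI := Classical.decRel G.Adj
  ext i j
  simp [adjMat, Matrix.conjTranspose_apply, SimpleGraph.adjMatrix_apply, SimpleGraph.adj_comm]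

/-- Spectral radius = largest adjacency eigenvalue. -/
noncomputable def specRad {V : Type} [Fintype V] [DecidableEq V] (G : SimpleGraph V) : ℝ :=
  ⨆ i, (adjMat_herm G).eigenvalues i

/-- degree -/
noncomputable def deg {V : Type} (G : SimpleGraph V) (v : V) : ℕ := (G.neighborSet v).ncard

/-- number of edges -/
noncomputable def ecard {V : Type} (G : SimpleGraph V) : ℕ := G.edgeSet.ncard

/-- k disjoint copies of G -/
def copies (k : ℕ) {V : Type} (G : SimpleGraph V) : SimpleGraph (Fin k × V) :=
  SimpleGraph.fromRel fun x y => x.1 = y.1 ∧ G.Adj x.2 y.2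

/-- disjoint union -/
def gUnion {V W : Type} (G : SimpleGraph V) (H : SimpleGraph W) : SimpleGraph (V ⊕ W) :=
  SimpleGraph.fromRel fun x y =>
    (∃ a b, x = Sum.inl a ∧ y = Sum.inl b ∧ G.Adj a b) ∨
    (∃ a b, x = Sum.inr a ∧ y = Sum.inr b ∧ H.Adj a b)

/-- join -/
def gJoin {V W : Type} (G : SimpleGraph V) (H : SimpleGraph W) : SimpleGraph (V ⊕ W) :=
  SimpleGraph.fromRel fun x y =>
    (∃ a b, x = Sum.inl a ∧ y = Sum.inl b ∧ G.Adj a b) ∨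
    (∃ a b, x = Sum.inr a ∧ y = Sum.inr b ∧ H.Adj a b) ∨
    (∃ a b, x = Sum.inl a ∧ y = Sum.inr b)

/-- Petersen graph (Kneser graph K(5,2)). -/
def petersen : SimpleGraph {s : Finset (Fin 5) // s.card = 2} :=
  SimpleGraph.fromRel fun a b => Disjoint a.1 b.1

/-- star K_{1,m} -/
def starG (m : ℕ) : SimpleGraph (Fin 1 ⊕ Fin m) := completeBipartiteGraph (Fin 1) (Fin m)

/-- the star forest H_{s,t} -/
def Hst (s t : ℕ) :
    SimpleGraph ((Fin ((t+1)/(s+1) - 1) × (Fin 1 ⊕ Fin s)) ⊕ (Fin 1 ⊕ Fin (t - ((t+1)/(s+1) - 1) * (s+1)))) :=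
  gUnion (copies ((t+1)/(s+1) - 1) (starG s)) (starG (t - ((t+1)/(s+1) - 1) * (s+1)))

/-- subdivide the edge uv of G by a path through k new vertices -/
def subdividePath {V : Type} (G : SimpleGraph V) (u v : V) (k : ℕ) : SimpleGraph (V ⊕ Fin k) :=
  SimpleGraph.fromRel fun x y =>
    (∃ a b, x = Sum.inl a ∧ y = Sum.inl b ∧ G.Adj a b ∧ ¬(a = u ∧ b = v) ∧ ¬(a = v ∧ b = u)) ∨
    (∃ i : Fin k, x = Sum.inl u ∧ y = Sum.inr i ∧ (i : ℕ) = 0) ∨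
    (∃ i j : Fin k, x = Sum.inr i ∧ y = Sum.inr j ∧ (j : ℕ) = (i : ℕ) + 1) ∨
    (∃ i : Fin k, x = Sum.inr i ∧ y = Sum.inl v ∧ (i : ℕ) = k - 1)

/-- (s,t)-property -/
def HasSTProp (s t : ℕ) {V : Type} (G : SimpleGraph V) : Prop :=
  ∀ a b : ℕ, 1 ≤ a → 1 ≤ b → a + b = t + 1 → a ≤ min s ((t+1)/2) →
    ¬ MinorOf (completeBipartiteGraph (Fin a) (Fin b)) G

/-- H_{a,b,c} -/
def Habc (a b c : ℕ) : SimpleGraph (Fin 3 ⊕ (Fin a ⊕ Fin b ⊕ Fin c)) :=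
  SimpleGraph.fromRel fun x y =>
    (x = Sum.inl 0 ∧ y = Sum.inl 1) ∨
    (x = Sum.inl 0 ∧ ∃ i : Fin a, y = Sum.inr (Sum.inl i)) ∨
    (x = Sum.inl 0 ∧ ∃ i : Fin b, y = Sum.inr (Sum.inr (Sum.inl i))) ∨
    (x = Sum.inl 1 ∧ ∃ i : Fin a, y = Sum.inr (Sum.inl i)) ∨
    (x = Sum.inl 1 ∧ ∃ i : Fin c, y = Sum.inr (Sum.inr (Sum.inr i))) ∨
    (x = Sum.inl 2 ∧ ∃ i : Fin b, y = Sum.inr (Sum.inr (Sum.inl i))) ∨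
    (x = Sum.inl 2 ∧ ∃ i : Fin c, y = Sum.inr (Sum.inr (Sum.inr i)))

noncomputable def edgeDegSum {V : Type} (G H : SimpleGraph V) : ℕ :=
  ∑ᶠ e ∈ G.edgeSet, Sym2.lift ⟨fun u v => deg H u + deg H v, fun u v => by dsimp; ring⟩ e


theorem minor_of_sets {V : Type} [DecidableEq V] (G : SimpleGraph V) (s t : ℕ) (A B : Finset V)
    (hA : A.card = s) (hB : B.card = t) (X : V → Set V)
    (hc : ∀ a ∈ A ∪ B, (G.induce (X a)).Connected)
    (hd : Disjoint A B)
    (hX : ∀ a ∈ A ∪ B, ∀ b ∈ A ∪ B, a ≠ b → Disjoint (X a) (X b))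
    (hadj : ∀ a ∈ A, ∀ b ∈ B, ∃ x ∈ X a, ∃ y ∈ X b, G.Adj x y) :
    MinorOf (completeBipartiteGraph (Fin s) (Fin t)) G := by
  let eA : Fin s ≃ A := (A.equivFinOfCardEq hA).symm
  let eB : Fin t ≃ B := (B.equivFinOfCardEq hB).symm
  let f : Fin s ⊕ Fin t → V := Sum.elim (fun a => (eA a : V)) (fun b => (eB b : V))
  have hf : ∀ z, f z ∈ A ∪ B := by
    rintro (a | b)
    · exact Finset.mem_union_left _ (eA a).2
    · exact Finset.mem_union_right _ (eB b).2
  have hinj : Function.Injective f := by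
    rintro (a | a) (b | b) h
    · exact congrArg _ (eA.injective (Subtype.ext h))
    · exact absurd h (Finset.disjoint_iff_ne.1 hd _ (eA a).2 _ (eB b).2)
    · exact absurd h.symm (Finset.disjoint_iff_ne.1 hd _ (eA b).2 _ (eB a).2)
    · exact congrArg _ (eB.injective (Subtype.ext h))
  refine ⟨fun z => X (f z), fun z => hc _ (hf z), ?_, ?_⟩
  · intro a b hab
    exact hX _ (hf a) _ (hf b) (fun h => hab (hinj h))
  · rintro (a | a) (b | b) h
    · simp at h
    · exact hadj _ (eA a).2 _ (eB b).2
    · obtain ⟨x, hx, y, hy, hxy⟩ := hadj _ (eA b).2 _ (eB a).2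
      exact ⟨y, hy, x, hx, hxy.symm⟩
    · simp at h

theorem conn_single {V : Type} (G : SimpleGraph V) (v : V) :
    (G.induce ({v} : Set V)).Connected := by
  have : Nonempty ({v} : Set V) := ⟨⟨v, rfl⟩⟩
  have : Subsingleton ({v} : Set V) := ⟨fun a b => Subtype.ext (by rw [a.2, b.2])⟩
  exact ⟨fun a b => by rw [Subsingleton.elim a b]⟩

/-- The data used throughout: `K` is a dominating clique. -/
structure DomClique {n : ℕ} (G : SimpleGraph (Fin n)) (K : Finset (Fin n)) : Prop where
  cl : G.IsClique (↑K : Set (Fin n))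
  dom : ∀ v : Fin n, v ∉ K → ∀ u ∈ K, G.Adj u v

theorem DomClique.adj {n : ℕ} {G : SimpleGraph (Fin n)} {K : Finset (Fin n)}
    (h : DomClique G K) {u v : Fin n} (hu : u ∈ K) (huv : u ≠ v) : G.Adj u v := by
  by_cases hv : v ∈ K
  · exact h.cl hu hv huv
  · exact h.dom v hv u hu

/-- no connected pair `{u,v}` dominating `t` further vertices -/
theorem no_pair {n s t : ℕ} (hs : 2 ≤ s) {G : SimpleGraph (Fin n)} {K : Finset (Fin n)}
    (hK : K.card = s - 1) (hD : DomClique G K)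
    (hG : ¬ MinorOf (completeBipartiteGraph (Fin s) (Fin t)) G)
    (u v : Fin n) (hu : u ∉ K) (hv : v ∉ K) (huv : u = v ∨ G.Adj u v)
    (T : Finset (Fin n)) (hT : t ≤ T.card) (hTK : Disjoint T K) (huT : u ∉ T) (hvT : v ∉ T)
    (hadj : ∀ w ∈ T, G.Adj u w ∨ G.Adj v w) : False := by
  obtain ⟨T', hT', hc⟩ := Finset.exists_subset_card_eq hT
  apply hG
  have hTK' : ∀ x ∈ T', x ∉ K := fun x hx => Finset.disjoint_left.1 hTK (hT' hx)
  have huT' : u ∉ T' := fun h => huT (hT' h)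
  have hvT' : v ∉ T' := fun h => hvT (hT' h)
  refine minor_of_sets G s t (insert u K) T' ?_ hc (fun a => if a = u then {u, v} else {a})
    ?_ ?_ ?_ ?_
  · rw [Finset.card_insert_of_notMem hu, hK]; omega
  · intro a _
    by_cases h : a = u
    · rw [if_pos h]
      rcases huv with rfl | huv
      · rw [Set.pair_eq_singleton]
        exact conn_single G u
      · exact SimpleGraph.induce_pair_connected_of_adj huv
    · rw [if_neg h]; exact conn_single G a
  · rw [Finset.disjoint_left]
    intro a ha ha'
    rcases Finset.mem_insert.1 ha with rfl | ha
    · exact huT' ha'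
    · exact hTK' a ha' ha
  · have key : ∀ b ∈ insert u K ∪ T', b ≠ u → b ≠ v := by
      intro b hb hbu hbv
      subst hbv
      simp [hbu, hv, hvT'] at hb
    intro a ha b hb hab
    by_cases h : a = u
    · by_cases h' : b = u
      · exact absurd (h.trans h'.symm) hab
      · simp only [h, h', if_true, if_false]
        simp [h', key b hb h']
    · by_cases h' : b = u
      · simp only [h, h', if_true, if_false]
        have := key a ha h
        simp
        exact ⟨h, this⟩
      · simp only [h, h', if_false]
        simpa using hab
  · intro a ha b hb
    have hbu : b ≠ u := fun e => huT' (e ▸ hb)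
    simp only [hbu, if_false]
    by_cases h : a = u
    · simp only [h, if_true]
      rcases hadj b (hT' hb) with h1 | h1
      · exact ⟨u, by simp, b, rfl, h1⟩
      · exact ⟨v, by simp, b, rfl, h1⟩
    · simp only [h, if_false]
      have haK : a ∈ K := (Finset.mem_insert.1 ha).resolve_left h
      exact ⟨a, rfl, b, rfl, hD.dom b (hTK' b hb) a haK⟩

theorem no_two {n s t : ℕ} (hs : 2 ≤ s) (ht : 1 ≤ t) {G : SimpleGraph (Fin n)}
    {K : Finset (Fin n)}
    (hK : K.card = s - 1) (hD : DomClique G K)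
    (hG : ¬ MinorOf (completeBipartiteGraph (Fin s) (Fin t)) G)
    (u v : Fin n) (hu : u ∉ K) (hv : v ∉ K) (huv : u ≠ v)
    (T : Finset (Fin n)) (hT : T.card = t - 1) (hTK : Disjoint T K) (huT : u ∉ T) (hvT : v ∉ T)
    (hadj : ∀ w ∈ T, G.Adj u w ∧ G.Adj v w) : False := by
  have hne : K.Nonempty := by rw [← Finset.card_pos]; omega
  obtain ⟨k, hk⟩ := hne
  have hTK' : ∀ x ∈ T, x ∉ K := fun x hx => Finset.disjoint_left.1 hTK hx
  have hku : k ≠ u := fun e => hu (e ▸ hk)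
  have hkv : k ≠ v := fun e => hv (e ▸ hk)
  have hkT : k ∉ T := fun h => hTK' k h hk
  apply hG
  refine minor_of_sets G s t (insert u (insert v (K.erase k))) (insert k T) ?_ ?_ (fun a => {a})
    (fun a _ => conn_single G a) ?_ (fun a _ b _ h => by simpa using h) ?_
  · rw [Finset.card_insert_of_notMem (by simp [huv, hu]),
      Finset.card_insert_of_notMem (by simp [hv]), Finset.card_erase_of_mem hk, hK]
    omega
  · rw [Finset.card_insert_of_notMem hkT, hT]; omega
  · rw [Finset.disjoint_left]
    intro a ha ha'
    simp only [Finset.mem_insert, Finset.mem_erase] at ha ha'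
    rcases ha with rfl | rfl | ⟨h1, h2⟩
    · rcases ha' with h | h
      · exact hku h.symm
      · exact huT h
    · rcases ha' with h | h
      · exact hkv h.symm
      · exact hvT h
    · rcases ha' with h | h
      · exact h1 h
      · exact hTK' a h h2
  · intro a ha b hb
    refine ⟨a, rfl, b, rfl, ?_⟩
    simp only [Finset.mem_insert, Finset.mem_erase] at ha hb
    rcases hb with rfl | hb
    · have hab : b ≠ a := by
        rcases ha with rfl | rfl | ⟨h1, h2⟩
        · exact hku
        · exact hkv
        · exact fun e => h1 e.symm
      exact (hD.adj hk hab).symm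
    · rcases ha with rfl | rfl | ⟨h1, h2⟩
      · exact (hadj b hb).1
      · exact (hadj b hb).2
      · exact hD.dom b (hTK' b hb) a h2

open Classical in
/-- degree bound inside a set avoiding `K` -/
theorem deg_le {n s t : ℕ} (hs : 2 ≤ s) {G : SimpleGraph (Fin n)}
    {K : Finset (Fin n)} (ht : 1 ≤ t)
    (hK : K.card = s - 1) (hD : DomClique G K)
    (hG : ¬ MinorOf (completeBipartiteGraph (Fin s) (Fin t)) G)
    (S : Finset (Fin n)) (hS : Disjoint S K) (v : Fin n) (hv : v ∉ K) :
    (S.filter (fun w => G.Adj v w)).card ≤ t - 1 := by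
  by_contra h
  exact no_pair hs hK hD hG v v hv hv (Or.inl rfl) (S.filter (fun w => G.Adj v w)) (by omega)
    (Finset.disjoint_of_subset_left (Finset.filter_subset _ _) hS) (by simp) (by simp)
    (fun w hw => Or.inl (Finset.mem_filter.1 hw).2)

open Classical in
theorem degsum_even {n : ℕ} (G : SimpleGraph (Fin n)) (S : Finset (Fin n)) :
    Even (∑ v ∈ S, (S.filter (fun w => G.Adj v w)).card) := by
  have h := (G.induce (S : Set (Fin n))).sum_degrees_eq_twice_card_edges
  have h2 : ∑ v ∈ S, (S.filter (fun w => G.Adj v w)).card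
      = ∑ v : (S : Set (Fin n)), (G.induce (S : Set (Fin n))).degree v := by
    rw [← Finset.sum_coe_sort S]
    refine Finset.sum_congr rfl (fun v _ => ?_)
    rw [← SimpleGraph.card_neighborFinset_eq_degree]
    symm
    refine Finset.card_bij (fun a _ => (a : Fin n)) ?_ ?_ ?_
    · intro a ha
      simp only [SimpleGraph.mem_neighborFinset, SimpleGraph.comap_adj] at ha
      exact Finset.mem_filter.2 ⟨a.2, ha⟩
    · intro a _ b _ h; exact Subtype.ext h
    · intro b hb
      obtain ⟨h1, h2⟩ := Finset.mem_filter.1 hb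
      exact ⟨⟨b, h1⟩, by simpa using h2, rfl⟩
  rw [h2, h]
  exact even_two_mul _

open Classical in
/-- main local bound -/
theorem degsum_lt {n s t i : ℕ} (hs : 2 ≤ s) (ht : 4 ≤ t) {G : SimpleGraph (Fin n)}
    {K : Finset (Fin n)}
    (hK : K.card = s - 1) (hD : DomClique G K)
    (hG : ¬ MinorOf (completeBipartiteGraph (Fin s) (Fin t)) G)
    (S : Finset (Fin n)) (hS : Disjoint S K) (hi : S.card = i) (hi1 : 1 ≤ i) (hi2 : i ≤ t + 3)
    (hit : i ≠ t) :
    ∑ v ∈ S, (S.filter (fun w => G.Adj v w)).card < i * (t - 1) := by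
  have hSK : ∀ x ∈ S, x ∉ K := fun x hx => Finset.disjoint_left.1 hS hx
  by_contra hcon
  have hle : ∀ v ∈ S, (S.filter (fun w => G.Adj v w)).card ≤ t - 1 :=
    fun v hv => deg_le hs (by omega) hK hD hG S hS v (hSK v hv)
  have hreg : ∀ v ∈ S, (S.filter (fun w => G.Adj v w)).card = t - 1 := by
    by_contra hne
    push Not at hne
    obtain ⟨v, hv, hv'⟩ := hne
    have := Finset.sum_lt_sum hle ⟨v, hv, lt_of_le_of_ne (hle v hv) hv'⟩
    simp [hi] at this
    omega
  let N : Fin n → Finset (Fin n) := fun v => S.filter (fun w => ¬ G.Adj v w ∧ w ≠ v)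
  have hNmem : ∀ v w, w ∈ N v ↔ w ∈ S ∧ ¬ G.Adj v w ∧ w ≠ v := fun v w => Finset.mem_filter
  have hN : ∀ v ∈ S, (N v).card + t = i := by
    intro v hv
    have h1 := Finset.card_filter_add_card_filter_not (s := S) (fun w => G.Adj v w)
    have h2 : S.filter (fun w => ¬ G.Adj v w) = insert v (N v) := by
      ext w
      simp only [Finset.mem_filter, Finset.mem_insert, hNmem]
      by_cases hw : w = v
      · subst hw; simp [hv]
      · simp [hw]
    rw [h2, Finset.card_insert_of_notMem (by simp [hNmem]), hreg v hv, hi] at h1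
    omega
  obtain ⟨u, hu⟩ : S.Nonempty := by rw [← Finset.card_pos]; omega
  have hNu := hN u hu
  have hcases : i = t + 1 ∨ i = t + 2 ∨ i = t + 3 := by omega
  by_cases h1 : i = t + 1
  · have : (N u).card = 1 := by omega
    obtain ⟨v, hv⟩ := Finset.card_eq_one.1 this
    have hvN : v ∈ N u := by simp [hv]
    obtain ⟨hvS, hvu, hvne⟩ := (hNmem _ _).1 hvN
    have hNv : (N v).card = 1 := by have := hN v hvS; omega
    obtain ⟨u', hu'⟩ := Finset.card_eq_one.1 hNv
    have huN : u ∈ N v := (hNmem _ _).2 ⟨hu, fun h => hvu h.symm, hvne.symm⟩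
    have huu : N v = {u} := by
      rw [hu'] at huN ⊢
      rw [Finset.mem_singleton.1 huN]
    refine no_two hs (by omega) hK hD hG u v (hSK u hu) (hSK v hvS) hvne.symm
      ((S.erase u).erase v) ?_ ?_ (by simp) (by simp) ?_
    · rw [Finset.card_erase_of_mem (by simp [hvne, hvS]), Finset.card_erase_of_mem hu]; omega
    · exact Finset.disjoint_of_subset_left
        ((Finset.erase_subset _ _).trans (Finset.erase_subset _ _)) hS
    · intro w hw
      simp only [Finset.mem_erase] at hw
      obtain ⟨hwv, hwu, hwS⟩ := hw
      constructor
      · by_contra hc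
        have : w ∈ N u := (hNmem _ _).2 ⟨hwS, hc, hwu⟩
        rw [hv] at this
        exact hwv (Finset.mem_singleton.1 this)
      · by_contra hc
        have : w ∈ N v := (hNmem _ _).2 ⟨hwS, hc, hwv⟩
        rw [huu] at this
        exact hwu (Finset.mem_singleton.1 this)
  · -- every neighbour of u has at least d-1 common non-neighbours with u
    set d := i - t with hd
    have hcommon : ∀ v ∈ S.filter (fun w => G.Adj u w), d - 1 ≤ (N u ∩ N v).card := by
      intro v hv
      obtain ⟨hvS, huv⟩ := Finset.mem_filter.1 hv
      by_contra hlt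
      have hsub : N u ∩ N v ⊆ (S.erase u).erase v := by
        intro w hw
        obtain ⟨ha, hb⟩ := Finset.mem_inter.1 hw
        have ha := (hNmem _ _).1 ha
        have hb := (hNmem _ _).1 hb
        simp [ha.1, ha.2.2, hb.2.2]
      refine no_pair hs hK hD hG u v (hSK u hu) (hSK v hvS) (Or.inr huv)
        (((S.erase u).erase v) \ (N u ∩ N v)) ?_ ?_ (by simp) (by simp) ?_
      · rw [Finset.card_sdiff_of_subset hsub, Finset.card_erase_of_mem
          (by simp [huv.ne', hvS]), Finset.card_erase_of_mem hu]
        omega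
      · exact Finset.disjoint_of_subset_left (Finset.sdiff_subset.trans
          ((Finset.erase_subset _ _).trans (Finset.erase_subset _ _))) hS
      · intro w hw
        simp only [Finset.mem_sdiff, Finset.mem_erase, Finset.mem_inter, hNmem] at hw
        tauto
    have hle1 : (t - 1) * (d - 1) ≤ ∑ v ∈ S.filter (fun w => G.Adj u w), (N u ∩ N v).card := by
      have := Finset.card_nsmul_le_sum _ _ _ hcommon
      rwa [hreg u hu, smul_eq_mul] at this
    have hswap : ∑ v ∈ S.filter (fun w => G.Adj u w), (N u ∩ N v).card
        = ∑ w ∈ N u, ((S.filter (fun w => G.Adj u w)).filter (fun v => w ∈ N v)).card := by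
      simp_rw [← Finset.filter_mem_eq_inter]
      have := Finset.sum_card_bipartiteAbove_eq_sum_card_bipartiteBelow
        (s := S.filter (fun w => G.Adj u w)) (t := N u) (fun v w => w ∈ N v)
      simpa [Finset.bipartiteAbove, Finset.bipartiteBelow] using this
    have hle2 : ∑ v ∈ S.filter (fun w => G.Adj u w), (N u ∩ N v).card ≤ d * (d - 1) := by
      rw [hswap]
      have hb : ∀ w ∈ N u, ((S.filter (fun w => G.Adj u w)).filter (fun v => w ∈ N v)).card
          ≤ d - 1 := by
        intro w hw
        obtain ⟨hwS, hwu, hne⟩ := (hNmem _ _).1 hw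
        have hsub : (S.filter (fun w => G.Adj u w)).filter (fun v => w ∈ N v) ⊆ (N w).erase u := by
          intro v hv
          simp only [Finset.mem_filter, hNmem] at hv
          simp only [Finset.mem_erase, hNmem]
          exact ⟨hv.1.2.ne', hv.1.1, fun h => hv.2.2.1 h.symm, fun h => hv.2.2.2 h.symm⟩
        have h3 := Finset.card_le_card hsub
        rw [Finset.card_erase_of_mem ((hNmem _ _).2 ⟨hu, fun h => hwu h.symm, hne.symm⟩)] at h3
        have := hN w hwS
        omega
      have := Finset.sum_le_card_nsmul _ _ _ hb
      rw [smul_eq_mul] at this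
      have hd' : (N u).card = d := by omega
      rwa [hd'] at this
    have h5 := hle1.trans hle2
    have h6 : t - 1 ≤ d := Nat.le_of_mul_le_mul_right h5 (by omega)
    have h7 : t = 4 ∧ i = 7 := by omega
    have h8 := degsum_even G S
    rw [Finset.sum_congr rfl hreg] at h8
    rw [Finset.sum_const, hi, h7.1, h7.2] at h8
    revert h8
    decide

/-- The modified graph: `r v = none` for vertices that are untouched; vertices with the same
`some` label form cliques; `K` is joined to everything. -/
def swapG {n : ℕ} (G : SimpleGraph (Fin n)) (K : Finset (Fin n)) (r : Fin n → Option ℕ) :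
    SimpleGraph (Fin n) where
  Adj u v := u ≠ v ∧ (u ∈ K ∨ v ∈ K ∨ (r u = r v ∧ (r u = none → G.Adj u v)))
  symm := ⟨fun u v h => by
    obtain ⟨h1, h2⟩ := h
    refine ⟨h1.symm, ?_⟩
    rcases h2 with h2 | h2 | ⟨h2, h3⟩
    · exact Or.inr (Or.inl h2)
    · exact Or.inl h2
    · exact Or.inr (Or.inr ⟨h2.symm, fun h => (h3 (h2.trans h)).symm⟩)⟩
  loopless := ⟨fun u h => h.1 rfl⟩

theorem swapG_adj {n : ℕ} (G : SimpleGraph (Fin n)) (K : Finset (Fin n)) (r : Fin n → Option ℕ)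
    (u v : Fin n) : (swapG G K r).Adj u v ↔
      u ≠ v ∧ (u ∈ K ∨ v ∈ K ∨ (r u = r v ∧ (r u = none → G.Adj u v))) := Iff.rfl

theorem const_of_connected {V W : Type} {G : SimpleGraph V} (hG : G.Connected) (f : V → W)
    (h : ∀ u v, G.Adj u v → f u = f v) (u v : V) : f u = f v := by
  obtain ⟨p⟩ := hG.preconnected u v
  induction p with
  | nil => rfl
  | cons hadj _ ih => exact (h _ _ hadj).trans ih

open Classical in
theorem swap_minor_free {n s t : ℕ} (hs : 2 ≤ s) (hst : s ≤ t) {G : SimpleGraph (Fin n)}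
    {K : Finset (Fin n)}
    (hK : K.card = s - 1) (hD : DomClique G K)
    (hG : ¬ MinorOf (completeBipartiteGraph (Fin s) (Fin t)) G)
    (r : Fin n → Option ℕ)
    (hr : ∀ j : ℕ, (Finset.univ.filter (fun w => r w = some j)).card ≤ t) :
    ¬ MinorOf (completeBipartiteGraph (Fin s) (Fin t)) (swapG G K r) := by
  rintro ⟨φ, hc, hd, hadj⟩
  -- branch sets meeting K
  let P : Fin s ⊕ Fin t → Prop := fun z => ∃ k ∈ K, k ∈ φ z
  have hne : ∀ z, ∃ x, x ∈ φ z := fun z => by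
    obtain ⟨x⟩ := (hc z).nonempty
    exact ⟨x, x.2⟩
  -- representative
  have hrep : ∀ z, ∃ x, x ∈ φ z ∧ (P z → x ∈ K) := by
    intro z
    by_cases h : P z
    · obtain ⟨k, hk, hkz⟩ := h
      exact ⟨k, hkz, fun _ => hk⟩
    · obtain ⟨x, hx⟩ := hne z
      exact ⟨x, hx, fun h' => absurd h' h⟩
  choose g hg hgK using hrep
  have hginj : Function.Injective g := by
    intro a b hab
    by_contra hne'
    exact Set.disjoint_left.1 (hd hne') (hg a) (hab ▸ hg b)
  -- at most s - 1 branch sets meet K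
  have hcnt : (Finset.univ.filter P).card ≤ s - 1 := by
    rw [← hK]
    exact Finset.card_le_card_of_injOn g (fun z hz => hgK z (by simpa using hz)) hginj.injOn
  have hA : ∃ a : Fin s, ¬ P (Sum.inl a) := by
    by_contra! h
    have h1 : (Finset.univ : Finset (Fin s)).card ≤ (Finset.univ.filter P).card :=
      Finset.card_le_card_of_injOn Sum.inl (fun a _ => by simpa using h a) Sum.inl_injective.injOn
    simp only [Finset.card_univ, Fintype.card_fin] at h1
    omega
  have hB : ∃ b : Fin t, ¬ P (Sum.inr b) := by
    by_contra! h
    have h1 : (Finset.univ : Finset (Fin t)).card ≤ (Finset.univ.filter P).card :=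
      Finset.card_le_card_of_injOn Sum.inr (fun a _ => by simpa using h a) Sum.inr_injective.injOn
    simp only [Finset.card_univ, Fintype.card_fin] at h1
    omega
  obtain ⟨a0, ha0⟩ := hA
  obtain ⟨b0, hb0⟩ := hB
  have hnK : ∀ z, ¬ P z → ∀ x ∈ φ z, x ∉ K := fun z hz x hx hxK => hz ⟨x, hxK, hx⟩
  have hadjr : ∀ u v, u ∉ K → v ∉ K → (swapG G K r).Adj u v → r u = r v := by
    intro u v hu hv h
    rcases h.2 with h | h | h
    · exact absurd h hu
    · exact absurd h hv
    · exact h.1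
  have hconst : ∀ z, ¬ P z → ∀ x ∈ φ z, ∀ y ∈ φ z, r x = r y := by
    intro z hz x hx y hy
    exact const_of_connected (hc z) (fun w => r w.1)
      (fun u v h => hadjr _ _ (hnK z hz _ u.2) (hnK z hz _ v.2) h) ⟨x, hx⟩ ⟨y, hy⟩
  have hcross : ∀ y z, ¬ P y → ¬ P z → (completeBipartiteGraph (Fin s) (Fin t)).Adj y z →
      r (g y) = r (g z) := by
    intro y z hy hz h
    obtain ⟨u, hu, v, hv, huv⟩ := hadj y z h
    rw [hconst y hy _ (hg y) u hu, hconst z hz _ (hg z) v hv]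
    exact hadjr u v (hnK y hy u hu) (hnK z hz v hv) huv
  have hab0 : r (g (Sum.inl a0)) = r (g (Sum.inr b0)) := hcross _ _ ha0 hb0 (by simp)
  have hall : ∀ z, ¬ P z → ∀ x ∈ φ z, r x = r (g (Sum.inl a0)) := by
    intro z hz x hx
    rw [hconst z hz x hx _ (hg z)]
    rcases z with a | b
    · rw [hab0]; exact hcross _ _ hz hb0 (by simp)
    · exact hcross _ _ hz ha0 (by simp)
  cases h0 : r (g (Sum.inl a0)) with
  | some j =>
    rw [h0] at hall
    have h1 : (Finset.univ : Finset (Fin s ⊕ Fin t)).card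
        ≤ (K ∪ Finset.univ.filter (fun w => r w = some j)).card := by
      refine Finset.card_le_card_of_injOn g (fun z _ => ?_) hginj.injOn
      simp only [Finset.coe_union, Set.mem_union, Finset.mem_coe, Finset.mem_filter,
        Finset.mem_univ, true_and]
      by_cases hz : P z
      · exact Or.inl (hgK z hz)
      · exact Or.inr (hall z hz _ (hg z))
    have h2 := Finset.card_union_le K (Finset.univ.filter (fun w => r w = some j))
    have h3 := hr j
    simp only [Finset.card_univ, Fintype.card_sum, Fintype.card_fin] at h1
    omega
  | none =>
    rw [h0] at hall
    apply hG
    have hsub : ∀ z, (if P z then {g z} else φ z) ⊆ φ z := by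
      intro z
      split_ifs
      · simpa using hg z
      · exact subset_rfl
    refine ⟨fun z => if P z then {g z} else φ z, ?_, ?_, ?_⟩
    · intro z
      change (G.induce (if P z then {g z} else φ z)).Connected
      by_cases hz : P z
      · rw [if_pos hz]; exact conn_single G _
      · rw [if_neg hz]
        refine (hc z).mono ?_
        intro u v huv
        have huv' : (swapG G K r).Adj u.1 v.1 := huv
        rcases huv'.2 with h | h | h
        · exact absurd h (hnK z hz _ u.2)
        · exact absurd h (hnK z hz _ v.2)
        · exact h.2 (hall z hz _ u.2)
    · intro y z hyz
      exact (hd hyz).mono (hsub y) (hsub z)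
    · intro y z hyz
      have hyz' : y ≠ z := hyz.ne
      have key : ∀ u ∈ φ y, ∀ v ∈ φ z, u ≠ v := fun u hu v hv h =>
        Set.disjoint_left.1 (hd hyz') hu (h ▸ hv)
      by_cases hy : P y
      · refine ⟨g y, by simp [hy], ?_⟩
        by_cases hz : P z
        · exact ⟨g z, by simp [hz], hD.adj (hgK y hy) (key _ (hg y) _ (hg z))⟩
        · exact ⟨g z, by simp [hz, hg z], hD.adj (hgK y hy) (key _ (hg y) _ (hg z))⟩
      · by_cases hz : P z
        · exact ⟨g y, by simp [hy, hg y], g z, by simp [hz],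
            (hD.adj (hgK z hz) (key _ (hg y) _ (hg z)).symm).symm⟩
        · obtain ⟨u, hu, v, hv, huv⟩ := hadj y z hyz
          refine ⟨u, by simpa [hy] using hu, v, by simpa [hz] using hv, ?_⟩
          rcases huv.2 with h | h | h
          · exact absurd h (hnK y hy _ hu)
          · exact absurd h (hnK z hz _ hv)
          · exact h.2 (hall y hy _ hu)

theorem adjMat_apply {V : Type} [Fintype V] (G : SimpleGraph V) (u v : V) [Decidable (G.Adj u v)] :
    adjMat G u v = if G.Adj u v then 1 else 0 := by
  simp only [adjMat, SimpleGraph.adjMatrix_apply]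
  congr

theorem psd_specRad {V : Type} [Fintype V] [DecidableEq V] (G : SimpleGraph V) :
    (specRad G • (1 : Matrix V V ℝ) - adjMat G).PosSemidef := by
  have hA := adjMat_herm G
  set U := hA.eigenvectorUnitary with hU
  have h1 := hA.spectral_theorem
  rw [Unitary.conjStarAlgAut_apply] at h1
  have h2 : specRad G • (1 : Matrix V V ℝ) - adjMat G
      = (U : Matrix V V ℝ) * (Matrix.diagonal (fun i => specRad G - hA.eigenvalues i))
        * (U : Matrix V V ℝ).conjTranspose := by
    have h3 : (Matrix.diagonal (fun i => specRad G - hA.eigenvalues i) : Matrix V V ℝ)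
        = specRad G • (1 : Matrix V V ℝ) - Matrix.diagonal (RCLike.ofReal ∘ hA.eigenvalues) := by
      ext i j
      by_cases h : i = j
      · subst h; simp
      · simp [h]
    have h4 : (U : Matrix V V ℝ) * (U : Matrix V V ℝ).conjTranspose = 1 :=
      Unitary.mul_star_self_of_mem U.2
    rw [h3, mul_sub, sub_mul]
    simp only [mul_smul_comm, mul_one, smul_mul_assoc, h4]
    congr 1
  rw [h2]
  refine Matrix.PosSemidef.mul_mul_conjTranspose_same (Matrix.PosSemidef.diagonal ?_) _
  intro i
  simp only [Pi.zero_apply, sub_nonneg]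
  exact le_ciSup (Set.finite_range _).bddAbove i

theorem quad_le {V : Type} [Fintype V] [DecidableEq V] (G : SimpleGraph V) (x : V → ℝ) :
    ∑ u, ∑ v, adjMat G u v * x u * x v ≤ specRad G * ∑ u, x u ^ 2 := by
  have h := (psd_specRad G).dotProduct_mulVec_nonneg x
  rw [Matrix.sub_mulVec, dotProduct_sub, Matrix.smul_mulVec, Matrix.one_mulVec] at h
  simp only [dotProduct, Matrix.mulVec, Pi.smul_apply, smul_eq_mul, star_trivial, Finset.mul_sum]
    at h
  have e1 : ∑ u, x u * (specRad G * x u) = specRad G * ∑ u, x u ^ 2 := by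
    rw [Finset.mul_sum]; exact Finset.sum_congr rfl (fun _ _ => by ring)
  have e2 : ∑ u, ∑ v, x u * (adjMat G u v * x v) = ∑ u, ∑ v, adjMat G u v * x u * x v :=
    Finset.sum_congr rfl (fun _ _ => Finset.sum_congr rfl (fun _ _ => by ring))
  rw [e1, e2] at h
  linarith

theorem perron {V : Type} [Fintype V] [DecidableEq V] [Nonempty V] (G : SimpleGraph V) :
    ∃ x : V → ℝ, (∀ v, 0 ≤ x v) ∧ (∃ v, x v ≠ 0) ∧
      ∀ u, ∑ v, adjMat G u v * x v = specRad G * x u := by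
  classical
  have hA := adjMat_herm G
  obtain ⟨i, hi⟩ := exists_eq_ciSup_of_finite (f := hA.eigenvalues)
  have hi' : hA.eigenvalues i = specRad G := hi
  let z : V → ℝ := fun v => hA.eigenvectorBasis i v
  have hz : ∀ u, ∑ v, adjMat G u v * z v = specRad G * z u := by
    intro u
    have := congrFun (hA.mulVec_eigenvectorBasis i) u
    rw [hi'] at this
    simpa [Matrix.mulVec, dotProduct, z] using this
  have hz0 : ∃ v, z v ≠ 0 := by
    by_contra! h
    have h1 : hA.eigenvectorBasis i = 0 := by
      ext v; exact h v
    have h2 := hA.eigenvectorBasis.orthonormal.1 i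
    rw [h1] at h2
    simp at h2
  let x : V → ℝ := fun v => |z v|
  refine ⟨x, fun v => abs_nonneg _, ?_, ?_⟩
  · obtain ⟨v, hv⟩ := hz0
    exact ⟨v, abs_ne_zero.2 hv⟩
  · have hnn : ∀ u v, 0 ≤ adjMat G u v := by
      intro u v; rw [adjMat_apply]; split_ifs <;> norm_num
    have h1 : specRad G * ∑ u, x u ^ 2 ≤ ∑ u, ∑ v, adjMat G u v * x u * x v := by
      have : specRad G * ∑ u, x u ^ 2 = ∑ u, ∑ v, adjMat G u v * z u * z v := by
        rw [Finset.mul_sum]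
        refine Finset.sum_congr rfl (fun u _ => ?_)
        have e : ∑ v, adjMat G u v * z u * z v = z u * ∑ v, adjMat G u v * z v := by
          rw [Finset.mul_sum]; exact Finset.sum_congr rfl (fun _ _ => by ring)
        rw [e, hz u]
        simp only [x, sq_abs]; ring
      rw [this]
      refine Finset.sum_le_sum (fun u _ => Finset.sum_le_sum (fun v _ => ?_))
      rw [mul_assoc, mul_assoc]
      refine mul_le_mul_of_nonneg_left ?_ (hnn u v)
      simp only [x, ← abs_mul]
      exact le_abs_self _
    have h2 := le_antisymm h1 (quad_le G x)
    have h3 := ((psd_specRad G).dotProduct_mulVec_zero_iff x).1 (by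
      rw [Matrix.sub_mulVec, dotProduct_sub, Matrix.smul_mulVec, Matrix.one_mulVec]
      simp only [dotProduct, Matrix.mulVec, Pi.smul_apply, smul_eq_mul, star_trivial,
        Finset.mul_sum]
      have e1 : ∑ u, x u * (specRad G * x u) = specRad G * ∑ u, x u ^ 2 := by
        rw [Finset.mul_sum]; exact Finset.sum_congr rfl (fun _ _ => by ring)
      have e2 : ∑ u, ∑ v, x u * (adjMat G u v * x v) = ∑ u, ∑ v, adjMat G u v * x u * x v :=
        Finset.sum_congr rfl (fun _ _ => Finset.sum_congr rfl (fun _ _ => by ring))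
      rw [e1, e2, h2, sub_self])
    intro u
    have h4 := congrFun h3 u
    rw [Matrix.sub_mulVec, Matrix.smul_mulVec, Matrix.one_mulVec] at h4
    simp only [Matrix.mulVec, dotProduct, Pi.sub_apply, Pi.smul_apply, smul_eq_mul,
      Pi.zero_apply] at h4
    linarith

/-- a dominating vertex forces a large spectral radius -/
theorem specRad_ge {V : Type} [Fintype V] [DecidableEq V] (G : SimpleGraph V) (k : V)
    (hk : ∀ v, v ≠ k → G.Adj k v) (c : ℝ) (hc : 0 < c) (hn : c ^ 2 + 1 ≤ Fintype.card V) :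
    c ≤ specRad G := by
  classical
  let x : V → ℝ := fun v => if v = k then c else 1
  have hnn : ∀ u v, 0 ≤ adjMat G u v := by
    intro u v; rw [adjMat_apply]; split_ifs <;> norm_num
  have h1 := quad_le G x
  have hcard : ((Finset.univ.erase k).card : ℝ) = Fintype.card V - 1 := by
    rw [Finset.card_erase_of_mem (Finset.mem_univ _), Finset.card_univ,
      Nat.cast_sub (Fintype.card_pos_iff.2 ⟨k⟩)]
    simp
  have h2 : ∑ u, x u ^ 2 = c ^ 2 + (Fintype.card V - 1) := by
    rw [← Finset.add_sum_erase _ _ (Finset.mem_univ k)]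
    rw [Finset.sum_congr rfl (g := fun _ => (1 : ℝ))
      (fun u hu => by simp [x, Finset.ne_of_mem_erase hu])]
    simp [x, ← hcard]
  have hrow : ∀ u, 0 ≤ ∑ v, adjMat G u v * x u * x v := by
    intro u
    refine Finset.sum_nonneg (fun v _ => mul_nonneg (mul_nonneg (hnn u v) ?_) ?_)
    · simp only [x]; split_ifs <;> linarith
    · simp only [x]; split_ifs <;> linarith
  have h3 : 2 * c * (Fintype.card V - 1) ≤ ∑ u, ∑ v, adjMat G u v * x u * x v := by
    rw [← Finset.add_sum_erase _ _ (Finset.mem_univ k)]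
    have ha : c * (Fintype.card V - 1) = ∑ v, adjMat G k v * x k * x v := by
      rw [← Finset.add_sum_erase _ _ (Finset.mem_univ k)]
      rw [Finset.sum_congr rfl (g := fun _ => c) (s₁ := Finset.univ.erase k)
        (fun u hu => by
          have := Finset.ne_of_mem_erase hu
          simp [x, this, adjMat_apply, hk u this])]
      rw [adjMat_apply]
      rw [Finset.sum_const, nsmul_eq_mul, hcard]
      simp; ring
    have hb : c * (Fintype.card V - 1)
        ≤ ∑ u ∈ Finset.univ.erase k, ∑ v, adjMat G u v * x u * x v := by
      have : ∑ u ∈ Finset.univ.erase k, c = c * (Fintype.card V - 1) := by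
        rw [Finset.sum_const, nsmul_eq_mul, hcard]; ring
      rw [← this]
      refine Finset.sum_le_sum (fun u hu => ?_)
      have hu' := Finset.ne_of_mem_erase hu
      have : adjMat G u k * x u * x k = c := by
        simp [x, hu', adjMat_apply, (hk u hu').symm]
      rw [← this]
      refine Finset.single_le_sum (f := fun v => adjMat G u v * x u * x v) (fun v _ => ?_)
        (Finset.mem_univ k)
      refine mul_nonneg (mul_nonneg (hnn u v) ?_) ?_
      · simp only [x]; split_ifs <;> linarith
      · simp only [x]; split_ifs <;> linarith
    linarith
  rw [h2] at h1
  have h4 := h3.trans h1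
  by_contra hlt
  push Not at hlt
  have h5 : specRad G * (c ^ 2 + (Fintype.card V - 1)) < c * (c ^ 2 + (Fintype.card V - 1)) :=
    mul_lt_mul_of_pos_right hlt (by nlinarith)
  nlinarith

open Classical in
theorem swap_quad {n t : ℕ} {G : SimpleGraph (Fin n)} {K : Finset (Fin n)}
    (hD : DomClique G K) (W : Finset (Fin n)) (hWK : Disjoint W K)
    (hcl : ∀ u ∈ W, ∀ v, v ∉ K → G.Adj u v → v ∈ W)
    (r : Fin n → Option ℕ) (hr : ∀ v, r v = none ↔ v ∉ W)
    (hrc : ∀ v ∈ W, (Finset.univ.filter (fun w => r w = r v)).card = t)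
    (x : Fin n → ℝ) (m M : ℝ) (hm : 0 ≤ m) (hx : ∀ v ∈ W, m ≤ x v ∧ x v ≤ M)
    (hlt : ((∑ u ∈ W, (W.filter (fun w => G.Adj u w)).card : ℕ) : ℝ) * M ^ 2
      < ((W.card * (t - 1) : ℕ) : ℝ) * m ^ 2) :
    ∑ u, ∑ v, adjMat G u v * x u * x v
      < ∑ u, ∑ v, adjMat (swapG G K r) u v * x u * x v := by
  have hWK' : ∀ v ∈ W, v ∉ K := fun v hv => Finset.disjoint_left.1 hWK hv
  -- entries agree outside W × W
  have hagree : ∀ u v, ¬ (u ∈ W ∧ v ∈ W) → adjMat (swapG G K r) u v = adjMat G u v := by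
    intro u v huv
    rw [adjMat_apply, adjMat_apply]
    have : (swapG G K r).Adj u v ↔ G.Adj u v := by
      rw [swapG_adj]
      constructor
      · rintro ⟨hne, h | h | ⟨h1, h2⟩⟩
        · exact hD.adj h hne
        · exact (hD.adj h hne.symm).symm
        · apply h2
          by_contra h3
          have hu : u ∈ W := by
            by_contra h4; exact h3 ((hr u).2 h4)
          have hv : v ∈ W := by
            by_contra h4; exact h3 (h1.trans ((hr v).2 h4))
          exact huv ⟨hu, hv⟩
      · intro h
        refine ⟨h.ne, ?_⟩
        by_cases hu : u ∈ K
        · exact Or.inl hu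
        by_cases hv : v ∈ K
        · exact Or.inr (Or.inl hv)
        have huW : u ∉ W := fun hh => huv ⟨hh, hcl u hh v hv h⟩
        have hvW : v ∉ W := fun hh => huv ⟨hcl v hh u hu h.symm, hh⟩
        exact Or.inr (Or.inr ⟨((hr u).2 huW).trans ((hr v).2 hvW).symm, fun _ => h⟩)
    simp only [this]
  have hdiff : ∑ u, ∑ v, adjMat (swapG G K r) u v * x u * x v
      - ∑ u, ∑ v, adjMat G u v * x u * x v
      = ∑ u ∈ W, ∑ v ∈ W, adjMat (swapG G K r) u v * x u * x v
      - ∑ u ∈ W, ∑ v ∈ W, adjMat G u v * x u * x v := by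
    simp only [← Finset.sum_sub_distrib]
    symm
    refine (Finset.sum_congr rfl (fun u hu => ?_)).trans
      (Finset.sum_subset (Finset.subset_univ W) (fun u _ hu => ?_))
    · refine Finset.sum_subset (Finset.subset_univ W) (fun v _ hv => ?_)
      rw [hagree u v (fun h => hv h.2), sub_self]
    · refine Finset.sum_eq_zero (fun v _ => ?_)
      rw [hagree u v (fun h => hu h.1), sub_self]
  have hnn : ∀ (H : SimpleGraph (Fin n)) u v, 0 ≤ adjMat H u v := by
    intro H u v; rw [adjMat_apply]; split_ifs <;> norm_num
  have hG : ∑ u ∈ W, ∑ v ∈ W, adjMat G u v * x u * x v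
      ≤ ((∑ u ∈ W, (W.filter (fun w => G.Adj u w)).card : ℕ) : ℝ) * M ^ 2 := by
    have : ((∑ u ∈ W, (W.filter (fun w => G.Adj u w)).card : ℕ) : ℝ) * M ^ 2
        = ∑ u ∈ W, ∑ v ∈ W, adjMat G u v * (M * M) := by
      rw [Nat.cast_sum, Finset.sum_mul]
      refine Finset.sum_congr rfl (fun u _ => ?_)
      rw [← Finset.sum_mul, Finset.card_filter, Nat.cast_sum, sq]
      congr 1
      exact Finset.sum_congr rfl (fun v _ => by rw [adjMat_apply]; split_ifs <;> simp)
    rw [this]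
    refine Finset.sum_le_sum (fun u hu => Finset.sum_le_sum (fun v hv => ?_))
    rw [mul_assoc]
    refine mul_le_mul_of_nonneg_left ?_ (hnn G u v)
    exact mul_le_mul (hx u hu).2 (hx v hv).2 (hm.trans (hx v hv).1)
      (hm.trans ((hx u hu).1.trans (hx u hu).2))
  have hG' : ((W.card * (t - 1) : ℕ) : ℝ) * m ^ 2
      ≤ ∑ u ∈ W, ∑ v ∈ W, adjMat (swapG G K r) u v * x u * x v := by
    have hrow : ∀ u ∈ W, ∑ v ∈ W, adjMat (swapG G K r) u v = ((t - 1 : ℕ) : ℝ) := by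
      intro u hu
      have h1 : (W.filter (fun v => (swapG G K r).Adj u v)).card = t - 1 := by
        have : W.filter (fun v => (swapG G K r).Adj u v)
            = (Finset.univ.filter (fun w => r w = r u)).erase u := by
          ext v
          simp only [Finset.mem_filter, Finset.mem_erase, Finset.mem_univ, true_and, swapG_adj]
          have hu' : r u ≠ none := fun h => (hr u).1 h hu
          constructor
          · rintro ⟨hv, hne, h | h | ⟨h, _⟩⟩
            · exact absurd h (hWK' u hu)
            · exact absurd h (hWK' v hv)
            · exact ⟨hne.symm, h.symm⟩
          · rintro ⟨hne, h⟩
            refine ⟨?_, hne.symm, Or.inr (Or.inr ⟨h.symm, fun h' => absurd h' hu'⟩)⟩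
            by_contra hv
            exact hu' (h.symm.trans ((hr v).2 hv))
        rw [this, Finset.card_erase_of_mem (by simp), hrc u hu]
      rw [← h1, Finset.card_filter, Nat.cast_sum]
      exact Finset.sum_congr rfl (fun v _ => by rw [adjMat_apply]; split_ifs <;> simp)
    have : ((W.card * (t - 1) : ℕ) : ℝ) * m ^ 2
        = ∑ u ∈ W, ∑ v ∈ W, adjMat (swapG G K r) u v * (m * m) := by
      rw [Finset.sum_congr rfl (fun u hu => by rw [← Finset.sum_mul, hrow u hu]),
        Finset.sum_const, nsmul_eq_mul]
      push_cast; ring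
    rw [this]
    refine Finset.sum_le_sum (fun u hu => Finset.sum_le_sum (fun v hv => ?_))
    rw [mul_assoc]
    refine mul_le_mul_of_nonneg_left ?_ (hnn _ u v)
    exact mul_le_mul (hx u hu).1 (hx v hv).1 hm (hm.trans (hx u hu).1)
  linarith

/-- labelling of a set of size `i * t` by blocks of size `t` -/
theorem exists_label {n t i : ℕ} (W : Finset (Fin n)) (hW : W.card = i * t) :
    ∃ r : Fin n → Option ℕ, (∀ v, r v = none ↔ v ∉ W) ∧
      (∀ v ∈ W, (Finset.univ.filter (fun w => r w = r v)).card = t) ∧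
      (∀ j, (Finset.univ.filter (fun w => r w = some j)).card ≤ t) := by
  classical
  have e : W ≃ Fin i × Fin t := Fintype.equivOfCardEq (by simp [hW])
  let r : Fin n → Option ℕ := fun v => if h : v ∈ W then some ((e ⟨v, h⟩).1 : ℕ) else none
  have hr1 : ∀ v, r v = none ↔ v ∉ W := by
    intro v
    by_cases h : v ∈ W <;> simp [r, h]
  have hmem : ∀ w j, r w = some j → ∃ h : w ∈ W, ((e ⟨w, h⟩).1 : ℕ) = j := by
    intro w j h
    by_cases hw : w ∈ W
    · refine ⟨hw, ?_⟩
      simpa [r, hw] using h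
    · simp [r, hw] at h
  have hfib : ∀ j : Fin i, (Finset.univ.filter (fun w => r w = some (j : ℕ))).card = t := by
    intro j
    have : Finset.univ.filter (fun w => r w = some (j : ℕ))
        = (Finset.univ : Finset (Fin t)).image (fun a => ((e.symm (j, a) : W) : Fin n)) := by
      ext w
      simp only [Finset.mem_filter, Finset.mem_univ, true_and, Finset.mem_image]
      constructor
      · intro h
        obtain ⟨hw, h⟩ := hmem w _ h
        refine ⟨(e ⟨w, hw⟩).2, ?_⟩
        have : (j, (e ⟨w, hw⟩).2) = e ⟨w, hw⟩ := Prod.ext (Fin.ext h.symm) rfl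
        rw [this, e.symm_apply_apply]
      · rintro ⟨a, rfl⟩
        simp [r]
    rw [this, Finset.card_image_of_injective, Finset.card_univ, Fintype.card_fin]
    intro a b hab
    have := e.symm.injective (Subtype.ext hab)
    exact (Prod.mk.inj this).2
  refine ⟨r, hr1, ?_, ?_⟩
  · intro v hv
    have h : r v = some ((e ⟨v, hv⟩).1 : ℕ) := by simp [r, hv]
    rw [h]
    exact hfib _
  · intro j
    by_cases hj : j < i
    · exact (hfib ⟨j, hj⟩).le
    · have : Finset.univ.filter (fun w => r w = some j) = ∅ := by
        refine Finset.filter_eq_empty_iff.2 (fun w _ h => ?_)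
        obtain ⟨hw, h⟩ := hmem w j h
        exact hj (h ▸ (e ⟨w, hw⟩).1.2)
      rw [this]; simp

theorem num_ineq (D τ ρ m M S : ℝ) (hD : 0 ≤ D) (hτ : 0 ≤ τ) (hρ : 2 * (D + 1) * τ < ρ)
    (hρτ : τ < ρ) (hm : 0 < m) (hM : 0 ≤ M) (hS : S = m * ρ) (hMS : M * (ρ - τ) ≤ S) :
    D * M ^ 2 < (D + 1) * m ^ 2 := by
  have hq : 0 < ρ - τ := by linarith
  have h1 : (M * (ρ - τ)) ^ 2 ≤ (m * ρ) ^ 2 := by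
    rw [← hS]
    exact pow_le_pow_left₀ (mul_nonneg hM hq.le) hMS 2
  have h2 : D * ρ ^ 2 < (D + 1) * (ρ - τ) ^ 2 := by
    have : 0 < ρ * (ρ - 2 * (D + 1) * τ) := mul_pos (by linarith) (by linarith)
    nlinarith [sq_nonneg τ, mul_nonneg hD (sq_nonneg τ)]
  have h3 : D * M ^ 2 * (ρ - τ) ^ 2 < (D + 1) * m ^ 2 * (ρ - τ) ^ 2 := by
    have a1 : D * (M * (ρ - τ)) ^ 2 ≤ D * (m * ρ) ^ 2 := mul_le_mul_of_nonneg_left h1 hD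
    have a2 : m ^ 2 * (D * ρ ^ 2) < m ^ 2 * ((D + 1) * (ρ - τ) ^ 2) :=
      mul_lt_mul_of_pos_left h2 (by positivity)
    nlinarith
  exact lt_of_mul_lt_mul_right h3 (sq_nonneg _)

open Classical in
/-- bounds on the Perron vector outside `K` -/
theorem perron_bounds {n s t : ℕ} (hs : 2 ≤ s) (ht : 1 ≤ t) {G : SimpleGraph (Fin n)}
    {K : Finset (Fin n)} (hK : K.card = s - 1) (hD : DomClique G K)
    (hG : ¬ MinorOf (completeBipartiteGraph (Fin s) (Fin t)) G)
    (hρ : (t : ℝ) < specRad G) (w0 : Fin n) (hw0 : w0 ∉ K) :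
    ∃ (x : Fin n → ℝ) (m M : ℝ), 0 < m ∧ 0 ≤ M ∧
      (∀ u, ∑ v, adjMat G u v * x v = specRad G * x u) ∧
      (∀ v, v ∉ K → m ≤ x v ∧ x v ≤ M) ∧
      M * (specRad G - ((t - 1 : ℕ) : ℝ)) ≤ m * specRad G := by
  have : Nonempty (Fin n) := ⟨w0⟩
  obtain ⟨x, hx0, ⟨v0, hv0⟩, hx⟩ := perron G
  have hρ0 : 0 < specRad G := lt_of_le_of_lt (Nat.cast_nonneg t) hρ
  have hnn : ∀ u v, 0 ≤ adjMat G u v := by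
    intro u v; rw [adjMat_apply]; split_ifs <;> norm_num
  set S := ∑ k ∈ K, x k with hSdef
  have hsplit : ∀ v, v ∉ K → specRad G * x v = S + ∑ w ∈ Kᶜ, adjMat G v w * x w := by
    intro v hv
    rw [← hx v, ← Finset.sum_add_sum_compl K, hSdef]
    congr 1
    refine Finset.sum_congr rfl (fun k hk => ?_)
    rw [adjMat_apply, if_pos (hD.dom v hv k hk).symm, one_mul]
  have hS0 : 0 ≤ S := Finset.sum_nonneg (fun k _ => hx0 k)
  have hSpos : 0 < S := by
    refine lt_of_le_of_ne hS0 (fun h => ?_)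
    obtain ⟨k, hk⟩ : K.Nonempty := by rw [← Finset.card_pos]; omega
    have hz : ∀ k ∈ K, x k = 0 := (Finset.sum_eq_zero_iff_of_nonneg (fun k _ => hx0 k)).1 h.symm
    have h1 := hx k
    rw [hz k hk, mul_zero] at h1
    have h2 := (Finset.sum_eq_zero_iff_of_nonneg
      (fun v _ => mul_nonneg (hnn k v) (hx0 v))).1 h1 v0 (Finset.mem_univ _)
    have hne : k ≠ v0 := fun e => hv0 (e ▸ hz k hk)
    rw [adjMat_apply, if_pos (hD.adj hk hne), one_mul] at h2
    exact hv0 h2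
  obtain ⟨w, hw, hmax⟩ := Finset.exists_max_image (Kᶜ) x ⟨w0, by simpa using hw0⟩
  have hwK : w ∉ K := by simpa using hw
  refine ⟨x, S / specRad G, x w, div_pos hSpos hρ0, hx0 w, hx, ?_, ?_⟩
  · intro v hv
    refine ⟨?_, hmax v (by simpa using hv)⟩
    rw [div_le_iff₀ hρ0, mul_comm, hsplit v hv]
    have : 0 ≤ ∑ w ∈ Kᶜ, adjMat G v w * x w :=
      Finset.sum_nonneg (fun w _ => mul_nonneg (hnn v w) (hx0 w))
    linarith
  · rw [div_mul_cancel₀ _ hρ0.ne']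
    have h1 := hsplit w hwK
    have h2 : ∑ v ∈ Kᶜ, adjMat G w v * x v ≤ ((t - 1 : ℕ) : ℝ) * x w := by
      have h3 : ∑ v ∈ Kᶜ, adjMat G w v * x v ≤ ∑ v ∈ Kᶜ, adjMat G w v * x w :=
        Finset.sum_le_sum (fun v hv => mul_le_mul_of_nonneg_left (hmax v hv) (hnn w v))
      refine h3.trans ?_
      rw [← Finset.sum_mul]
      refine mul_le_mul_of_nonneg_right ?_ (hx0 w)
      have h4 := deg_le hs ht hK hD hG Kᶜ (Finset.disjoint_left.2 (by simp)) w hwK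
      have h5 : ∑ v ∈ Kᶜ, adjMat G w v = ((Kᶜ.filter (fun v => G.Adj w v)).card : ℝ) := by
        rw [Finset.card_filter, Nat.cast_sum]
        exact Finset.sum_congr rfl (fun v _ => by rw [adjMat_apply]; split_ifs <;> simp)
      rw [h5]
      exact_mod_cast h4
    linarith

open Classical in
/-- union of `t` components of order `i` -/
theorem exists_W {n s t i : ℕ} (hs : 2 ≤ s) (ht : 4 ≤ t) {G : SimpleGraph (Fin n)}
    {K : Finset (Fin n)} (hK : K.card = s - 1) (hD : DomClique G K)
    (hG : ¬ MinorOf (completeBipartiteGraph (Fin s) (Fin t)) G)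
    (hi1 : 1 ≤ i) (hi2 : i ≤ t + 3) (hit : i ≠ t)
    (hmany : t ≤ {c : (G.comap (Subtype.val : {v : Fin n // v ∉ K} → Fin n)).ConnectedComponent |
          c.supp.ncard = i}.ncard) :
    ∃ W : Finset (Fin n), Disjoint W K ∧ W.card = i * t ∧
      (∀ u ∈ W, ∀ v, v ∉ K → G.Adj u v → v ∈ W) ∧
      ∑ u ∈ W, (W.filter (fun w => G.Adj u w)).card + 1 ≤ W.card * (t - 1) := by
  set H := G.comap (Subtype.val : {v : Fin n // v ∉ K} → Fin n) with hH
  obtain ⟨T0, hT0, hT0c⟩ := Set.exists_subset_card_eq hmany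
  have hfin : T0.Finite := Set.toFinite T0
  let T : Finset H.ConnectedComponent := hfin.toFinset
  have hTc : T.card = t := by rw [← hT0c, Set.ncard_eq_toFinset_card T0 hfin]
  have hTi : ∀ c ∈ T, c.supp.ncard = i := fun c hc => hT0 (by simpa [T] using hc)
  let F : H.ConnectedComponent → Finset (Fin n) := fun c =>
    (Finset.univ.filter (fun v => v ∈ c.supp)).map (Function.Embedding.subtype _)
  have hF : ∀ c v, v ∈ F c ↔ ∃ h : v ∉ K, H.connectedComponentMk ⟨v, h⟩ = c := by
    intro c v
    simp [F]
  have hFc : ∀ c ∈ T, (F c).card = i := by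
    intro c hc
    rw [Finset.card_map, ← hTi c hc, Set.ncard_eq_toFinset_card' c.supp]
    congr 1
    ext v
    simp
  have hFK : ∀ c, Disjoint (F c) K := by
    intro c
    rw [Finset.disjoint_left]
    intro v hv
    exact ((hF c v).1 hv).1
  have hFd : ∀ c ∈ T, ∀ d ∈ T, c ≠ d → Disjoint (F c) (F d) := by
    intro c _ d _ hcd
    rw [Finset.disjoint_left]
    intro v hv hv'
    obtain ⟨h1, h2⟩ := (hF c v).1 hv
    obtain ⟨h3, h4⟩ := (hF d v).1 hv'
    exact hcd (h2.symm.trans h4)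
  have hFcl : ∀ c, ∀ u ∈ F c, ∀ v, v ∉ K → G.Adj u v → v ∈ F c := by
    intro c u hu v hv huv
    obtain ⟨h1, h2⟩ := (hF c u).1 hu
    refine (hF c v).2 ⟨hv, ?_⟩
    rw [← h2]
    have : H.Adj ⟨v, hv⟩ ⟨u, h1⟩ := huv.symm
    exact SimpleGraph.ConnectedComponent.sound this.reachable
  let W := T.biUnion F
  have hWc : W.card = i * t := by
    rw [Finset.card_biUnion hFd, Finset.sum_congr rfl hFc, Finset.sum_const, hTc, smul_eq_mul,
      mul_comm]
  have hWK : Disjoint W K := (Finset.disjoint_biUnion_left _ _ _).2 (fun c _ => hFK c)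
  refine ⟨W, hWK, hWc, ?_, ?_⟩
  · intro u hu v hv huv
    obtain ⟨c, hc, hu⟩ := Finset.mem_biUnion.1 hu
    exact Finset.mem_biUnion.2 ⟨c, hc, hFcl c u hu v hv huv⟩
  · have hsum : ∑ u ∈ W, (W.filter (fun w => G.Adj u w)).card
        = ∑ c ∈ T, ∑ u ∈ F c, ((F c).filter (fun w => G.Adj u w)).card := by
      rw [Finset.sum_biUnion hFd]
      refine Finset.sum_congr rfl (fun c hc => Finset.sum_congr rfl (fun u hu => ?_))
      congr 1
      ext v
      simp only [Finset.mem_filter]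
      constructor
      · rintro ⟨hv, huv⟩
        exact ⟨hFcl c u hu v (Finset.disjoint_left.1 hWK hv) huv, huv⟩
      · rintro ⟨hv, huv⟩
        exact ⟨Finset.mem_biUnion.2 ⟨c, hc, hv⟩, huv⟩
    have hlt : ∑ c ∈ T, ∑ u ∈ F c, ((F c).filter (fun w => G.Adj u w)).card
        < ∑ c ∈ T, i * (t - 1) := by
      refine Finset.sum_lt_sum_of_nonempty (by rw [← Finset.card_pos]; omega) (fun c hc => ?_)
      exact degsum_lt hs ht hK hD hG (F c) (hFK c) (hFc c hc) hi1 hi2 hit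
    rw [hsum, hWc]
    rw [Finset.sum_const, hTc, smul_eq_mul] at hlt
    calc _ ≤ t * (i * (t - 1)) := hlt
      _ = i * t * (t - 1) := by ring

/-- Lemma 3.5: for i ≠ t, fewer than t components of G⋆ − K have exactly i vertices. -/
theorem few_components_of_order_ne_t (s t : ℕ) (ht : 4 ≤ t) (hs : 2 ≤ s) (hst : s ≤ t) :
    ∃ n₀ : ℕ, ∀ n : ℕ, n₀ ≤ n →
    ∀ (G : SimpleGraph (Fin n)) (K : Finset (Fin n)),
      ¬ MinorOf (completeBipartiteGraph (Fin s) (Fin t)) G →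
      (∀ G' : SimpleGraph (Fin n),
        ¬ MinorOf (completeBipartiteGraph (Fin s) (Fin t)) G' → specRad G' ≤ specRad G) →
      K.card = s - 1 → G.IsClique (↑K : Set (Fin n)) →
      (∀ v : Fin n, v ∉ K → ∀ u ∈ K, G.Adj u v) →
      ∀ i : ℕ, 1 ≤ i → i ≤ t + 3 → i ≠ t →
        {c : (G.comap (Subtype.val : {v : Fin n // v ∉ K} → Fin n)).ConnectedComponent |
          c.supp.ncard = i}.ncard < t := by
  refine ⟨(2 * (t * (t + 3) * t + 1) * t + t) ^ 2 + 1, ?_⟩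
  intro n hn G K hG hmax hK hcl hdom i hi1 hi2 hit
  by_contra hcon
  have hD : DomClique G K := ⟨hcl, hdom⟩
  classical
  obtain ⟨W, hWK, hWc, hWcl, hWsum⟩ := exists_W hs ht hK hD hG hi1 hi2 hit (not_lt.1 hcon)
  obtain ⟨r, hr1, hr2, hr3⟩ := exists_label W hWc
  obtain ⟨w0, hw0⟩ : W.Nonempty := by
    rw [← Finset.card_pos, hWc]; exact Nat.mul_pos (by omega) (by omega)
  obtain ⟨k, hk⟩ : K.Nonempty := by rw [← Finset.card_pos]; omega
  have ht0 : (0 : ℝ) < t := by exact_mod_cast (by omega : 0 < t)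
  have hρ : 2 * ((t : ℝ) * (t + 3) * t + 1) * t + t ≤ specRad G := by
    refine specRad_ge G k (fun v hv => hD.adj hk hv.symm) _ (by positivity) ?_
    rw [Fintype.card_fin]
    exact_mod_cast hn
  have hρt : (t : ℝ) < specRad G := by
    have : 0 < 2 * ((t : ℝ) * (t + 3) * t + 1) * t := by positivity
    linarith
  obtain ⟨x, m, M, hm, hM, hx, hb, hMm⟩ := perron_bounds hs (by omega) hK hD hG hρt w0
    (Finset.disjoint_left.1 hWK hw0)
  set D := ∑ u ∈ W, (W.filter (fun w => G.Adj u w)).card with hDdef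
  have hτ : ((t - 1 : ℕ) : ℝ) ≤ t := by exact_mod_cast Nat.sub_le t 1
  have hDN : (D : ℝ) ≤ (t : ℝ) * (t + 3) * t := by
    have h1 : D ≤ t * (t + 3) * t := by
      calc D ≤ W.card * (t - 1) := by omega
        _ ≤ ((t + 3) * t) * t := by
          rw [hWc]
          exact Nat.mul_le_mul (Nat.mul_le_mul_right t hi2) (Nat.sub_le t 1)
        _ = t * (t + 3) * t := by ring
    exact_mod_cast h1
  have hnum : (D : ℝ) * M ^ 2 < (D + 1) * m ^ 2 := by
    refine num_ineq D ((t - 1 : ℕ) : ℝ) (specRad G) m M (m * specRad G) (Nat.cast_nonneg _)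
      (Nat.cast_nonneg _) ?_ (lt_of_le_of_lt hτ hρt) hm hM rfl hMm
    have h1 : 2 * ((D : ℝ) + 1) * ((t - 1 : ℕ) : ℝ) ≤ 2 * ((t : ℝ) * (t + 3) * t + 1) * t :=
      mul_le_mul (by linarith) hτ (Nat.cast_nonneg _) (by positivity)
    linarith
  have hlt : (D : ℝ) * M ^ 2 < ((W.card * (t - 1) : ℕ) : ℝ) * m ^ 2 := by
    refine lt_of_lt_of_le hnum (mul_le_mul_of_nonneg_right ?_ (sq_nonneg m))
    exact_mod_cast hWsum
  have hquad := swap_quad hD W hWK hWcl r hr1 hr2 x m M hm.le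
    (fun v hv => hb v (Finset.disjoint_left.1 hWK hv)) hlt
  have hspec := hmax _ (swap_minor_free hs hst hK hD hG r hr3)
  have h1 := quad_le (swapG G K r) x
  have h2 : ∑ u, ∑ v, adjMat G u v * x u * x v = specRad G * ∑ u, x u ^ 2 := by
    rw [Finset.mul_sum]
    refine Finset.sum_congr rfl (fun u _ => ?_)
    have e : ∑ v, adjMat G u v * x u * x v = x u * ∑ v, adjMat G u v * x v := by
      rw [Finset.mul_sum]; exact Finset.sum_congr rfl (fun _ _ => by ring)
    rw [e, hx u]; ring
  have h3 : specRad (swapG G K r) * ∑ u, x u ^ 2 ≤ specRad G * ∑ u, x u ^ 2 :=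
    mul_le_mul_of_nonneg_right hspec (Finset.sum_nonneg (fun u _ => sq_nonneg _))
  linarith
end

section
/- Let t ≥ 4 and 2 ≤ s ≤ t. There exists n₀ such that for all n ≥ n₀ the following holds: with G⋆ and K as in the extremal setup, every connected component of G⋆ − K has at most t+2 vertices. -/
open SimpleGraph

section PartOne
open Classical

lemma specRad_ge_eig {n : ℕ} (G : SimpleGraph (Fin n)) (i : Fin n) :
    (adjMat_herm G).eigenvalues i ≤ specRad G :=
  le_ciSup (f := fun i => (adjMat_herm G).eigenvalues i) (Set.finite_range _).bddAbove i

lemma adjMat_mulVec {n : ℕ} (G : SimpleGraph (Fin n)) (y : Fin n → ℝ) (i : Fin n) :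
    (adjMat G).mulVec y i = ∑ j, if G.Adj i j then y j else 0 := by
  simp only [Matrix.mulVec, dotProduct, adjMat, SimpleGraph.adjMatrix_apply]
  apply Finset.sum_congr rfl
  intro j _
  split_ifs <;> simp

lemma rayleigh_le {n : ℕ} (G : SimpleGraph (Fin n)) (y : Fin n → ℝ) :
    ∑ i, ∑ j, (if G.Adj i j then y i * y j else 0) ≤ specRad G * ∑ i, y i ^ 2 := by
  set B : Matrix (Fin n) (Fin n) ℝ := specRad G • (1 : Matrix (Fin n) (Fin n) ℝ) - adjMat G with hB
  have hH : B.IsHermitian := by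
    apply Matrix.IsHermitian.sub _ (adjMat_herm G)
    ext i j
    simp [Matrix.one_apply, eq_comm]
  have hP : B.PosSemidef := by
    rw [hH.posSemidef_iff_eigenvalues_nonneg]
    intro i
    have h1 := hH.mulVec_eigenvectorBasis i
    set b : Fin n → ℝ := ⇑(hH.eigenvectorBasis i) with hb
    have hne : hH.eigenvectorBasis i ≠ 0 := hH.eigenvectorBasis.orthonormal.ne_zero i
    have h2 : (adjMat G).mulVec b = (specRad G - hH.eigenvalues i) • b := by
      have h3 : B.mulVec b = specRad G • b - (adjMat G).mulVec b := by
        rw [hB, Matrix.sub_mulVec, Matrix.smul_mulVec, Matrix.one_mulVec]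
      rw [h1] at h3
      rw [sub_smul, h3]; simp
    have h4 : specRad G - hH.eigenvalues i ∈ spectrum ℝ (adjMat G) := by
      rw [← Matrix.spectrum_toLin']
      apply Module.End.HasEigenvalue.mem_spectrum
      apply Module.End.hasEigenvalue_of_hasEigenvector (x := b)
      rw [Module.End.hasEigenvector_iff]
      refine ⟨?_, ?_⟩
      · rw [Module.End.mem_eigenspace_iff]; simpa using h2
      · intro h0
        apply hne
        ext j
        have := congrFun h0 j
        simpa [hb] using this
    rw [(adjMat_herm G).spectrum_real_eq_range_eigenvalues] at h4
    obtain ⟨j, hj⟩ := h4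
    have := specRad_ge_eig G j
    simp only [Pi.zero_apply]
    linarith
  have h := hP.dotProduct_mulVec_nonneg y
  rw [hB, Matrix.sub_mulVec, Matrix.smul_mulVec, Matrix.one_mulVec] at h
  have e1 : star y ⬝ᵥ (specRad G • y - (adjMat G).mulVec y)
      = specRad G * ∑ i, y i ^ 2 - ∑ i, ∑ j, (if G.Adj i j then y i * y j else 0) := by
    simp only [dotProduct, Pi.star_apply, star_trivial, Pi.sub_apply, Pi.smul_apply, adjMat_mulVec,
      smul_eq_mul]
    rw [Finset.mul_sum, ← Finset.sum_sub_distrib]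
    apply Finset.sum_congr rfl
    intro i _
    rw [mul_sub, Finset.mul_sum]
    congr 1
    · ring
    · apply Finset.sum_congr rfl
      intro j _
      split_ifs <;> simp
  rw [e1] at h
  linarith

lemma exists_top_eigvec {n : ℕ} (hn : 0 < n) (G : SimpleGraph (Fin n)) :
    ∃ x : Fin n → ℝ, x ≠ 0 ∧ ∀ i, ∑ j, (if G.Adj i j then x j else 0) = specRad G * x i := by
  haveI : Nonempty (Fin n) := ⟨⟨0, hn⟩⟩
  obtain ⟨i, hi⟩ := exists_eq_ciSup_of_finite (f := fun i => (adjMat_herm G).eigenvalues i)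
  refine ⟨⇑((adjMat_herm G).eigenvectorBasis i), ?_, ?_⟩
  · intro h0
    apply (adjMat_herm G).eigenvectorBasis.orthonormal.ne_zero i
    ext j
    simpa using congrFun h0 j
  · intro j
    rw [← adjMat_mulVec, (adjMat_herm G).mulVec_eigenvectorBasis i, specRad, ← hi]
    simp

end PartOne

section PartTwo
open Classical

lemma star_minor {V : Type} (G : SimpleGraph V) (K : Finset V) (s t : ℕ) (hs : 2 ≤ s)
    (hcard : K.card = s - 1)
    (hdom : ∀ v, v ∉ K → ∀ u ∈ K, G.Adj u v) (S : Set V) (hS : (G.induce S).Connected)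
    (hSK : ∀ x ∈ S, x ∉ K) (T : Finset V) (hT : t ≤ T.card) (hTK : ∀ x ∈ T, x ∉ K)
    (hTS : ∀ x ∈ T, x ∉ S) (hadj : ∀ x ∈ T, ∃ y ∈ S, G.Adj y x) :
    MinorOf (completeBipartiteGraph (Fin s) (Fin t)) G := by
  obtain ⟨s', rfl⟩ : ∃ s', s = s' + 1 := ⟨s - 1, by omega⟩
  simp only [Nat.add_sub_cancel] at hcard
  let eK : Fin s' ≃ K := (Fintype.equivFinOfCardEq (by simpa using hcard)).symm
  obtain ⟨T', hT'T, hT'c⟩ := Finset.exists_subset_card_eq hT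
  let eT : Fin t ≃ T' := (Fintype.equivFinOfCardEq (by simpa using hT'c)).symm
  let f : Fin (s' + 1) → Set V := Fin.cases S (fun i => {(eK i : V)})
  have hT2 : ∀ j, (eT j : V) ∈ T := fun j => hT'T (eT j).2
  refine ⟨Sum.elim f (fun j => {(eT j : V)}), ?_, ?_, ?_⟩
  · rintro (i | j)
    · refine Fin.cases ?_ (fun i => ?_) i
      · exact hS
      · show (G.induce {(eK i : V)}).Connected
        have : Subsingleton ({(eK i : V)} : Set V) := by
          constructor; rintro ⟨a, rfl⟩ ⟨b, rfl⟩; rfl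
        have : Nonempty ({(eK i : V)} : Set V) := ⟨⟨_, rfl⟩⟩
        exact { preconnected := SimpleGraph.Preconnected.of_subsingleton }
    · show (G.induce {(eT j : V)}).Connected
      have : Subsingleton ({(eT j : V)} : Set V) := by
        constructor; rintro ⟨a, rfl⟩ ⟨b, rfl⟩; rfl
      have : Nonempty ({(eT j : V)} : Set V) := ⟨⟨_, rfl⟩⟩
      exact { preconnected := SimpleGraph.Preconnected.of_subsingleton }
  · have key : ∀ i j, Disjoint (f i) {(eT j : V)} := by
      intro i j
      rw [Set.disjoint_singleton_right]
      refine Fin.cases ?_ (fun i => ?_) i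
      · exact hTS _ (hT2 j)
      · show (eT j : V) ∉ ({(eK i : V)} : Set V)
        intro h
        apply hTK _ (hT2 j)
        rw [Set.mem_singleton_iff.1 h]
        exact (eK i).2
    have key2 : ∀ i j, i ≠ j → Disjoint (f i) (f j) := by
      intro i j
      refine Fin.cases ?_ (fun i => ?_) i
      · refine Fin.cases ?_ (fun j => ?_) j
        · intro h; exact absurd rfl h
        · intro _
          show Disjoint S {(eK j : V)}
          rw [Set.disjoint_singleton_right]
          intro h; exact hSK _ h (eK j).2
      · refine Fin.cases ?_ (fun j => ?_) j
        · intro _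
          show Disjoint {(eK i : V)} S
          rw [Set.disjoint_singleton_left]
          intro h; exact hSK _ h (eK i).2
        · intro hij
          show Disjoint ({(eK i : V)} : Set V) {(eK j : V)}
          rw [Set.disjoint_singleton_left]
          intro h
          apply hij
          have := eK.injective (Subtype.ext (Set.mem_singleton_iff.1 h))
          rw [this]
    rintro (i | i) (j | j) hij
    · exact key2 i j (fun h => hij (by rw [h]))
    · exact key i j
    · exact (key j i).symm
    · show Disjoint ({(eT i : V)} : Set V) {(eT j : V)}
      rw [Set.disjoint_singleton_left]
      intro h
      apply hij
      have := eT.injective (Subtype.ext (Set.mem_singleton_iff.1 h))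
      rw [this]
  · have key : ∀ i j, ∃ x ∈ f i, ∃ y ∈ ({(eT j : V)} : Set V), G.Adj x y := by
      intro i j
      refine Fin.cases ?_ (fun i => ?_) i
      · obtain ⟨y, hy, hyx⟩ := hadj _ (hT2 j)
        exact ⟨y, hy, _, rfl, hyx⟩
      · exact ⟨(eK i : V), rfl, _, rfl, hdom _ (hTK _ (hT2 j)) _ (eK i).2⟩
    rintro (i | i) (j | j) hij
    · simp at hij
    · exact key i j
    · obtain ⟨x, hx, y, hy, h⟩ := key j i
      exact ⟨y, hy, x, hx, h.symm⟩
    · simp at hij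

lemma trunc_connected {V β : Type} (G : SimpleGraph V) (K : Finset V)
    (hK : G.IsClique (K : Set V)) (blk : V → β)
    (hblk : ∀ u v, u ∉ K → v ∉ K → G.Adj u v → blk u = blk v) (b : β) (X : Set V)
    (hX : (G.induce X).Connected) (k : V) (hkX : k ∈ X) (hkK : k ∈ K) :
    (G.induce (X ∩ {x | x ∈ K ∨ blk x = b})).Connected := by
  set Y := X ∩ {x | x ∈ K ∨ blk x = b} with hY
  have hkY : k ∈ Y := ⟨hkX, Or.inl hkK⟩
  have key : ∀ (x : X) (p : (G.induce X).Walk x ⟨k, hkX⟩) (hx : (x : V) ∈ Y),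
      (G.induce Y).Reachable ⟨x, hx⟩ ⟨k, hkY⟩ := by
    intro x p
    generalize hz : (⟨k, hkX⟩ : X) = z at p
    induction p with
    | nil =>
      subst hz
      intro hx
      exact SimpleGraph.Reachable.refl _
    | @cons u v w huv p ih =>
      subst hz
      intro hx
      by_cases huK : (u : V) ∈ K
      · by_cases huk : (u : V) = k
        · have : (⟨(u : V), hx⟩ : Y) = ⟨k, hkY⟩ := Subtype.ext huk
          rw [this]
        · exact SimpleGraph.Adj.reachable (show G.Adj u k from hK huK hkK huk)
      · have hub : blk u = b := by
          rcases hx.2 with h | h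
          · exact absurd h huK
          · exact h
        have hvY : (v : V) ∈ Y := by
          refine ⟨v.2, ?_⟩
          by_cases hvK : (v : V) ∈ K
          · exact Or.inl hvK
          · exact Or.inr ((hblk _ _ huK hvK huv).symm.trans hub)
        exact (SimpleGraph.Adj.reachable (G := G.induce Y) (u := ⟨u, hx⟩) (v := ⟨v, hvY⟩) huv).trans
          (ih rfl hvY)
  have : Nonempty Y := ⟨⟨k, hkY⟩⟩
  refine { preconnected := ?_ }
  have key2 : ∀ x : Y, (G.induce Y).Reachable x ⟨k, hkY⟩ := by
    intro x
    obtain ⟨p⟩ := hX.preconnected ⟨x, x.2.1⟩ ⟨k, hkX⟩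
    exact key _ p x.2
  intro x y
  exact (key2 x).trans (key2 y).symm

lemma blk_const {V β : Type} (G : SimpleGraph V) (K : Finset V) (blk : V → β)
    (hblk : ∀ u v, u ∉ K → v ∉ K → G.Adj u v → blk u = blk v) (X : Set V)
    (hX : (G.induce X).Connected) (hXK : ∀ x ∈ X, x ∉ K) (x y : V) (hx : x ∈ X) (hy : y ∈ X) :
    blk x = blk y := by
  obtain ⟨p⟩ := hX.preconnected ⟨x, hx⟩ ⟨y, hy⟩
  have : ∀ (a c : X) (p : (G.induce X).Walk a c), blk a = blk c := by
    intro a c p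
    induction p with
    | nil => rfl
    | @cons u v w huv p ih => exact (hblk _ _ (hXK _ u.2) (hXK _ v.2) huv).trans ih
  exact this _ _ p

lemma exists_free {V : Type} (K : Finset V) {r : ℕ} (hr : K.card < r) (f : Fin r → Set V)
    (hd : ∀ i j, i ≠ j → Disjoint (f i) (f j)) : ∃ i, ∀ x ∈ f i, x ∉ K := by
  by_contra hcon
  push Not at hcon
  choose g hg hgK using hcon
  have : Function.Injective (fun i => (⟨g i, hgK i⟩ : K)) := by
    intro i j hij
    by_contra hne
    have h1 : g i = g j := congrArg Subtype.val hij
    exact Set.disjoint_left.1 (hd i j hne) (hg i) (h1 ▸ hg j)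
  have := Fintype.card_le_of_injective _ this
  simp at this
  omega

lemma clique_sum {V β : Type} (G : SimpleGraph V) (K : Finset V) (s t : ℕ)
    (hK : G.IsClique (K : Set V)) (hcard : K.card < s) (hst : s ≤ t) (blk : V → β)
    (hblk : ∀ u v, u ∉ K → v ∉ K → G.Adj u v → blk u = blk v)
    (φ : Fin s ⊕ Fin t → Set V) (h1 : ∀ a, (G.induce (φ a)).Connected)
    (h2 : Pairwise fun a b => Disjoint (φ a) (φ b))
    (h3 : ∀ a b, (completeBipartiteGraph (Fin s) (Fin t)).Adj a b →
      ∃ x ∈ φ a, ∃ y ∈ φ b, G.Adj x y) :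
    ∃ b : β, ∃ φ' : Fin s ⊕ Fin t → Set V, (∀ a, (G.induce (φ' a)).Connected) ∧
      (Pairwise fun a b => Disjoint (φ' a) (φ' b)) ∧
      (∀ a b, (completeBipartiteGraph (Fin s) (Fin t)).Adj a b →
        ∃ x ∈ φ' a, ∃ y ∈ φ' b, G.Adj x y) ∧
      ∀ a, ∀ x ∈ φ' a, x ∈ K ∨ blk x = b := by
  obtain ⟨i0, hi0⟩ := exists_free K hcard (fun i => φ (Sum.inl i))
    (fun i j hij => h2 (by simpa using hij))
  obtain ⟨j0, hj0⟩ := exists_free K (lt_of_lt_of_le hcard hst) (fun i => φ (Sum.inr i))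
    (fun i j hij => h2 (by simpa using hij))
  obtain ⟨x0, hx0, y0, hy0, hxy0⟩ := h3 (Sum.inl i0) (Sum.inr j0) (by simp)
  have hb0 : blk x0 = blk y0 := hblk _ _ (hi0 _ hx0) (hj0 _ hy0) hxy0
  set b := blk x0 with hb
  have hfree : ∀ a, (∀ x ∈ φ a, x ∉ K) → ∀ x ∈ φ a, blk x = b := by
    rintro (i | j) hf x hx
    · obtain ⟨x1, hx1, y1, hy1, hxy1⟩ := h3 (Sum.inl i) (Sum.inr j0) (by simp)
      rw [blk_const G K blk hblk _ (h1 _) hf x x1 hx hx1,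
        hblk _ _ (hf _ hx1) (hj0 _ hy1) hxy1,
        blk_const G K blk hblk _ (h1 _) hj0 y1 y0 hy1 hy0, hb0]
    · obtain ⟨x1, hx1, y1, hy1, hxy1⟩ := h3 (Sum.inr j) (Sum.inl i0) (by simp)
      rw [blk_const G K blk hblk _ (h1 _) hf x x1 hx hx1,
        hblk _ _ (hf _ hx1) (hi0 _ hy1) hxy1,
        blk_const G K blk hblk _ (h1 _) hi0 y1 x0 hy1 hx0]
  refine ⟨b, fun a => φ a ∩ {x | x ∈ K ∨ blk x = b}, ?_, ?_, ?_, ?_⟩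
  · intro a
    by_cases hf : ∀ x ∈ φ a, x ∉ K
    · have : φ a ∩ {x | x ∈ K ∨ blk x = b} = φ a := by
        apply Set.inter_eq_left.2
        intro x hx
        exact Or.inr (hfree a hf x hx)
      show (G.induce (φ a ∩ {x | x ∈ K ∨ blk x = b})).Connected
      rw [this]; exact h1 a
    · push Not at hf
      obtain ⟨k, hk, hkK⟩ := hf
      exact trunc_connected G K hK blk hblk b (φ a) (h1 a) k hk hkK
  · intro a c hac
    exact (h2 hac).mono Set.inter_subset_left Set.inter_subset_left
  · intro a c hac
    obtain ⟨x, hx, y, hy, hxy⟩ := h3 a c hac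
    have hne : a ≠ c := (completeBipartiteGraph (Fin s) (Fin t)).ne_of_adj hac
    have half : ∀ x y a c, x ∈ φ a → y ∈ φ c → G.Adj x y → (∀ x ∈ φ a, x ∉ K) →
        y ∈ φ c ∩ {x | x ∈ K ∨ blk x = b} := by
      intro x y a c hx hy hxy hf
      refine ⟨hy, ?_⟩
      by_cases hyK : y ∈ K
      · exact Or.inl hyK
      · exact Or.inr ((hblk x y (hf x hx) hyK hxy).symm.trans (hfree a hf x hx))
    by_cases hf : ∀ x ∈ φ a, x ∉ K
    · exact ⟨x, ⟨hx, Or.inr (hfree a hf x hx)⟩, y, half x y a c hx hy hxy hf, hxy⟩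
    · by_cases hf' : ∀ x ∈ φ c, x ∉ K
      · exact ⟨x, half y x c a hy hx hxy.symm hf', y, ⟨hy, Or.inr (hfree c hf' y hy)⟩, hxy⟩
      · push Not at hf hf'
        obtain ⟨k, hk, hkK⟩ := hf
        obtain ⟨k', hk', hkK'⟩ := hf'
        refine ⟨k, ⟨hk, Or.inl hkK⟩, k', ⟨hk', Or.inl hkK'⟩, hK hkK hkK' ?_⟩
        rintro rfl
        exact Set.disjoint_left.1 (h2 hne) hk hk'
  · intro a x hx
    exact hx.2

lemma no_small_model {V : Type} (s t : ℕ) (Z : Finset V) (hZ : Z.card < s + t)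
    (φ : Fin s ⊕ Fin t → Set V) (hne : ∀ a, (φ a).Nonempty)
    (h2 : Pairwise fun a b => Disjoint (φ a) (φ b)) (hsub : ∀ a, ∀ x ∈ φ a, x ∈ Z) : False := by
  choose g hg using hne
  have : Function.Injective (fun a => (⟨g a, hsub a _ (hg a)⟩ : Z)) := by
    intro i j hij
    by_contra hne
    have h1 : g i = g j := congrArg Subtype.val hij
    exact Set.disjoint_left.1 (h2 hne) (hg i) (h1 ▸ hg j)
  have := Fintype.card_le_of_injective _ this
  simp at this
  omega

/-- minor-freeness of the modified graph -/
lemma modified_minor_free {V : Type} (G G' : SimpleGraph V) (K : Finset V) (s t : ℕ)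
    (hs : 2 ≤ s) (hst : s ≤ t) (hcard : K.card = s - 1)
    (hK : G'.IsClique (K : Set V)) (blk : V → Option ℕ)
    (hblk : ∀ u v, u ∉ K → v ∉ K → G'.Adj u v → blk u = blk v)
    (hagree : ∀ u v, (u ∈ K ∨ blk u = none) → (v ∈ K ∨ blk v = none) → G'.Adj u v → G.Adj u v)
    (hsmall : ∀ i : ℕ, ∃ Z : Finset V, Z.card ≤ t ∧ ∀ x, blk x = some i → x ∈ Z)
    (hG : ¬ MinorOf (completeBipartiteGraph (Fin s) (Fin t)) G) :
    ¬ MinorOf (completeBipartiteGraph (Fin s) (Fin t)) G' := by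
  rintro ⟨φ, h1, h2, h3⟩
  obtain ⟨b, φ', h1', h2', h3', h4⟩ := clique_sum G' K s t hK (by omega) hst blk hblk φ h1 h2 h3
  cases b with
  | none =>
    apply hG
    refine ⟨φ', ?_, h2', ?_⟩
    · intro a
      refine (h1' a).mono ?_
      intro x y hxy
      exact hagree _ _ (h4 a _ x.2) (h4 a _ y.2) hxy
    · intro a c hac
      obtain ⟨x, hx, y, hy, hxy⟩ := h3' a c hac
      exact ⟨x, hx, y, hy, hagree _ _ (h4 a _ hx) (h4 c _ hy) hxy⟩
  | some i =>
    obtain ⟨Z, hZ, hZi⟩ := hsmall i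
    apply no_small_model s t (K ∪ Z) _ φ' _ h2' _
    · have := Finset.card_union_le K Z
      omega
    · intro a
      obtain ⟨x⟩ := (h1' a).nonempty
      exact ⟨x, x.2⟩
    · intro a x hx
      rcases h4 a x hx with h | h
      · exact Finset.mem_union_left _ h
      · exact Finset.mem_union_right _ (hZi x h)

end PartTwo

section PartThree
open Classical

/-- number of neighbours of `v` in `X` -/
noncomputable def nbc {W : Type} (C : SimpleGraph W) (v : W) (X : Finset W) : ℕ :=
  (X.filter (fun x => C.Adj v x)).card

lemma nbc_union {W : Type} (C : SimpleGraph W) (v : W) (X Y : Finset W) (h : Disjoint X Y) :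
    nbc C v (X ∪ Y) = nbc C v X + nbc C v Y := by
  unfold nbc
  rw [Finset.filter_union, Finset.card_union_of_disjoint]
  exact Finset.disjoint_filter_filter h

lemma nbc_swap {W : Type} (C : SimpleGraph W) (X Y : Finset W) :
    ∑ v ∈ X, nbc C v Y = ∑ w ∈ Y, nbc C w X := by
  have := Finset.sum_card_bipartiteAbove_eq_sum_card_bipartiteBelow (s := X) (t := Y)
    (fun a b => C.Adj a b)
  simp only [Finset.bipartiteAbove, Finset.bipartiteBelow] at this
  unfold nbc
  rw [this]
  simp only [C.adj_comm]

/-- the star bound -/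
def StarBound {W : Type} (C : SimpleGraph W) (t : ℕ) : Prop :=
  ∀ S T : Finset W, (C.induce (S : Set W)).Connected → Disjoint S T →
    (∀ x ∈ T, ∃ y ∈ S, C.Adj y x) → T.card < t

lemma conn_single_s13 {W : Type} (C : SimpleGraph W) (v : W) :
    (C.induce (({v} : Finset W) : Set W)).Connected := by
  have : Subsingleton (({v} : Finset W) : Set W) := by
    constructor; rintro ⟨a, ha⟩ ⟨b, hb⟩
    simp at ha hb
    subst ha; subst hb; rfl
  have : Nonempty (({v} : Finset W) : Set W) := ⟨⟨v, by simp⟩⟩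
  exact { preconnected := SimpleGraph.Preconnected.of_subsingleton }

lemma conn_insert {W : Type} (C : SimpleGraph W) (v u : W) (S : Finset W)
    (hS : (C.induce (S : Set W)).Connected) (hu : u ∈ S) (hvu : C.Adj v u) :
    (C.induce ((insert v S : Finset W) : Set W)).Connected := by
  have h1 : (C.induce ({v, u} : Set W)).Connected :=
    SimpleGraph.induce_pair_connected_of_adj hvu
  have := SimpleGraph.induce_union_connected h1.preconnected hS.preconnected ⟨u, by simp, hu⟩
  have h2 : ((insert v S : Finset W) : Set W) = {v, u} ∪ (S : Set W) := by
    ext x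
    simp only [Finset.coe_insert, Set.mem_insert_iff, Set.mem_union, Set.mem_singleton_iff,
      Finset.mem_coe]
    constructor
    · rintro (h | h)
      · exact Or.inl (Or.inl h)
      · exact Or.inr h
    · rintro ((h | h) | h)
      · exact Or.inl h
      · rw [h]; exact Or.inr hu
      · exact Or.inr h
  rw [h2]
  exact this

lemma closed_univ {W : Type} (C : SimpleGraph W) (hC : C.Connected) (v : W) (P : W → Prop)
    (hv : P v) (hcl : ∀ x y, P x → C.Adj x y → P y) (z : W) : P z := by
  obtain ⟨p⟩ := hC.preconnected v z
  have : ∀ (a c : W) (p : C.Walk a c), P a → P c := by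
    intro a c p
    induction p with
    | nil => exact id
    | @cons u v w huv p ih => exact fun h => ih (hcl _ _ h huv)
  exact this _ _ p hv

lemma geodesic {W : Type} (C : SimpleGraph W) (hC : C.Connected) (v : W) (l : ℕ) :
    ∀ z, C.dist v z = l → ∃ P : Finset W, (C.induce (P : Set W)).Connected ∧ v ∈ P ∧ z ∈ P ∧
      (∀ x ∈ P, C.dist v x ≤ l) ∧ (∀ x ∈ P, ∀ y ∈ P, C.dist v x = C.dist v y → x = y) := by
  induction l with
  | zero =>
    intro z hz
    have : v = z := (hC.dist_eq_zero_iff).1 hz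
    subst this
    refine ⟨{v}, conn_single_s13 C v, by simp, by simp, ?_, ?_⟩
    · intro x hx; simp at hx; subst hx; exact hz.le
    · intro x hx y hy _
      simp at hx hy; rw [hx, hy]
  | succ l ih =>
    intro z hz
    obtain ⟨z', hz', hadj⟩ : ∃ z', C.dist v z' = l ∧ C.Adj z z' := by
      obtain ⟨p, hp⟩ := hC.exists_walk_length_eq_dist z v
      rw [SimpleGraph.dist_comm, hz] at hp
      cases p with
      | nil => simp at hp
      | @cons _ y _ h q =>
        simp at hp
        refine ⟨y, ?_, h⟩
        have h1 : C.dist y v ≤ l := hp ▸ SimpleGraph.dist_le q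
        have h2 := hC.dist_triangle (u := v) (v := y) (w := z)
        rw [SimpleGraph.dist_eq_one_iff_adj.2 h.symm, hz] at h2
        rw [SimpleGraph.dist_comm] at h1
        omega
    obtain ⟨P, hP, hvP, hzP, hle, hinj⟩ := ih z' hz'
    refine ⟨insert z P, conn_insert C z z' P hP hzP hadj, by simp [hvP], by simp, ?_, ?_⟩
    · intro x hx
      rcases Finset.mem_insert.1 hx with h | h
      · rw [h, hz]
      · exact (hle x h).trans (Nat.le_succ _)
    · intro x hx y hy hxy
      rcases Finset.mem_insert.1 hx with h | h <;> rcases Finset.mem_insert.1 hy with h' | h'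
      · rw [h, h']
      · have := hle y h'; rw [h, hz] at hxy; omega
      · have := hle x h; rw [h', hz] at hxy; omega
      · exact hinj x h y h' hxy

variable {W : Type} [Fintype W]

noncomputable def D1 (C : SimpleGraph W) (v : W) : Finset W := Finset.univ.filter (fun x => C.Adj v x)
noncomputable def D2 (C : SimpleGraph W) (v : W) : Finset W :=
  Finset.univ.filter (fun x => x ≠ v ∧ ¬ C.Adj v x ∧ ∃ u, C.Adj v u ∧ C.Adj u x)
noncomputable def D3 (C : SimpleGraph W) (v : W) : Finset W :=
  Finset.univ.filter (fun x => x ≠ v ∧ ¬ C.Adj v x ∧ ¬ ∃ u, C.Adj v u ∧ C.Adj u x)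

lemma mem_D1 {C : SimpleGraph W} {v x : W} : x ∈ D1 C v ↔ C.Adj v x := by simp [D1]
lemma mem_D2 {C : SimpleGraph W} {v x : W} :
    x ∈ D2 C v ↔ x ≠ v ∧ ¬ C.Adj v x ∧ ∃ u, C.Adj v u ∧ C.Adj u x := by simp [D2]
lemma mem_D3 {C : SimpleGraph W} {v x : W} :
    x ∈ D3 C v ↔ x ≠ v ∧ ¬ C.Adj v x ∧ ¬ ∃ u, C.Adj v u ∧ C.Adj u x := by simp [D3]

lemma disj12 (C : SimpleGraph W) (v : W) : Disjoint (D1 C v) (D2 C v) := by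
  rw [Finset.disjoint_left]; intro x h1 h2; exact (mem_D2.1 h2).2.1 (mem_D1.1 h1)
lemma disj13 (C : SimpleGraph W) (v : W) : Disjoint (D1 C v) (D3 C v) := by
  rw [Finset.disjoint_left]; intro x h1 h2; exact (mem_D3.1 h2).2.1 (mem_D1.1 h1)
lemma disj23 (C : SimpleGraph W) (v : W) : Disjoint (D2 C v) (D3 C v) := by
  rw [Finset.disjoint_left]; intro x h1 h2; exact (mem_D3.1 h2).2.2 (mem_D2.1 h1).2.2

lemma univ_split (C : SimpleGraph W) (v : W) :
    (Finset.univ : Finset W) = {v} ∪ (D1 C v ∪ (D2 C v ∪ D3 C v)) := by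
  ext x
  simp only [Finset.mem_univ, Finset.mem_union, Finset.mem_singleton, mem_D1, mem_D2, mem_D3]
  by_cases h1 : x = v <;> by_cases h2 : C.Adj v x <;>
    by_cases h3 : ∃ u, C.Adj v u ∧ C.Adj u x <;> simp only [ne_eq, h1, h2, h3] <;> simp

lemma disj0 (C : SimpleGraph W) (v : W) : Disjoint {v} (D1 C v ∪ (D2 C v ∪ D3 C v)) := by
  rw [Finset.disjoint_singleton_left]
  simp [mem_D1, mem_D2, mem_D3]

lemma sum_split (C : SimpleGraph W) (v : W) (f : W → ℕ) :
    ∑ x, f x = f v + (∑ x ∈ D1 C v, f x + (∑ x ∈ D2 C v, f x + ∑ x ∈ D3 C v, f x)) := by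
  rw [univ_split C v, Finset.sum_union (disj0 C v), Finset.sum_singleton, Finset.sum_union,
    Finset.sum_union (disj23 C v)]
  rw [Finset.disjoint_union_right]; exact ⟨disj12 C v, disj13 C v⟩

lemma nbc_split (C : SimpleGraph W) (v x : W) :
    nbc C x Finset.univ = (if C.Adj x v then 1 else 0) +
      (nbc C x (D1 C v) + (nbc C x (D2 C v) + nbc C x (D3 C v))) := by
  rw [univ_split C v, nbc_union _ _ _ _ (disj0 C v), nbc_union, nbc_union _ _ _ _ (disj23 C v)]
  · congr 1
    unfold nbc
    rw [Finset.filter_singleton]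
    split_ifs <;> simp
  · rw [Finset.disjoint_union_right]; exact ⟨disj12 C v, disj13 C v⟩

lemma nbc_zero (C : SimpleGraph W) (x : W) (X : Finset W) (h : ∀ y ∈ X, ¬ C.Adj x y) :
    nbc C x X = 0 := by
  unfold nbc
  rw [Finset.card_eq_zero, Finset.filter_eq_empty_iff]
  intro y hy; exact h y hy

lemma card_D1 (C : SimpleGraph W) (v : W) : (D1 C v).card = nbc C v Finset.univ := rfl

lemma deg_D1 (C : SimpleGraph W) (v u : W) (hu : u ∈ D1 C v) :
    nbc C u Finset.univ = 1 + (nbc C u (D1 C v) + nbc C u (D2 C v)) := by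
  rw [nbc_split C v u, if_pos (mem_D1.1 hu).symm, nbc_zero C u (D3 C v)]; rfl
  intro y hy h
  exact (mem_D3.1 hy).2.2 ⟨u, mem_D1.1 hu, h⟩

lemma deg_D2 (C : SimpleGraph W) (v u : W) (hu : u ∈ D2 C v) :
    nbc C u Finset.univ = nbc C u (D1 C v) + nbc C u (D2 C v ∪ D3 C v) := by
  rw [nbc_split C v u, if_neg (fun h => (mem_D2.1 hu).2.1 h.symm), zero_add,
    nbc_union _ _ _ _ (disj23 C v)]

lemma F1 (C : SimpleGraph W) (t : ℕ) (hB : StarBound C t) (v u : W) (hu : u ∈ D1 C v) :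
    nbc C u (D2 C v) + nbc C v Finset.univ ≤ t := by
  have h := hB {v, u} ((D1 C v).erase u ∪ (D2 C v).filter (fun x => C.Adj u x))
    (conn_insert C v u _ (conn_single_s13 C u) (by simp) (mem_D1.1 hu)) ?_ ?_
  · rw [Finset.card_union_of_disjoint, Finset.card_erase_of_mem hu, card_D1] at h
    · have : 0 < (D1 C v).card := Finset.card_pos.2 ⟨u, hu⟩
      rw [card_D1] at this
      unfold nbc at *
      omega
    · exact (disj12 C v).mono (Finset.erase_subset _ _) (Finset.filter_subset _ _)
  · rw [Finset.disjoint_left]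
    intro x hx
    simp only [Finset.mem_insert, Finset.mem_singleton] at hx
    have := mem_D1.1 hu
    rcases hx with rfl | rfl
    · simp [mem_D1, mem_D2]
    · simp [mem_D2, this]
  · intro x hx
    simp only [Finset.mem_union, Finset.mem_erase, Finset.mem_filter, mem_D1] at hx
    rcases hx with h | h
    · exact ⟨v, by simp, h.2⟩
    · exact ⟨u, by simp, h.2⟩

lemma F2 (C : SimpleGraph W) (t : ℕ) (hB : StarBound C t) (v w : W) (hw : w ∈ D2 C v) :
    nbc C w (D2 C v ∪ D3 C v) + nbc C v Finset.univ ≤ t := by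
  obtain ⟨hwv, hvw, u, hvu, huw⟩ := mem_D2.1 hw
  have hu : u ∈ D1 C v := mem_D1.2 hvu
  have h := hB {v, u, w} ((D1 C v).erase u ∪ (D2 C v ∪ D3 C v).filter (fun x => C.Adj w x))
    (conn_insert C v u _ (conn_insert C u w _ (conn_single_s13 C w) (by simp) huw) (by simp) hvu) ?_ ?_
  · rw [Finset.card_union_of_disjoint, Finset.card_erase_of_mem hu, card_D1] at h
    · have : 0 < (D1 C v).card := Finset.card_pos.2 ⟨u, hu⟩
      rw [card_D1] at this
      unfold nbc at *
      omega
    · refine Disjoint.mono (Finset.erase_subset _ _) (Finset.filter_subset _ _) ?_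
      rw [Finset.disjoint_union_right]; exact ⟨disj12 C v, disj13 C v⟩
  · rw [Finset.disjoint_left]
    intro x hx
    simp only [Finset.mem_insert, Finset.mem_singleton] at hx
    rcases hx with rfl | rfl | rfl
    · simp [mem_D1, mem_D2, mem_D3]
    · simp [mem_D2, mem_D3, hvu]
    · simp [mem_D1, hvw]
  · intro x hx
    simp only [Finset.mem_union, Finset.mem_erase, Finset.mem_filter, mem_D1] at hx
    rcases hx with h | h
    · exact ⟨v, by simp, h.2⟩
    · exact ⟨w, by simp, h.2⟩

lemma F3 (C : SimpleGraph W) (hC : C.Connected) (t : ℕ) (hB : StarBound C t) (v z : W)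
    (hz : z ∈ D3 C v) :
    nbc C z Finset.univ + nbc C v Finset.univ ≤ t + 1 := by
  obtain ⟨hzv, hvz, hno⟩ := mem_D3.1 hz
  obtain ⟨P, hP, hvP, hzP, hle, hinj⟩ := geodesic C hC v _ z rfl
  have h := hB P ((D1 C v) \ P ∪ (D1 C z) \ P) hP ?_ ?_
  · have hd : Disjoint (D1 C v) (D1 C z) := by
      rw [Finset.disjoint_left]
      intro x h1 h2
      exact hno ⟨x, mem_D1.1 h1, (mem_D1.1 h2).symm⟩
    rw [Finset.card_union_of_disjoint (hd.mono Finset.sdiff_subset Finset.sdiff_subset)] at h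
    have h1 : (D1 C v ∩ P).card ≤ 1 := by
      rw [Finset.card_le_one]
      intro x hx y hy
      rw [Finset.mem_inter, mem_D1] at hx hy
      apply hinj x hx.2 y hy.2
      rw [SimpleGraph.dist_eq_one_iff_adj.2 hx.1, SimpleGraph.dist_eq_one_iff_adj.2 hy.1]
    have h2 : (D1 C z ∩ P).card ≤ 1 := by
      have key : ∀ x ∈ P, C.Adj z x → C.dist v x + 1 = C.dist v z := by
        intro x hx hzx
        have h1 := hle x hx
        have h2 : C.dist v x ≠ C.dist v z := by
          intro h; exact hzx.ne (hinj x hx z hzP h).symm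
        have h3 := hC.dist_triangle (u := v) (v := x) (w := z)
        rw [SimpleGraph.dist_eq_one_iff_adj.2 hzx.symm] at h3
        omega
      rw [Finset.card_le_one]
      intro x hx y hy
      rw [Finset.mem_inter, mem_D1] at hx hy
      apply hinj x hx.2 y hy.2
      have := key x hx.2 hx.1
      have := key y hy.2 hy.1
      omega
    have h3 := Finset.card_sdiff_add_card_inter (D1 C v) P
    have h4 := Finset.card_sdiff_add_card_inter (D1 C z) P
    rw [card_D1] at h3 h4
    omega
  · rw [Finset.disjoint_union_right]
    exact ⟨Finset.disjoint_sdiff, Finset.disjoint_sdiff⟩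
  · intro x hx
    simp only [Finset.mem_union, Finset.mem_sdiff, mem_D1] at hx
    rcases hx with h | h
    · exact ⟨v, hvP, h.1⟩
    · exact ⟨z, hzP, h.1⟩

lemma deg_lt (C : SimpleGraph W) (t : ℕ) (hB : StarBound C t) (v : W) :
    nbc C v Finset.univ < t := by
  refine hB {v} (D1 C v) (conn_single_s13 C v) ?_ ?_
  · simp [mem_D1]
  · intro x hx; exact ⟨v, by simp, mem_D1.1 hx⟩

lemma card_split (C : SimpleGraph W) (v : W) :
    Fintype.card W = 1 + (nbc C v Finset.univ + ((D2 C v).card + (D3 C v).card)) := by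
  have := sum_split C v (fun _ => 1)
  simp at this
  rw [this, card_D1]

lemma crude (C : SimpleGraph W) (hC : C.Connected) (t : ℕ) (hB : StarBound C t) (v : W)
    (hmax : ∀ x, nbc C x Finset.univ ≤ nbc C v Finset.univ) (d k : ℕ)
    (hd : nbc C v Finset.univ = d) (hk : d + k + 1 = t) :
    ∑ x, nbc C x Finset.univ ≤
      d + d * d + d * (k + 1) + (D2 C v).card * (k + 1) + (D3 C v).card * (k + 2) ∧
    ∑ x, nbc C x Finset.univ ≤ d + d * d + (D2 C v).card * d + (D3 C v).card * (k + 2) := by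
  have hs := sum_split C v (fun x => nbc C x Finset.univ)
  simp only [hd] at hs hmax
  have h1 : ∑ x ∈ D1 C v, nbc C x Finset.univ ≤ d * d := by
    have := Finset.sum_le_card_nsmul (D1 C v) (fun x => nbc C x Finset.univ) d (fun x _ => hmax x)
    rwa [card_D1, hd, smul_eq_mul] at this
  have h3 : ∑ x ∈ D3 C v, nbc C x Finset.univ ≤ (D3 C v).card * (k + 2) := by
    have := Finset.sum_le_card_nsmul (D3 C v) (fun x => nbc C x Finset.univ) (k + 2) (fun x hx => by
      have := F3 C hC t hB v x hx
      omega)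
    rwa [smul_eq_mul] at this
  have h2 : ∑ x ∈ D2 C v, nbc C x Finset.univ ≤ (D2 C v).card * d := by
    have := Finset.sum_le_card_nsmul (D2 C v) (fun x => nbc C x Finset.univ) d (fun x _ => hmax x)
    rwa [smul_eq_mul] at this
  have h2' : ∑ x ∈ D2 C v, nbc C x Finset.univ ≤ d * (k + 1) + (D2 C v).card * (k + 1) := by
    have e : ∑ x ∈ D2 C v, nbc C x Finset.univ =
        ∑ x ∈ D2 C v, nbc C x (D1 C v) + ∑ x ∈ D2 C v, nbc C x (D2 C v ∪ D3 C v) := by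
      rw [← Finset.sum_add_distrib]
      exact Finset.sum_congr rfl (fun x hx => deg_D2 C v x hx)
    rw [e, ← nbc_swap]
    apply add_le_add
    · have := Finset.sum_le_card_nsmul (D1 C v) (fun x => nbc C x (D2 C v)) (k + 1) (fun x hx => by
        have := F1 C t hB v x hx
        omega)
      rwa [card_D1, hd, smul_eq_mul] at this
    · have := Finset.sum_le_card_nsmul (D2 C v) (fun x => nbc C x (D2 C v ∪ D3 C v)) (k + 1)
        (fun x hx => by
          have := F2 C t hB v x hx
          omega)
      rwa [smul_eq_mul] at this
  constructor <;> omega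

lemma nbc_degree (F : SimpleGraph W) (x : W) : nbc F x Finset.univ = F.degree x := by
  unfold nbc
  rw [← SimpleGraph.card_neighborFinset_eq_degree]
  congr 1
  ext y; simp

lemma reach_card (F : SimpleGraph W) (U : Finset W)
    (hU : ∀ x ∈ U, ∀ y ∈ U, F.Reachable x y) :
    2 * U.card ≤ ∑ x, nbc F x Finset.univ + 2 := by
  rcases U.eq_empty_or_nonempty with rfl | ⟨u0, hu0⟩
  · simp
  simp only [nbc_degree]
  rw [SimpleGraph.sum_degrees_eq_twice_card_edges]
  set c := F.connectedComponentMk u0 with hc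
  have h1 : c.toSimpleGraph.Connected := c.connected_toSimpleGraph
  have h2 := h1.card_vert_le_card_edgeSet_add_one
  have h3 : U.card ≤ Nat.card c := by
    have hmem : ∀ x ∈ U, x ∈ c.supp := by
      intro x hx
      rw [SimpleGraph.ConnectedComponent.mem_supp_iff, hc]
      exact SimpleGraph.ConnectedComponent.sound (hU x hx u0 hu0)
    have : Function.Injective (fun x : U => (⟨x, hmem x x.2⟩ : c)) := by
      intro x y hxy
      have h0 : (x : W) = (y : W) := by simpa using hxy
      exact Subtype.ext h0
    have := Nat.card_le_card_of_injective _ this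
    simpa using this
  have h4 : Nat.card c.toSimpleGraph.edgeSet ≤ F.edgeFinset.card := by
    have e : c.toSimpleGraph ↪g F := SimpleGraph.Embedding.induce c.supp
    have := Nat.card_le_card_of_injective _ e.mapEdgeSet.injective
    simpa [SimpleGraph.edgeFinset_card] using this
  omega

/-- non-adjacency graph on `D` -/
def nonG (C : SimpleGraph W) (D : Finset W) : SimpleGraph W where
  Adj x y := x ∈ D ∧ y ∈ D ∧ x ≠ y ∧ ¬ C.Adj x y
  symm := ⟨fun x y h => ⟨h.2.1, h.1, h.2.2.1.symm, fun h' => h.2.2.2 h'.symm⟩⟩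
  loopless := ⟨fun x h => h.2.2.1 rfl⟩

lemma nonG_adj (C : SimpleGraph W) (D : Finset W) (x y : W) :
    (nonG C D).Adj x y ↔ x ∈ D ∧ y ∈ D ∧ x ≠ y ∧ ¬ C.Adj x y := Iff.rfl

lemma nonG_deg (C : SimpleGraph W) (D : Finset W) (x : W) (hx : x ∈ D) :
    nbc C x D + nbc (nonG C D) x Finset.univ + 1 = D.card := by
  have h1 : D = (D.filter (fun y => C.Adj x y)) ∪
      ((Finset.univ.filter (fun y => (nonG C D).Adj x y)) ∪ {x}) := by
    ext y
    simp only [Finset.mem_union, Finset.mem_filter, Finset.mem_univ, true_and,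
      Finset.mem_singleton]
    simp only [nonG_adj]
    by_cases hy : y ∈ D <;> by_cases hxy : C.Adj x y <;> by_cases he : y = x <;> simp_all [eq_comm]
  have h2 := congrArg Finset.card h1
  rw [Finset.card_union_of_disjoint, Finset.card_union_of_disjoint] at h2
  · simp only [Finset.card_singleton] at h2
    unfold nbc
    omega
  · rw [Finset.disjoint_singleton_right, Finset.mem_filter]
    rintro ⟨_, h⟩
    exact (nonG C D).loopless.irrefl _ h
  · rw [Finset.disjoint_left]
    intro y hy
    simp only [Finset.mem_union, Finset.mem_filter, Finset.mem_univ, true_and,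
      Finset.mem_singleton] at *
    simp only [nonG_adj]
    rintro (h | h)
    · exact h.2.2.2 hy.2
    · subst h; exact C.loopless.irrefl _ hy.2

lemma nonG_deg_zero (C : SimpleGraph W) (D : Finset W) (x : W) (hx : x ∉ D) :
    nbc (nonG C D) x Finset.univ = 0 := nbc_zero _ _ _ (fun y _ h => hx h.1)

/-- vertices of `D1` with a neighbour in `D2` -/
noncomputable def UU (C : SimpleGraph W) (v : W) : Finset W :=
  (D1 C v).filter (fun u => ∃ w ∈ D2 C v, C.Adj u w)

lemma mem_UU {C : SimpleGraph W} {v u : W} :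
    u ∈ UU C v ↔ C.Adj v u ∧ ∃ w ∈ D2 C v, C.Adj u w := by simp [UU, mem_D1]

/-- the basic identity for `d = t-1` -/
lemma identity0 (C : SimpleGraph W) (t : ℕ) (hB : StarBound C t) (v : W)
    (hd : nbc C v Finset.univ + 1 = t) :
    ∑ x, nbc C x Finset.univ + ∑ x, nbc (nonG C (D1 C v)) x Finset.univ =
      t * (t - 1) + 2 * (UU C v).card + ∑ x ∈ D2 C v, nbc C x (D2 C v ∪ D3 C v)
        + ∑ x ∈ D3 C v, nbc C x Finset.univ := by
  have hs := sum_split C v (fun x => nbc C x Finset.univ)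
  set d := nbc C v Finset.univ with hdd
  have hcd : (D1 C v).card = d := card_D1 C v
  have hm : ∑ x ∈ D1 C v, nbc C x (D2 C v) = (UU C v).card := by
    rw [UU, Finset.card_filter]
    apply Finset.sum_congr rfl
    intro u hu
    have h1 := F1 C t hB v u hu
    split_ifs with h
    · obtain ⟨w, hw, huw⟩ := h
      have : 0 < nbc C u (D2 C v) := Finset.card_pos.2 ⟨w, by simp [hw, huw]⟩
      omega
    · apply nbc_zero
      intro y hy huy
      exact h ⟨y, hy, huy⟩
  have hn : ∑ x, nbc (nonG C (D1 C v)) x Finset.univ =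
      ∑ x ∈ D1 C v, nbc (nonG C (D1 C v)) x Finset.univ := by
    symm
    apply Finset.sum_subset (Finset.subset_univ _)
    intro x _ hx
    exact nonG_deg_zero C _ x hx
  have e2 : ∑ x ∈ D2 C v, nbc C x Finset.univ =
      ∑ x ∈ D2 C v, nbc C x (D1 C v) + ∑ x ∈ D2 C v, nbc C x (D2 C v ∪ D3 C v) := by
    rw [← Finset.sum_add_distrib]
    exact Finset.sum_congr rfl (fun x hx => deg_D2 C v x hx)
  rw [← nbc_swap C (D1 C v) (D2 C v), hm] at e2
  have e1 : ∑ x ∈ D1 C v, nbc C x Finset.univ + ∑ x ∈ D1 C v, nbc (nonG C (D1 C v)) x Finset.univ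
      = d * d + (UU C v).card := by
    rw [← hm, ← Finset.sum_add_distrib]
    have : d * d = ∑ x ∈ D1 C v, d := by rw [Finset.sum_const, hcd, smul_eq_mul]
    rw [this, ← Finset.sum_add_distrib]
    apply Finset.sum_congr rfl
    intro x hx
    have := nonG_deg C (D1 C v) x hx
    have := deg_D1 C v x hx
    omega
  have : t * (t - 1) = d * d + d := by
    rw [← hd]; simp; ring
  omega

lemma nbc_pos {C : SimpleGraph W} {x : W} {X : Finset W} (h : 0 < nbc C x X) :
    ∃ y ∈ X, C.Adj x y := by
  obtain ⟨y, hy⟩ := Finset.card_pos.1 h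
  exact ⟨y, (Finset.mem_filter.1 hy).1, (Finset.mem_filter.1 hy).2⟩

lemma nbc_le_one {C : SimpleGraph W} {x y z : W} {X : Finset W} (h : nbc C x X ≤ 1)
    (hy : y ∈ X) (hz : z ∈ X) (hxy : C.Adj x y) (hxz : C.Adj x z) : y = z :=
  Finset.card_le_one.1 h y (by simp [hy, hxy]) z (by simp [hz, hxz])

lemma D2_nonempty (C : SimpleGraph W) (hC : C.Connected) (t : ℕ) (v : W)
    (hd : nbc C v Finset.univ + 1 = t) (hN : t + 3 ≤ Fintype.card W) : (D2 C v).Nonempty := by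
  by_contra h
  rw [Finset.not_nonempty_iff_eq_empty] at h
  have hcl := closed_univ C hC v (fun x => x = v ∨ C.Adj v x) (Or.inl rfl) (by
    intro x y hx hxy
    by_contra hy
    push Not at hy
    rcases hx with rfl | hx
    · exact hy.2 hxy
    · have : y ∈ D2 C v := mem_D2.2 ⟨hy.1, hy.2, x, hx, hxy⟩
      rw [h] at this; simp at this)
  have h3 : D3 C v = ∅ := by
    rw [Finset.eq_empty_iff_forall_notMem]
    intro x hx
    rcases hcl x with h' | h'
    · exact (mem_D3.1 hx).1 h'
    · exact (mem_D3.1 hx).2.1 h'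
  have := card_split C v
  rw [h, h3] at this
  simp at this
  omega

/-- case `a = 1` -/
lemma miss_a1 (C : SimpleGraph W) (hC : C.Connected) (t : ℕ) (hB : StarBound C t) (v : W)
    (hd : nbc C v Finset.univ + 1 = t) (hN : t + 3 ≤ Fintype.card W)
    (ha : (D2 C v).card = 1) :
    2 * (UU C v).card ≤ ∑ x, nbc (nonG C (D1 C v)) x Finset.univ := by
  obtain ⟨w, hw⟩ := Finset.card_eq_one.1 ha
  have hwD : w ∈ D2 C v := by rw [hw]; simp
  obtain ⟨w', hw'R, hww'⟩ : ∃ w' ∈ D2 C v ∪ D3 C v, C.Adj w w' := by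
    by_contra hno
    push Not at hno
    have hcl := closed_univ C hC v (fun x => x ∉ D3 C v) (by simp [mem_D3]) (by
      intro x y hx hxy hy
      have hxm := Finset.mem_univ x
      rw [univ_split C v] at hxm
      simp only [Finset.mem_union, Finset.mem_singleton] at hxm
      rcases hxm with rfl | h | h | h
      · exact (mem_D3.1 hy).2.1 hxy
      · exact (mem_D3.1 hy).2.2 ⟨x, mem_D1.1 h, hxy⟩
      · rw [hw, Finset.mem_singleton] at h
        subst h
        exact hno y (Finset.mem_union_right _ hy) hxy
      · exact hx h)
    have h3 : D3 C v = ∅ := Finset.eq_empty_iff_forall_notMem.2 hcl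
    have := card_split C v
    rw [h3, ha] at this
    simp at this
    omega
  set F := nonG C (D1 C v) with hF
  have hUD : UU C v ⊆ D1 C v := Finset.filter_subset _ _
  have key : ∀ u ∈ UU C v, 1 ≤ nbc F u (D1 C v \ UU C v) := by
    intro u hu
    by_contra hcon
    have hz : nbc F u (D1 C v \ UU C v) = 0 := by omega
    obtain ⟨hvu, w1, hw1, huw⟩ := mem_UU.1 hu
    rw [hw, Finset.mem_singleton] at hw1
    subst hw1
    have hall : ∀ x ∈ D1 C v, x ≠ u → C.Adj u x ∨ C.Adj w1 x := by
      intro x hx hxu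
      by_cases hxU : x ∈ UU C v
      · obtain ⟨_, w2, hw2, hxw⟩ := mem_UU.1 hxU
        rw [hw, Finset.mem_singleton] at hw2
        subst hw2
        exact Or.inr hxw.symm
      · left
        by_contra hux
        have : 0 < nbc F u (D1 C v \ UU C v) := Finset.card_pos.2 ⟨x, by
          rw [Finset.mem_filter, Finset.mem_sdiff]
          exact ⟨⟨hx, hxU⟩, hUD hu, hx, hxu.symm, hux⟩⟩
        omega
    have hw'1 : w' ∉ D1 C v := by
      intro h
      rcases Finset.mem_union.1 hw'R with h' | h'
      · exact Finset.disjoint_left.1 (disj12 C v) h h'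
      · exact Finset.disjoint_left.1 (disj13 C v) h h'
    have hw'v : w' ≠ v := by
      rintro rfl
      simp [mem_D2, mem_D3] at hw'R
    have hw1D := mem_D2.1 hwD
    have h := hB {u, w1} (insert v (insert w' ((D1 C v).erase u)))
      (conn_insert C u w1 _ (conn_single_s13 C w1) (by simp) huw) ?_ ?_
    · rw [Finset.card_insert_of_notMem, Finset.card_insert_of_notMem,
        Finset.card_erase_of_mem (mem_D1.2 hvu), card_D1] at h
      · have : 0 < (D1 C v).card := Finset.card_pos.2 ⟨u, hUD hu⟩
        rw [card_D1] at this
        omega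
      · simp [hw'1]
      · simp [hw'v.symm, mem_D1]
    · rw [Finset.disjoint_left]
      intro x hx
      simp only [Finset.mem_insert, Finset.mem_singleton] at hx
      rcases hx with rfl | rfl
      · have : x ≠ w' := by rintro rfl; exact hw'1 (hUD hu)
        simp [hvu.ne', this]
      · simp [hw1D.1, hww'.ne, mem_D1, hw1D.2.1]
    · intro x hx
      simp only [Finset.mem_insert, Finset.mem_erase] at hx
      rcases hx with rfl | rfl | ⟨h1, h2⟩
      · exact ⟨u, by simp, hvu.symm⟩
      · exact ⟨w1, by simp, hww'⟩
      · rcases hall x h2 h1 with h | h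
        · exact ⟨u, by simp, h⟩
        · exact ⟨w1, by simp, h⟩
  have hmon : ∀ (x : W) (X : Finset W), nbc F x X ≤ nbc F x Finset.univ := by
    intro x X
    exact Finset.card_le_card (Finset.filter_subset_filter _ (Finset.subset_univ _))
  have c1 : (UU C v).card ≤ ∑ u ∈ UU C v, nbc F u (D1 C v \ UU C v) := by
    have := Finset.card_nsmul_le_sum (UU C v) (fun u => nbc F u (D1 C v \ UU C v)) 1 key
    simpa using this
  have c2 := nbc_swap F (UU C v) (D1 C v \ UU C v)
  have c3 : ∑ u ∈ UU C v, nbc F u (D1 C v \ UU C v) ≤ ∑ u ∈ UU C v, nbc F u Finset.univ :=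
    Finset.sum_le_sum (fun x _ => hmon x _)
  have c4 : ∑ u ∈ D1 C v \ UU C v, nbc F u (UU C v) ≤
      ∑ u ∈ D1 C v \ UU C v, nbc F u Finset.univ :=
    Finset.sum_le_sum (fun x _ => hmon x _)
  have c5 : ∑ u ∈ D1 C v \ UU C v, nbc F u Finset.univ + ∑ u ∈ UU C v, nbc F u Finset.univ =
      ∑ u ∈ D1 C v, nbc F u Finset.univ := Finset.sum_sdiff hUD
  have c6 : ∑ u ∈ D1 C v, nbc F u Finset.univ ≤ ∑ u, nbc F u Finset.univ :=
    Finset.sum_le_sum_of_subset (Finset.subset_univ _)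
  omega

/-- case `a ≥ 2` -/
lemma reach_a2 (C : SimpleGraph W) (t : ℕ) (hB : StarBound C t) (v : W)
    (hd : nbc C v Finset.univ + 1 = t) (ha : 2 ≤ (D2 C v).card) :
    ∀ x ∈ UU C v, ∀ y ∈ UU C v, (nonG C (D1 C v)).Reachable x y := by
  set F := nonG C (D1 C v) with hF
  have key : ∀ u u' w w', C.Adj v u → C.Adj v u' → w ∈ D2 C v → w' ∈ D2 C v → C.Adj u w →
      C.Adj u' w' → w ≠ w' → F.Reachable u u' := by
    intro u u' w w' hu hu' hw hw' huw huw' hne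
    have hw2 := mem_D2.1 hw
    have hw2' := mem_D2.1 hw'
    have huu' : u ≠ u' := by
      rintro rfl
      have := F1 C t hB v u (mem_D1.2 hu)
      exact hne (nbc_le_one (by omega) hw hw' huw huw')
    by_cases hadj : C.Adj u u'
    · obtain ⟨x, hx, hxu, hxu', h1, h2⟩ : ∃ x ∈ D1 C v, x ≠ u ∧ x ≠ u' ∧ ¬ C.Adj u x ∧
          ¬ C.Adj u' x := by
        by_contra hcon
        push Not at hcon
        have h := hB {u, u'} (insert v (insert w (insert w' (((D1 C v).erase u).erase u'))))
          (conn_insert C u u' _ (conn_single_s13 C u') (by simp) hadj) ?_ ?_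
        · rw [Finset.card_insert_of_notMem, Finset.card_insert_of_notMem,
            Finset.card_insert_of_notMem, Finset.card_erase_of_mem,
            Finset.card_erase_of_mem (mem_D1.2 hu), card_D1] at h
          · have : 1 < (D1 C v).card :=
              Finset.one_lt_card.2 ⟨u, mem_D1.2 hu, u', mem_D1.2 hu', huu'⟩
            rw [card_D1] at this
            omega
          · simp [huu'.symm, mem_D1, hu']
          · simp [mem_D1, hw2'.2.1]
          · simp [mem_D1, hw2.2.1, hne]
          · simp [mem_D1, hw2.1.symm, hw2'.1.symm]
        · have n1 : u ≠ w := by rintro rfl; exact hw2.2.1 hu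
          have n2 : u ≠ w' := by rintro rfl; exact hw2'.2.1 hu
          have n3 : u' ≠ w := by rintro rfl; exact hw2.2.1 hu'
          have n4 : u' ≠ w' := by rintro rfl; exact hw2'.2.1 hu'
          rw [Finset.disjoint_left]
          intro x hx
          simp only [Finset.mem_insert, Finset.mem_singleton] at hx
          rcases hx with rfl | rfl
          · simp [hu.ne', n1, n2]
          · simp [hu'.ne', n3, n4]
        · intro x hx
          simp only [Finset.mem_insert, Finset.mem_erase] at hx
          rcases hx with rfl | rfl | rfl | ⟨h1, h2, h3⟩
          · exact ⟨u, by simp, hu.symm⟩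
          · exact ⟨u, by simp, huw⟩
          · exact ⟨u', by simp, huw'⟩
          · by_cases hux : C.Adj u x
            · exact ⟨u, by simp, hux⟩
            · exact ⟨u', by simp, hcon x h3 h2 h1 hux⟩
      have a1 : F.Adj u x := ⟨mem_D1.2 hu, hx, hxu.symm, h1⟩
      have a2 : F.Adj u' x := ⟨mem_D1.2 hu', hx, hxu'.symm, h2⟩
      exact a1.reachable.trans a2.reachable.symm
    · exact SimpleGraph.Adj.reachable (show F.Adj u u' from
        ⟨mem_D1.2 hu, mem_D1.2 hu', huu', hadj⟩)
  intro x hx y hy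
  obtain ⟨hvx, w, hw, hxw⟩ := mem_UU.1 hx
  obtain ⟨hvy, w', hw', hyw'⟩ := mem_UU.1 hy
  by_cases hne : w = w'
  · subst hne
    obtain ⟨w2, hw2, hne2⟩ := Finset.exists_mem_ne (by omega : 1 < (D2 C v).card) w
    obtain ⟨_, _, u2, hvu2, hu2⟩ := mem_D2.1 hw2
    exact (key x u2 w w2 hvx hvu2 hw hw2 hxw hu2 hne2.symm).trans
      (key y u2 w w2 hvy hvu2 hw hw2 hyw' hu2 hne2.symm).symm
  · exact key x y w w' hvx hvy hw hw' hxw hyw' hne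

lemma k0_bound (C : SimpleGraph W) (hC : C.Connected) (t Q : ℕ) (ht : 4 ≤ t)
    (hB : StarBound C t) (v : W)
    (hd : nbc C v Finset.univ + 1 = t) (hN : Fintype.card W = t + Q) (hQ : 3 ≤ Q) :
    ∑ x, nbc C x Finset.univ ≤ t * (t - 1) + 2 * Q ∧
    (Q = 3 → ∑ x, nbc C x Finset.univ = t * (t - 1) + 2 * Q →
      (∀ x, 2 ≤ nbc C x Finset.univ) ∧ ∃ z, nbc C z Finset.univ = 2) := by
  have hid := identity0 C t hB v hd
  have hcs := card_split C v
  have ho2 : ∀ x ∈ D2 C v, nbc C x (D2 C v ∪ D3 C v) ≤ 1 := by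
    intro x hx
    have := F2 C t hB v x hx
    omega
  have ho3 : ∀ x ∈ D3 C v, nbc C x Finset.univ ≤ 2 := by
    intro x hx
    have := F3 C hC t hB v x hx
    omega
  have s2 : ∑ x ∈ D2 C v, nbc C x (D2 C v ∪ D3 C v) ≤ (D2 C v).card := by
    have := Finset.sum_le_card_nsmul (D2 C v) (fun x => nbc C x (D2 C v ∪ D3 C v)) 1 ho2
    simpa using this
  have s3 : ∑ x ∈ D3 C v, nbc C x Finset.univ ≤ (D3 C v).card * 2 := by
    have := Finset.sum_le_card_nsmul (D3 C v) (fun x => nbc C x Finset.univ) 2 ho3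
    simpa using this
  have hne := D2_nonempty C hC t v hd (by omega)
  have hpos := Finset.card_pos.2 hne
  rcases Nat.lt_or_ge 1 (D2 C v).card with ha | ha
  · have hr := reach_a2 C t hB v hd ha
    have hrc := reach_card _ _ hr
    refine ⟨by omega, ?_⟩
    rintro rfl heq
    have a2 : (D2 C v).card = 2 := by omega
    have b1 : (D3 C v).card = 1 := by omega
    have e2 : ∑ x ∈ D2 C v, nbc C x (D2 C v ∪ D3 C v) = ∑ x ∈ D2 C v, 1 := by
      simp; omega
    have e3 : ∑ x ∈ D3 C v, nbc C x Finset.univ = ∑ x ∈ D3 C v, 2 := by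
      simp; omega
    have e2' := (Finset.sum_eq_sum_iff_of_le ho2).1 e2
    have e3' := (Finset.sum_eq_sum_iff_of_le ho3).1 e3
    have hcard2 : ∀ (x y z : W), y ≠ z → C.Adj x y → C.Adj x z → 2 ≤ nbc C x Finset.univ := by
      intro x y z hyz hxy hxz
      exact Finset.one_lt_card.2 ⟨y, by simp [hxy], z, by simp [hxz], hyz⟩
    constructor
    · intro x
      have hxm := Finset.mem_univ x
      rw [univ_split C v] at hxm
      simp only [Finset.mem_union, Finset.mem_singleton] at hxm
      rcases hxm with rfl | h | h | h
      · omega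
      · by_cases hxU : x ∈ UU C v
        · obtain ⟨hvx, w, hw, hxw⟩ := mem_UU.1 hxU
          exact hcard2 x v w (mem_D2.1 hw).1.symm hvx.symm hxw
        · by_contra hlt
          have hdx := deg_D1 C v x h
          have h0 : nbc C x (D1 C v) = 0 := by omega
          have hF : ∀ y ∈ UU C v, (nonG C (D1 C v)).Reachable x y := by
            intro y hy
            have hy1 : y ∈ D1 C v := mem_D1.2 (mem_UU.1 hy).1
            refine SimpleGraph.Adj.reachable ((nonG_adj _ _ _ _).2 ⟨h, hy1, ?_, ?_⟩)
            · rintro rfl; exact hxU hy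
            · intro hxy
              have : 0 < nbc C x (D1 C v) :=
                Finset.card_pos.2 ⟨y, Finset.mem_filter.2 ⟨hy1, hxy⟩⟩
              omega
          have hr2 : ∀ y ∈ insert x (UU C v), ∀ z ∈ insert x (UU C v),
              (nonG C (D1 C v)).Reachable y z := by
            intro y hy z hz
            rcases Finset.mem_insert.1 hy with hy1 | hy1 <;>
              rcases Finset.mem_insert.1 hz with hz1 | hz1
            · rw [hy1, hz1]
            · rw [hy1]; exact hF z hz1
            · rw [hz1]; exact (hF y hy1).symm
            · exact hr y hy1 z hz1
          have hrc2 := reach_card _ _ hr2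
          rw [Finset.card_insert_of_notMem hxU] at hrc2
          omega
      · have h1 := e2' x h
        have h2 := deg_D2 C v x h
        obtain ⟨_, _, u, hvu, hux⟩ := mem_D2.1 h
        have : 0 < nbc C x (D1 C v) :=
          Finset.card_pos.2 ⟨u, Finset.mem_filter.2 ⟨mem_D1.2 hvu, hux.symm⟩⟩
        omega
      · have := e3' x h
        omega
    · obtain ⟨z, hz⟩ := Finset.card_pos.1 (by omega : 0 < (D3 C v).card)
      exact ⟨z, e3' z hz⟩
  · have ha1 : (D2 C v).card = 1 := by omega
    have := miss_a1 C hC t hB v hd (by omega) ha1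
    refine ⟨by omega, fun _ h => ?_⟩
    omega

lemma W3_lt (C : SimpleGraph W) (hC : C.Connected) (x y : W)
    (hxy : nbc C x Finset.univ ≠ nbc C y Finset.univ) :
    ∑ v, ∑ w, (if C.Adj v w then (nbc C v Finset.univ : ℝ) * nbc C w Finset.univ else 0) <
      ∑ v, (nbc C v Finset.univ : ℝ) ^ 3 := by
  have hrow : ∀ v, (nbc C v Finset.univ : ℝ) ^ 3 =
      ∑ w, (if C.Adj v w then (nbc C v Finset.univ : ℝ) ^ 2 else 0) := by
    intro v
    rw [← Finset.sum_filter, Finset.sum_const, nsmul_eq_mul]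
    change _ = (nbc C v Finset.univ : ℝ) * _
    ring
  have h1 : ∑ v, (nbc C v Finset.univ : ℝ) ^ 3 =
      ∑ v, ∑ w, (if C.Adj v w then (nbc C v Finset.univ : ℝ) ^ 2 else 0) :=
    Finset.sum_congr rfl (fun v _ => hrow v)
  have h2 : ∑ v, (nbc C v Finset.univ : ℝ) ^ 3 =
      ∑ v, ∑ w, (if C.Adj v w then (nbc C w Finset.univ : ℝ) ^ 2 else 0) := by
    rw [h1, Finset.sum_comm]
    refine Finset.sum_congr rfl (fun v _ => Finset.sum_congr rfl (fun w _ => ?_))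
    simp only [C.adj_comm]
  have h3 : 0 < ∑ v, ∑ w, (if C.Adj v w then
      ((nbc C v Finset.univ : ℝ) - nbc C w Finset.univ) ^ 2 else 0) := by
    have hnn : ∀ v w, 0 ≤ (if C.Adj v w then
      ((nbc C v Finset.univ : ℝ) - nbc C w Finset.univ) ^ 2 else 0) := by
      intro v w; split_ifs <;> positivity
    by_contra hcon
    have hz : ∑ v, ∑ w, (if C.Adj v w then
      ((nbc C v Finset.univ : ℝ) - nbc C w Finset.univ) ^ 2 else 0) = 0 :=
      le_antisymm (not_lt.1 hcon) (Finset.sum_nonneg (fun v _ => Finset.sum_nonneg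
        (fun w _ => hnn v w)))
    apply hxy
    have := closed_univ C hC x (fun z => nbc C x Finset.univ = nbc C z Finset.univ) rfl (by
      intro a b ha hab
      rw [ha]
      have h5 := (Finset.sum_eq_zero_iff_of_nonneg (fun v _ => Finset.sum_nonneg
        (fun w _ => hnn v w))).1 hz a (Finset.mem_univ _)
      have h6 := (Finset.sum_eq_zero_iff_of_nonneg (fun w _ => hnn a w)).1 h5 b (Finset.mem_univ _)
      rw [if_pos hab] at h6
      have h7 : (nbc C a Finset.univ : ℝ) - nbc C b Finset.univ = 0 := by
        exact pow_eq_zero_iff (two_ne_zero) |>.1 h6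
      have h8 : (nbc C a Finset.univ : ℝ) = nbc C b Finset.univ := by linarith
      exact_mod_cast h8) y
    exact this
  have h4 : ∑ v, ∑ w, (if C.Adj v w then
      ((nbc C v Finset.univ : ℝ) - nbc C w Finset.univ) ^ 2 else 0) =
      ∑ v, ∑ w, (if C.Adj v w then (nbc C v Finset.univ : ℝ) ^ 2 else 0) +
      ∑ v, ∑ w, (if C.Adj v w then (nbc C w Finset.univ : ℝ) ^ 2 else 0) -
      2 * ∑ v, ∑ w, (if C.Adj v w then (nbc C v Finset.univ : ℝ) * nbc C w Finset.univ else 0) := by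
    rw [Finset.mul_sum, ← Finset.sum_add_distrib, ← Finset.sum_sub_distrib]
    refine Finset.sum_congr rfl (fun v _ => ?_)
    rw [Finset.mul_sum, ← Finset.sum_add_distrib, ← Finset.sum_sub_distrib]
    refine Finset.sum_congr rfl (fun w _ => ?_)
    split_ifs <;> ring
  linarith

/-- the tie analysis for `d = t - 1` -/
lemma tie_analysis (C : SimpleGraph W) (hC : C.Connected) (t : ℕ) (ht : 4 ≤ t)
    (hN : Fintype.card W = t + 3) (hE : ∑ x, nbc C x Finset.univ = t * (t - 1) + 6)
    (hmin : ∀ x, 2 ≤ nbc C x Finset.univ) (hmax : ∀ x, nbc C x Finset.univ + 1 ≤ t)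
    (v z : W) (hv : nbc C v Finset.univ + 1 = t) (hz : nbc C z Finset.univ = 2) :
    (∑ x, (nbc C x Finset.univ : ℝ) ^ 2 < t * ((t : ℝ) - 1) ^ 2 + 12) ∨
    (∑ x, (nbc C x Finset.univ : ℝ) ^ 2 = t * ((t : ℝ) - 1) ^ 2 + 12 ∧
      ∑ v, ∑ w, (if C.Adj v w then (nbc C v Finset.univ : ℝ) * nbc C w Finset.univ else 0) <
        t * ((t : ℝ) - 1) ^ 3 + 24) := by
  have hER : ∑ x, (nbc C x Finset.univ : ℝ) = t * ((t : ℝ) - 1) + 6 := by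
    have := congrArg (fun n : ℕ => (n : ℝ)) hE
    push_cast [Nat.cast_sub (by omega : 1 ≤ t)] at this
    exact this
  have hcard : ∑ x : W, (1 : ℝ) = t + 3 := by
    simp [hN]
  have hnn : ∀ x : W, 0 ≤ ((nbc C x Finset.univ : ℝ) - 2) * ((t : ℝ) - 1 - nbc C x Finset.univ) := by
    intro x
    have h1 : (2 : ℝ) ≤ nbc C x Finset.univ := by exact_mod_cast hmin x
    have h2 : (nbc C x Finset.univ : ℝ) + 1 ≤ t := by exact_mod_cast hmax x
    apply mul_nonneg <;> linarith
  have hsum : ∑ x : W, ((nbc C x Finset.univ : ℝ) - 2) * ((t : ℝ) - 1 - nbc C x Finset.univ) =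
      t * ((t : ℝ) - 1) ^ 2 + 12 - ∑ x, (nbc C x Finset.univ : ℝ) ^ 2 := by
    have : ∀ x : W, ((nbc C x Finset.univ : ℝ) - 2) * ((t : ℝ) - 1 - nbc C x Finset.univ) =
        ((t : ℝ) + 1) * nbc C x Finset.univ - 2 * ((t : ℝ) - 1) * 1 -
          (nbc C x Finset.univ : ℝ) ^ 2 := fun x => by ring
    simp only [this, Finset.sum_sub_distrib, ← Finset.mul_sum]
    rw [hER, hcard]
    ring
  have hge : 0 ≤ ∑ x : W, ((nbc C x Finset.univ : ℝ) - 2) * ((t : ℝ) - 1 - nbc C x Finset.univ) :=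
    Finset.sum_nonneg (fun x _ => hnn x)
  rcases hge.lt_or_eq with h | h
  · left; linarith
  · right
    have hW2 : ∑ x, (nbc C x Finset.univ : ℝ) ^ 2 = t * ((t : ℝ) - 1) ^ 2 + 12 := by linarith
    refine ⟨hW2, ?_⟩
    have hzero := (Finset.sum_eq_zero_iff_of_nonneg (fun x _ => hnn x)).1 h.symm
    have h3 : ∑ x, (nbc C x Finset.univ : ℝ) ^ 3 = t * ((t : ℝ) - 1) ^ 3 + 24 := by
      have : ∀ x : W, (nbc C x Finset.univ : ℝ) ^ 3 =
          ((t : ℝ) + 1) * (nbc C x Finset.univ : ℝ) ^ 2 -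
            2 * ((t : ℝ) - 1) * nbc C x Finset.univ := by
        intro x
        have := hzero x (Finset.mem_univ _)
        linear_combination (-(nbc C x Finset.univ : ℝ)) * this
      simp only [this, Finset.sum_sub_distrib, ← Finset.mul_sum]
      rw [hW2, hER]
      ring
    rw [← h3]
    exact W3_lt C hC v z (by omega)

lemma arith_p2 (t p q k a : ℤ) (hp : 2 ≤ p) (hk : 1 ≤ k) (ha : 0 ≤ a) (h4 : 4 * k * p ≤ t)
    (h : (p - 1) * (t * (t - 3 - k)) + (k - 1) * t + 1 - k - k ^ 2 + q * (q - 3 - k) + a ≤ 0) :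
    False := by
  have hqq : -(3 + k) ^ 2 ≤ 4 * (q * (q - 3 - k)) := by linarith [sq_nonneg (2 * q - 3 - k)]
  have h8 : 8 * k ≤ t := by
    have : 4 * k * 2 ≤ 4 * k * p := mul_le_mul_of_nonneg_left hp (by linarith)
    linarith
  have h9 : 4 * k ≤ t - 3 - k := by linarith
  have h10 : (8 * k) * (4 * k) ≤ t * (t - 3 - k) :=
    mul_le_mul h8 h9 (by linarith) (by linarith)
  have h11 : 1 * (t * (t - 3 - k)) ≤ (p - 1) * (t * (t - 3 - k)) :=
    mul_le_mul_of_nonneg_right (by linarith) (by nlinarith)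
  have h12 : 0 ≤ (k - 1) * t := mul_nonneg (by linarith) (by linarith)
  nlinarith

lemma arith_p1 (t q k a : ℤ) (hk : 1 ≤ k) (ha : 0 ≤ a) (h4 : 4 * k ≤ t)
    (hq3 : 3 ≤ q) (hstar : k * (t + q) ≤ q * (t - q))
    (h : (k - 1) * t + 1 - k - k ^ 2 + q * (q - 3 - k) + a ≤ 0) :
    k = 1 ∧ q ≤ 4 := by
  have hqq : -(3 + k) ^ 2 ≤ 4 * (q * (q - 3 - k)) := by linarith [sq_nonneg (2 * q - 3 - k)]
  have hk3 : k ≤ 2 := by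
    by_contra hcon
    push Not at hcon
    have : (k - 1) * (4 * k) ≤ (k - 1) * t := mul_le_mul_of_nonneg_left h4 (by linarith)
    nlinarith
  have hk12 : k = 1 ∨ k = 2 := by omega
  rcases hk12 with rfl | rfl
  · refine ⟨rfl, ?_⟩
    by_contra hcon
    push Not at hcon
    nlinarith
  · exfalso
    by_cases hq5 : 5 ≤ q
    · nlinarith
    · have : q = 3 ∨ q = 4 := by omega
      rcases this with rfl | rfl <;> linarith

lemma arith_k (t p q k d a b E : ℤ) (ht : 4 ≤ t) (hp : 1 ≤ p) (hq0 : 0 ≤ q) (hqt : q < t)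
    (hN : t + 3 ≤ p * t + q) (hd : d = t - 1 - k) (hk : 1 ≤ k) (ha : 0 ≤ a) (hb : 0 ≤ b)
    (hab : 1 + d + a + b = p * t + q) (hE1 : E ≤ (p * t + q) * d)
    (hE2 : E ≤ d + d * d + d * (k + 1) + a * (k + 1) + b * (k + 2))
    (hE3 : E ≤ d + d * d + a * d + b * (k + 2)) (heven : E % 2 = 0)
    (hge : p * (t * (t - 1)) + q * (q - 1) ≤ E) :
    p = 1 ∧ q = 3 ∧ k = 1 ∧ E = t * (t - 1) + 6 := by
  subst hd
  have hstar : k * (p * t + q) ≤ q * (t - q) := by linarith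
  have h4 : 4 * k * p ≤ t := by
    have h5 : 4 * (k * (p * t + q)) ≤ t * t := by linarith [sq_nonneg (t - 2 * q)]
    have h6 : 0 ≤ k * q := by positivity
    have h7 : (4 * k * p) * t ≤ t * t := by linarith
    exact le_of_mul_le_mul_right h7 (by linarith)
  have hb' : b = p * t + q - t + k - a := by linarith
  subst hb'
  have hcr2 : (p - 1) * (t * (t - 3 - k)) + (k - 1) * t + 1 - k - k ^ 2 + q * (q - 3 - k) + a ≤ 0 := by
    linarith
  rcases lt_or_eq_of_le hp with hp2 | hp1
  · exact (arith_p2 t p q k a hp2 hk ha h4 hcr2).elim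
  · subst hp1
    have hq3 : 3 ≤ q := by linarith
    obtain ⟨rfl, hq4⟩ := arith_p1 t q k a hk ha (by linarith) hq3 (by linarith) (by linarith)
    have : q = 3 ∨ q = 4 := by omega
    rcases this with rfl | rfl
    · refine ⟨rfl, rfl, rfl, ?_⟩
      by_cases ha3 : 3 ≤ a
      · obtain ⟨r, hr⟩ := Int.even_mul_succ_self (t - 1)
        have h1 : t * (t - 1) = 2 * r := by linarith
        have h2 : E ≤ t * (t - 1) + 10 - a := by linarith
        have h3 : t * (t - 1) + 6 ≤ E := by linarith
        omega
      · exfalso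
        have : a = 0 ∨ a = 1 ∨ a = 2 := by omega
        rcases this with rfl | rfl | rfl <;> linarith
    · exfalso
      by_cases ha3 : 2 ≤ a
      · linarith
      · have : a = 0 ∨ a = 1 := by omega
        rcases this with rfl | rfl <;> linarith

/-- Combinatorial main theorem. -/
theorem comb_main (C : SimpleGraph W) (hC : C.Connected) (t p q : ℕ) (ht : 4 ≤ t)
    (hB : StarBound C t) (hqt : q < t) (hN : Fintype.card W = p * t + q)
    (hN3 : t + 3 ≤ Fintype.card W) :
    (∀ x, nbc C x Finset.univ + 1 ≤ t) ∧
    2 * (∑ x, (nbc C x Finset.univ : ℝ)) ≤ 2 * (t : ℝ) ^ 2 + (p * t + q) * (t + 1) ∧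
    ((∑ x, (nbc C x Finset.univ : ℝ)) + 1 ≤ p * (t * ((t : ℝ) - 1)) + q * ((q : ℝ) - 1) ∨
      (p = 1 ∧ q = 3 ∧ (∑ x, (nbc C x Finset.univ : ℝ)) = t * ((t : ℝ) - 1) + 6 ∧
        ((∑ x, (nbc C x Finset.univ : ℝ) ^ 2 < t * ((t : ℝ) - 1) ^ 2 + 12) ∨
         (∑ x, (nbc C x Finset.univ : ℝ) ^ 2 = t * ((t : ℝ) - 1) ^ 2 + 12 ∧
          ∑ v, ∑ w, (if C.Adj v w then (nbc C v Finset.univ : ℝ) * nbc C w Finset.univ else 0) <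
            t * ((t : ℝ) - 1) ^ 3 + 24)))) := by
  have hdl := deg_lt C t hB
  refine ⟨hdl, ?_⟩
  have : Nonempty W := hC.nonempty
  obtain ⟨v, hv⟩ := Finite.exists_max (fun x => nbc C x Finset.univ)
  obtain ⟨d, hd⟩ : ∃ d, nbc C v Finset.univ = d := ⟨_, rfl⟩
  obtain ⟨k, hk⟩ : ∃ k, d + k + 1 = t := ⟨t - 1 - d, by have := hdl v; omega⟩
  obtain ⟨c1, c2⟩ := crude C hC t hB v hv d k hd hk
  have hcs := card_split C v
  rw [hd, hN] at hcs
  rw [hN] at hN3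
  set a := (D2 C v).card
  set b := (D3 C v).card
  obtain ⟨E, hE⟩ : ∃ E, ∑ x, nbc C x Finset.univ = E := ⟨_, rfl⟩
  have hER : ∑ x, (nbc C x Finset.univ : ℝ) = E := by rw [← hE]; push_cast; rfl
  have hEd : E ≤ (p * t + q) * d := by
    have := Finset.sum_le_card_nsmul Finset.univ (fun x => nbc C x Finset.univ) d
      (fun x _ => hd ▸ hv x)
    rwa [hE, Finset.card_univ, hN, smul_eq_mul] at this
  rw [hE] at c1 c2
  rw [hER]
  have hp : 1 ≤ p := by
    by_contra h
    have : p = 0 := by omega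
    subst this
    omega
  constructor
  · have key : 2 * E ≤ 2 * t ^ 2 + (p * t + q) * (t + 1) := by
      have hk' : k = t - 1 - d := by omega
      by_cases h2d : 2 * d ≤ t + 1
      · have e0 : (p * t + q) * (2 * d) ≤ (p * t + q) * (t + 1) := Nat.mul_le_mul_left _ h2d
        have e1 : 2 * E ≤ (p * t + q) * (2 * d) := by
          calc 2 * E ≤ 2 * ((p * t + q) * d) := Nat.mul_le_mul_left _ hEd
            _ = (p * t + q) * (2 * d) := by ring
        omega
      · have hkk : 2 * (k + 2) ≤ t + 1 := by omega
        have e1 : 2 * (a * (k + 1) + b * (k + 2)) ≤ (a + b) * (t + 1) := by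
          calc 2 * (a * (k + 1) + b * (k + 2)) ≤ 2 * (a * (k + 2) + b * (k + 2)) := by
                gcongr; omega
            _ = (a + b) * (2 * (k + 2)) := by ring
            _ ≤ (a + b) * (t + 1) := Nat.mul_le_mul_left _ hkk
        have e2 : d + d * d + d * (k + 1) = d * (t + 1) := by rw [← hk]; ring
        have e3 : (p * t + q) * (t + 1) = (t + 1) + d * (t + 1) + (a + b) * (t + 1) := by
          rw [hcs]; ring
        have e4 : d * (t + 1) ≤ 2 * t ^ 2 := by
          calc d * (t + 1) ≤ t * (t + t) := Nat.mul_le_mul (by omega) (by omega)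
            _ = 2 * t ^ 2 := by ring
        omega
    exact_mod_cast key
  · have heven : E % 2 = 0 := by
      have h1 := SimpleGraph.sum_degrees_eq_twice_card_edges C
      have h2 : ∑ x, C.degree x = E := by
        rw [← hE]; exact Finset.sum_congr rfl (fun x _ => (nbc_degree C x).symm)
      omega
    have conv : (E : ℤ) < p * (t * ((t : ℤ) - 1)) + q * ((q : ℤ) - 1) →
        (E : ℝ) + 1 ≤ p * (t * ((t : ℝ) - 1)) + q * ((q : ℝ) - 1) := by
      intro h
      have h2 : (E : ℤ) + 1 ≤ p * (t * ((t : ℤ) - 1)) + q * ((q : ℤ) - 1) := h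
      have h3 : (((E : ℤ) + 1 : ℤ) : ℝ) ≤
        ((p * (t * ((t : ℤ) - 1)) + q * ((q : ℤ) - 1) : ℤ) : ℝ) := Int.cast_le.2 h2
      push_cast at h3
      exact h3
    by_cases hlt : (E : ℤ) < p * (t * ((t : ℤ) - 1)) + q * ((q : ℤ) - 1)
    · exact Or.inl (conv hlt)
    · right
      push Not at hlt
      rcases Nat.eq_zero_or_pos k with hk0 | hk1
      · subst hk0
        obtain ⟨Q, hQ⟩ : ∃ Q, p * t + q = t + Q := ⟨p * t + q - t, by omega⟩
        obtain ⟨b1, b2⟩ := k0_bound C hC t Q ht hB v (by omega) (by omega) (by omega)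
        rw [hE] at b1 b2
        have b1' : (E : ℤ) ≤ t * ((t : ℤ) - 1) + 2 * Q := by
          have : ((E : ℕ) : ℤ) ≤ ((t * (t - 1) + 2 * Q : ℕ) : ℤ) := by exact_mod_cast b1
          push_cast [Nat.cast_sub (by omega : 1 ≤ t)] at this
          exact this
        have hQ' : (Q : ℤ) = (p - 1) * t + q := by
          have : ((p * t + q : ℕ) : ℤ) = ((t + Q : ℕ) : ℤ) := by rw [hQ]
          push_cast at this
          linarith
        have ht' : (4 : ℤ) ≤ t := by exact_mod_cast ht
        have hcomb : ((p : ℤ) - 1) * (t * (t - 3)) + q * ((q : ℤ) - 3) ≤ 0 := by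
          rw [hQ'] at b1'
          linarith
        have hqz : (q : ℤ) * (q - 3) ≥ -2 := by
          have : q = 0 ∨ q = 1 ∨ q = 2 ∨ 3 ≤ q := by omega
          rcases this with rfl | rfl | rfl | h
          · norm_num
          · norm_num
          · norm_num
          · have : (3 : ℤ) ≤ q := by exact_mod_cast h
            have : (0 : ℤ) ≤ q * (q - 3) := mul_nonneg (by linarith) (by linarith)
            linarith
        have hp1 : p = 1 := by
          by_contra hne
          have : (2 : ℤ) ≤ p := by exact_mod_cast (by omega : 2 ≤ p)
          have h5 : (4 : ℤ) * 1 ≤ t * (t - 3) :=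
            mul_le_mul ht' (by linarith) (by norm_num) (by linarith)
          have h6 : 1 * ((t : ℤ) * (t - 3)) ≤ ((p : ℤ) - 1) * (t * (t - 3)) :=
            mul_le_mul_of_nonneg_right (by linarith) (by linarith)
          linarith
        subst hp1
        have hq3 : q = 3 := by
          have h6 : 3 ≤ q := by omega
          by_contra hne
          have : (4 : ℤ) ≤ q := by exact_mod_cast (by omega : 4 ≤ q)
          push_cast at hcomb
          have h7 : (4 : ℤ) * 1 ≤ q * (q - 3) :=
            mul_le_mul this (by linarith) (by norm_num) (by linarith)
          linarith
        subst hq3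
        have hQ3 : Q = 3 := by omega
        subst hQ3
        have hEq : E = t * (t - 1) + 2 * 3 := by
          apply le_antisymm b1
          have : (((t * (t - 1) + 2 * 3 : ℕ)) : ℤ) ≤ (E : ℤ) := by
            push_cast [Nat.cast_sub (by omega : 1 ≤ t)]
            push_cast at hlt
            linarith
          exact_mod_cast this
        obtain ⟨hmin, z, hz⟩ := b2 rfl hEq
        refine ⟨rfl, rfl, ?_, ?_⟩
        · rw [hEq]; push_cast [Nat.cast_sub (by omega : 1 ≤ t)]; norm_num
        · exact tie_analysis C hC t ht (by omega) (by rw [hE, hEq]) hmin hdl v z (by omega) hz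
      · have hA := arith_k t p q k d a b E (by exact_mod_cast ht) (by exact_mod_cast hp)
          (by positivity) (by exact_mod_cast hqt) (by exact_mod_cast hN3) (by omega)
          (by exact_mod_cast hk1) (by positivity) (by positivity)
          (by have : ((p * t + q : ℕ) : ℤ) = ((1 + (d + (a + b)) : ℕ) : ℤ) := by rw [hcs]
              push_cast at this; linarith)
          (by exact_mod_cast hEd) (by exact_mod_cast c1) (by exact_mod_cast c2)
          (by exact_mod_cast heven) hlt
        obtain ⟨hp1, hq3, hk1, hEq⟩ := hA
        have hp1' : p = 1 := by exact_mod_cast hp1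
        have hq3' : q = 3 := by exact_mod_cast hq3
        have hk1' : k = 1 := by exact_mod_cast hk1
        have hEqR : (E : ℝ) = t * ((t : ℝ) - 1) + 6 := by
          have : ((E : ℤ) : ℝ) = ((t * ((t : ℤ) - 1) + 6 : ℤ) : ℝ) := by rw [hEq]
          push_cast at this
          exact this
        refine ⟨hp1', hq3', hEqR, Or.inl ?_⟩
        have hb2 : ∀ x, (nbc C x Finset.univ : ℝ) ^ 2 ≤ ((t : ℝ) - 2) * nbc C x Finset.univ := by
          intro x
          have h1 : nbc C x Finset.univ + 2 ≤ t := by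
            have := hv x
            omega
          have h2 : (nbc C x Finset.univ : ℝ) + 2 ≤ t := by exact_mod_cast h1
          have h3 : (0 : ℝ) ≤ nbc C x Finset.univ := by positivity
          nlinarith
        have h3 : ∑ x, (nbc C x Finset.univ : ℝ) ^ 2 ≤
            ∑ x, ((t : ℝ) - 2) * nbc C x Finset.univ := Finset.sum_le_sum (fun x _ => hb2 x)
        rw [← Finset.mul_sum, hER, hEqR] at h3
        have ht' : (4 : ℝ) ≤ t := by exact_mod_cast ht
        nlinarith [sq_nonneg ((t : ℝ) - 7 / 2)]

end PartThree

section PartFour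
open Classical
variable {W : Type} [Fintype W]

lemma adj_sum_swap (C : SimpleGraph W) (f g : W → ℝ) :
    ∑ v, f v * ∑ w, (if C.Adj v w then g w else 0) =
      ∑ w, (∑ v, (if C.Adj w v then f v else 0)) * g w := by
  simp only [Finset.mul_sum, Finset.sum_mul]
  rw [Finset.sum_comm]
  refine Finset.sum_congr rfl (fun v _ => Finset.sum_congr rfl (fun w _ => ?_))
  simp only [C.adj_comm v w]
  split_ifs <;> ring

lemma nbc_sum (C : SimpleGraph W) (v : W) (c : ℝ) :
    ∑ w, (if C.Adj v w then c else 0) = nbc C v Finset.univ * c := by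
  rw [← Finset.sum_filter, Finset.sum_const, nsmul_eq_mul]
  rfl

lemma walk_expand (C : SimpleGraph W) (ρ M : ℝ) (x : W → ℝ)
    (hx : ∀ v, ρ * x v = 1 + ∑ w, (if C.Adj v w then x w else 0)) (hM : ∀ v, x v ≤ M) :
    ρ ^ 3 * ∑ v, x v ≤ Fintype.card W * ρ ^ 2 + (∑ v, (nbc C v Finset.univ : ℝ)) * ρ +
      ∑ v, (nbc C v Finset.univ : ℝ) ^ 2 +
      (∑ v, ∑ w, (if C.Adj v w then (nbc C v Finset.univ : ℝ) * nbc C w Finset.univ else 0)) * M := by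
  set D : W → ℝ := fun v => (nbc C v Finset.univ : ℝ) with hD
  set L : W → ℝ := fun v => ∑ w, (if C.Adj v w then D w else 0) with hL
  have s1 : ρ * ∑ v, x v = Fintype.card W + ∑ v, D v * x v := by
    have := adj_sum_swap C (fun _ => 1) x
    simp only [one_mul, nbc_sum, mul_one] at this
    rw [Finset.mul_sum, Finset.sum_congr rfl (fun v _ => hx v), Finset.sum_add_distrib, this]
    simp [hD]
  have s2 : ρ * ∑ v, D v * x v = ∑ v, D v + ∑ v, L v * x v := by
    have := adj_sum_swap C D x
    rw [← this, ← Finset.sum_add_distrib, Finset.mul_sum]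
    refine Finset.sum_congr rfl (fun v _ => ?_)
    rw [mul_left_comm, hx v]; ring
  have hLsum : ∑ v, L v = ∑ v, D v ^ 2 := by
    have := adj_sum_swap C (fun _ => 1) D
    simp only [one_mul, nbc_sum, mul_one] at this
    rw [hL, this]
    refine Finset.sum_congr rfl (fun v _ => ?_)
    rw [sq]
  have s3 : ρ * ∑ v, L v * x v = ∑ v, D v ^ 2 + ∑ v, L v * ∑ w, (if C.Adj v w then x w else 0) := by
    rw [← hLsum, ← Finset.sum_add_distrib, Finset.mul_sum]
    refine Finset.sum_congr rfl (fun v _ => ?_)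
    rw [mul_left_comm, hx v]; ring
  have hLnn : ∀ v, 0 ≤ L v := by
    intro v
    apply Finset.sum_nonneg
    intro w _
    split_ifs
    · exact Nat.cast_nonneg _
    · exact le_rfl
  have s4 : ∑ v, L v * ∑ w, (if C.Adj v w then x w else 0) ≤
      (∑ v, ∑ w, (if C.Adj v w then D v * D w else 0)) * M := by
    have e : (∑ v, ∑ w, (if C.Adj v w then D v * D w else 0)) * M =
        ∑ v, L v * (D v * M) := by
      rw [Finset.sum_mul]
      refine Finset.sum_congr rfl (fun v _ => ?_)
      rw [hL]
      simp only [Finset.sum_mul]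
      refine Finset.sum_congr rfl (fun w _ => ?_)
      split_ifs <;> ring
    rw [e]
    refine Finset.sum_le_sum (fun v _ => mul_le_mul_of_nonneg_left ?_ (hLnn v))
    rw [hD]
    simp only
    rw [← nbc_sum]
    refine Finset.sum_le_sum (fun w _ => ?_)
    split_ifs
    · exact hM w
    · exact le_rfl
  have : ρ ^ 3 * ∑ v, x v = Fintype.card W * ρ ^ 2 + (∑ v, D v) * ρ + ∑ v, D v ^ 2 +
      ∑ v, L v * ∑ w, (if C.Adj v w then x w else 0) := by
    linear_combination ρ ^ 2 * s1 + ρ * s2 + s3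
  linarith

lemma W3_le (C : SimpleGraph W) (m : ℝ) (hm : ∀ v, (nbc C v Finset.univ : ℝ) ≤ m) :
    ∑ v, ∑ w, (if C.Adj v w then (nbc C v Finset.univ : ℝ) * nbc C w Finset.univ else 0) ≤
      m * ∑ v, (nbc C v Finset.univ : ℝ) ^ 2 := by
  rw [Finset.mul_sum]
  refine Finset.sum_le_sum (fun v _ => ?_)
  calc _ ≤ ∑ w, (if C.Adj v w then (nbc C v Finset.univ : ℝ) * m else 0) := by
        refine Finset.sum_le_sum (fun w _ => ?_)
        split_ifs
        · exact mul_le_mul_of_nonneg_left (hm w) (Nat.cast_nonneg _)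
        · exact le_rfl
    _ = m * (nbc C v Finset.univ : ℝ) ^ 2 := by rw [nbc_sum]; ring

lemma inv_expand (ρ δ : ℝ) (h0 : 0 ≤ δ) (h1 : δ < ρ) :
    ρ ^ 2 + δ * ρ + δ ^ 2 + δ ^ 3 / ρ ≤ ρ ^ 3 * (1 / (ρ - δ)) := by
  have hρ : 0 < ρ := by linarith
  rw [mul_one_div, le_div_iff₀ (by linarith)]
  have : (ρ ^ 2 + δ * ρ + δ ^ 2 + δ ^ 3 / ρ) * (ρ - δ) = ρ ^ 3 - δ ^ 4 / ρ := by
    field_simp; ring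
  rw [this]
  have : 0 ≤ δ ^ 4 / ρ := by positivity
  linarith

/-- real-arithmetic core -/
lemma core_ineq (t p q N ρ E W2 W3 M : ℝ) (ht : 4 ≤ t) (hN : N = p * t + q)
    (hNpos : 0 < N) (hρ : 100 * t ^ 5 ≤ ρ) (hM : M = 1 / (ρ - t + 1))
    (hE : E ≤ (t - 1) * N) (hE0 : 0 ≤ E) (hW20 : 0 ≤ W2) (hW30 : 0 ≤ W3)
    (hW2 : W2 ≤ (t - 1) * E) (hW3 : W3 ≤ (t - 1) * W2)
    (hp : 0 ≤ p) (hq2 : 0 ≤ q * (q - 1) ^ 2) (hq3 : 0 ≤ q * (q - 1) ^ 3)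
    (hcase : N ≤ 8 * t ^ 2 * (p * (t * (t - 1)) + q * (q - 1) - E) ∨
      (p = 1 ∧ q = 3 ∧ E = t * (t - 1) + 6 ∧ (W2 + 1 ≤ t * (t - 1) ^ 2 + 12 ∨
        (W2 = t * (t - 1) ^ 2 + 12 ∧ W3 + 1 ≤ t * (t - 1) ^ 3 + 24)))) :
    N * ρ ^ 2 + E * ρ + W2 + W3 * M <
      p * t * (ρ ^ 2 + (t - 1) * ρ + (t - 1) ^ 2 + (t - 1) ^ 3 / ρ) +
        q * (ρ ^ 2 + (q - 1) * ρ + (q - 1) ^ 2 + (q - 1) ^ 3 / ρ) := by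
  have ht1 : (1 : ℝ) ≤ t := by linarith
  have ht45 : t ^ 4 ≤ t ^ 5 := pow_le_pow_right₀ ht1 (by norm_num)
  have ht15 : t ≤ t ^ 5 := by
    calc t = t ^ 1 := (pow_one t).symm
      _ ≤ t ^ 5 := pow_le_pow_right₀ ht1 (by norm_num)
  have ht05 : 1 ≤ t ^ 5 := one_le_pow₀ ht1
  have hρpos : 0 < ρ := by linarith
  have hρt : 0 < ρ - t + 1 := by linarith
  have hM2 : M * ρ ≤ 2 := by
    rw [hM, one_div, inv_mul_le_iff₀ hρt]; linarith
  have hM0 : 0 < M := by rw [hM]; positivity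
  have hW2N : W2 ≤ (t - 1) ^ 2 * N := by
    calc W2 ≤ (t - 1) * E := hW2
      _ ≤ (t - 1) * ((t - 1) * N) := mul_le_mul_of_nonneg_left hE (by linarith)
      _ = _ := by ring
  have hW3N : W3 ≤ (t - 1) ^ 3 * N := by
    calc W3 ≤ (t - 1) * W2 := hW3
      _ ≤ (t - 1) * ((t - 1) ^ 2 * N) := mul_le_mul_of_nonneg_left hW2N (by linarith)
      _ = _ := by ring
  have hdiff : p * t * (ρ ^ 2 + (t - 1) * ρ + (t - 1) ^ 2 + (t - 1) ^ 3 / ρ) +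
        q * (ρ ^ 2 + (q - 1) * ρ + (q - 1) ^ 2 + (q - 1) ^ 3 / ρ) -
        (N * ρ ^ 2 + E * ρ + W2 + W3 * M) =
      (p * (t * (t - 1)) + q * (q - 1) - E) * ρ + (p * t * (t - 1) ^ 2 + q * (q - 1) ^ 2 - W2) +
      ((p * t * (t - 1) ^ 3 + q * (q - 1) ^ 3) / ρ - W3 * M) := by
    rw [hN]; ring
  rw [← sub_pos, hdiff]
  have hMsmall : M * (50 * t ^ 5) ≤ 1 := by
    have : M * (100 * t ^ 5) ≤ M * ρ := mul_le_mul_of_nonneg_left hρ hM0.le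
    linarith
  rcases hcase with h | ⟨rfl, rfl, hEq, h⟩
  · have h1 : 0 ≤ p * t * (t - 1) ^ 2 := by positivity
    have h2 : 0 ≤ (p * t * (t - 1) ^ 3 + q * (q - 1) ^ 3) / ρ := by
      have : 0 ≤ (t - 1) ^ 3 := pow_nonneg (by linarith) _
      positivity
    have h3 : N * (100 * t ^ 5) ≤ 8 * t ^ 2 * ((p * (t * (t - 1)) + q * (q - 1) - E) * ρ) := by
      calc N * (100 * t ^ 5) ≤ N * ρ := mul_le_mul_of_nonneg_left hρ hNpos.le
        _ ≤ 8 * t ^ 2 * (p * (t * (t - 1)) + q * (q - 1) - E) * ρ :=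
          mul_le_mul_of_nonneg_right h hρpos.le
        _ = _ := by ring
    have h4 : N * (12 * t ^ 3) ≤ (p * (t * (t - 1)) + q * (q - 1) - E) * ρ := by
      have : 8 * t ^ 2 * (N * (12 * t ^ 3)) ≤
          8 * t ^ 2 * ((p * (t * (t - 1)) + q * (q - 1) - E) * ρ) := by
        refine le_trans ?_ h3
        have : 0 ≤ N * t ^ 5 := by positivity
        linarith
      exact le_of_mul_le_mul_left this (by positivity)
    have hMt : M ≤ 1 := by
      have : M * 1 ≤ M * (50 * t ^ 5) := mul_le_mul_of_nonneg_left (by linarith) hM0.le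
      linarith
    have h5 : W3 * M ≤ (t - 1) ^ 3 * N := by
      calc W3 * M ≤ W3 * 1 := mul_le_mul_of_nonneg_left hMt hW30
        _ ≤ _ := by linarith
    have h6 : (t - 1) ^ 3 ≤ t ^ 3 := pow_le_pow_left₀ (by linarith) (by linarith) _
    have h7 : (t - 1) ^ 2 ≤ t ^ 2 := pow_le_pow_left₀ (by linarith) (by linarith) _
    have h8 : t ^ 2 ≤ t ^ 3 := pow_le_pow_right₀ ht1 (by norm_num)
    have h9 : (t - 1) ^ 3 * N ≤ t ^ 3 * N := mul_le_mul_of_nonneg_right h6 hNpos.le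
    have h10 : (t - 1) ^ 2 * N ≤ t ^ 3 * N := mul_le_mul_of_nonneg_right (h7.trans h8) hNpos.le
    have h11 : 0 < t ^ 3 * N := by positivity
    linarith
  · have hzero : (1 : ℝ) * (t * (t - 1)) + 3 * (3 - 1) - E = 0 := by rw [hEq]; ring
    rw [hzero]
    rcases h with h | ⟨h, h'⟩
    · have h2 : 0 < (1 * t * (t - 1) ^ 3 + 3 * (3 - 1) ^ 3) / ρ := by
        have : 0 ≤ (t - 1) ^ 3 := pow_nonneg (by linarith) _
        positivity
      have h5 : W3 * M ≤ 1 := by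
        have h6 : (t - 1) ^ 3 ≤ t ^ 3 := pow_le_pow_left₀ (by linarith) (by linarith) _
        have h7 : W3 ≤ 50 * t ^ 5 := by
          calc W3 ≤ (t - 1) ^ 3 * N := hW3N
            _ ≤ t ^ 3 * N := mul_le_mul_of_nonneg_right h6 hNpos.le
            _ ≤ t ^ 3 * (2 * t) := by
              apply mul_le_mul_of_nonneg_left _ (by positivity); linarith
            _ = 2 * t ^ 4 := by ring
            _ ≤ 50 * t ^ 5 := by linarith
        calc W3 * M ≤ (50 * t ^ 5) * M := mul_le_mul_of_nonneg_right h7 hM0.le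
          _ ≤ 1 := by linarith
      linarith
    · have h2 : W3 * M < (1 * t * (t - 1) ^ 3 + 3 * (3 - 1) ^ 3) / ρ := by
        rw [hM, mul_one_div, div_lt_div_iff₀ hρt hρpos]
        set Z := t * (t - 1) ^ 3 with hZ
        have h6 : (t - 1) ^ 3 ≤ t ^ 3 := pow_le_pow_left₀ (by linarith) (by linarith) _
        have hZ4 : Z ≤ t ^ 4 := by
          calc Z ≤ t * t ^ 3 := mul_le_mul_of_nonneg_left h6 (by linarith)
            _ = t ^ 4 := by ring
        have h7 : W3 * ρ ≤ (Z + 23) * ρ := mul_le_mul_of_nonneg_right (by linarith) hρpos.le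
        have h8 : Z * (t - 1) ≤ t ^ 4 * (t - 1) := mul_le_mul_of_nonneg_right hZ4 (by linarith)
        have h9 : t ^ 4 * (t - 1) = t ^ 5 - t ^ 4 := by ring
        have h10 : 0 < t ^ 4 := by positivity
        rw [one_mul]
        have : (Z + 3 * (3 - 1) ^ 3) * (ρ - t + 1) = (Z + 24) * ρ - Z * (t - 1) - 24 * (t - 1) := by
          ring
        rw [this]
        linarith
      rw [h]
      linarith

theorem analytic_main (C : SimpleGraph W) (hC : C.Connected) (t p q : ℕ) (ht : 4 ≤ t)
    (hB : StarBound C t) (hqt : q < t) (hN : Fintype.card W = p * t + q)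
    (hN3 : t + 3 ≤ Fintype.card W) (ρ : ℝ) (hρ : 100 * (t : ℝ) ^ 5 ≤ ρ) (x : W → ℝ)
    (hx : ∀ v, ρ * x v = 1 + ∑ w, (if C.Adj v w then x w else 0))
    (hM : ∀ v, x v ≤ 1 / (ρ - t + 1)) :
    ∑ v, x v < p * t * (1 / (ρ - ((t : ℝ) - 1))) + q * (1 / (ρ - ((q : ℝ) - 1))) := by
  obtain ⟨hdeg, hbig, hmain⟩ := comb_main C hC t p q ht hB hqt hN hN3
  have hw := walk_expand C ρ _ x hx hM
  have ht' : (4 : ℝ) ≤ t := by exact_mod_cast ht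
  have hNR : (Fintype.card W : ℝ) = p * t + q := by rw [hN]; push_cast; ring
  have hdegR : ∀ v, (nbc C v Finset.univ : ℝ) ≤ (t : ℝ) - 1 := by
    intro v
    have : (nbc C v Finset.univ : ℝ) + 1 ≤ t := by exact_mod_cast hdeg v
    linarith
  have hW3 := W3_le C _ hdegR
  have hW2 : ∑ v, (nbc C v Finset.univ : ℝ) ^ 2 ≤ ((t : ℝ) - 1) * ∑ v, (nbc C v Finset.univ : ℝ) := by
    rw [Finset.mul_sum]
    refine Finset.sum_le_sum (fun v _ => ?_)
    rw [sq]
    exact mul_le_mul_of_nonneg_right (hdegR v) (Nat.cast_nonneg _)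
  have hE : ∑ v, (nbc C v Finset.univ : ℝ) ≤ ((t : ℝ) - 1) * Fintype.card W := by
    have := Finset.sum_le_card_nsmul Finset.univ (fun v => (nbc C v Finset.univ : ℝ)) _
      (fun v _ => hdegR v)
    rw [nsmul_eq_mul, Finset.card_univ] at this
    linarith
  have hE0 : 0 ≤ ∑ v, (nbc C v Finset.univ : ℝ) := Finset.sum_nonneg (fun v _ => Nat.cast_nonneg _)
  have hW20 : 0 ≤ ∑ v, (nbc C v Finset.univ : ℝ) ^ 2 := Finset.sum_nonneg (fun v _ => sq_nonneg _)
  have hW30 : 0 ≤ ∑ v, ∑ w,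
      (if C.Adj v w then (nbc C v Finset.univ : ℝ) * nbc C w Finset.univ else 0) := by
    refine Finset.sum_nonneg (fun v _ => Finset.sum_nonneg (fun w _ => ?_))
    split_ifs
    · positivity
    · exact le_rfl
  have hq3 : 0 ≤ (q : ℝ) * ((q : ℝ) - 1) ^ 3 := by
    rcases Nat.eq_zero_or_pos q with rfl | h
    · simp
    · have : (1 : ℝ) ≤ q := by exact_mod_cast h
      exact mul_nonneg (by linarith) (pow_nonneg (by linarith) _)
  have hq1 : 0 ≤ (q : ℝ) * ((q : ℝ) - 1) := by
    rcases Nat.eq_zero_or_pos q with rfl | h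
    · simp
    · have : (1 : ℝ) ≤ q := by exact_mod_cast h
      exact mul_nonneg (by linarith) (by linarith)
  have hNpos : (0 : ℝ) < Fintype.card W := by exact_mod_cast (by omega : 0 < Fintype.card W)
  have ht05 : t ≤ (t : ℝ) ^ 5 := by
    calc (t : ℝ) = (t : ℝ) ^ 1 := (pow_one _).symm
      _ ≤ (t : ℝ) ^ 5 := pow_le_pow_right₀ (by linarith) (by norm_num)
  have hρpos : 0 < ρ := by linarith
  have hcore := core_ineq t p q (Fintype.card W) ρ (∑ v, (nbc C v Finset.univ : ℝ))
    (∑ v, (nbc C v Finset.univ : ℝ) ^ 2) (∑ v, ∑ w,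
      (if C.Adj v w then (nbc C v Finset.univ : ℝ) * nbc C w Finset.univ else 0))
    (1 / (ρ - t + 1)) ht' hNR hNpos hρ rfl hE hE0 hW20 hW30 hW2 hW3 (by positivity)
    (by positivity) hq3 ?_
  · have key : ρ ^ 3 * ∑ v, x v <
        ρ ^ 3 * (p * t * (1 / (ρ - ((t : ℝ) - 1))) + q * (1 / (ρ - ((q : ℝ) - 1)))) := by
      refine lt_of_le_of_lt hw (lt_of_lt_of_le hcore ?_)
      have e1 := inv_expand ρ ((t : ℝ) - 1) (by linarith) (by linarith)
      have e1' := mul_le_mul_of_nonneg_left e1 (show (0 : ℝ) ≤ p * t by positivity)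
      have e2' : (q : ℝ) * (ρ ^ 2 + ((q : ℝ) - 1) * ρ + ((q : ℝ) - 1) ^ 2 + ((q : ℝ) - 1) ^ 3 / ρ) ≤
          q * (ρ ^ 3 * (1 / (ρ - ((q : ℝ) - 1)))) := by
        rcases Nat.eq_zero_or_pos q with rfl | h
        · simp
        · have h1 : (1 : ℝ) ≤ q := by exact_mod_cast h
          have h2 : (q : ℝ) < t := by exact_mod_cast hqt
          exact mul_le_mul_of_nonneg_left (inv_expand ρ _ (by linarith) (by linarith)) (by linarith)
      linarith
    exact lt_of_mul_lt_mul_left key (by positivity)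
  · rcases hmain with h | ⟨hp1, hq, hEq, h⟩
    · left
      by_cases hsmall : (Fintype.card W : ℝ) ≤ 8 * (t : ℝ) ^ 2
      · refine hsmall.trans ?_
        have : 8 * (t : ℝ) ^ 2 * 1 ≤ 8 * (t : ℝ) ^ 2 *
            (p * (t * ((t : ℝ) - 1)) + q * ((q : ℝ) - 1) - ∑ v, (nbc C v Finset.univ : ℝ)) :=
          mul_le_mul_of_nonneg_left (by linarith) (by positivity)
        linarith
      · push Not at hsmall
        set E := ∑ v, (nbc C v Finset.univ : ℝ)
        set N := (Fintype.card W : ℝ)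
        have hqt' : (q : ℝ) ≤ t := by exact_mod_cast hqt.le
        have h1 : (N - t) * ((t : ℝ) - 1) ≤ p * (t * ((t : ℝ) - 1)) := by
          have : (N - t) * ((t : ℝ) - 1) ≤ (p * t) * ((t : ℝ) - 1) :=
            mul_le_mul_of_nonneg_right (by linarith) (by linarith)
          linarith
        rw [← hNR] at hbig
        have h2 : N * 1 ≤ N * ((t : ℝ) - 3) := mul_le_mul_of_nonneg_left (by linarith) hNpos.le
        have h3 : N ≤ 4 * (p * (t * ((t : ℝ) - 1)) + q * ((q : ℝ) - 1) - E) := by linarith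
        have h4 : (4 : ℝ) ≤ 8 * (t : ℝ) ^ 2 := by nlinarith
        have h5 : 0 ≤ p * (t * ((t : ℝ) - 1)) + q * ((q : ℝ) - 1) - E := by linarith
        exact h3.trans (mul_le_mul_of_nonneg_right h4 h5)
    · right
      refine ⟨by rw [hp1]; norm_num, by rw [hq]; norm_num, hEq, ?_⟩
      have c2 : ∑ v, (nbc C v Finset.univ : ℝ) ^ 2 =
          (((∑ v, (nbc C v Finset.univ : ℤ) ^ 2 : ℤ)) : ℝ) := by push_cast; rfl
      have c3 : ∑ v, ∑ w,
          (if C.Adj v w then (nbc C v Finset.univ : ℝ) * nbc C w Finset.univ else 0) =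
          (((∑ v, ∑ w,
          (if C.Adj v w then (nbc C v Finset.univ : ℤ) * nbc C w Finset.univ else 0) : ℤ)) : ℝ) := by
        push_cast
        refine Finset.sum_congr rfl (fun v _ => Finset.sum_congr rfl (fun w _ => ?_))
        split_ifs <;> push_cast <;> rfl
      rcases h with h | ⟨h, h'⟩
      · left
        rw [c2] at h ⊢
        have : (∑ v, (nbc C v Finset.univ : ℤ) ^ 2 : ℤ) < t * ((t : ℤ) - 1) ^ 2 + 12 := by
          exact_mod_cast h
        exact_mod_cast this
      · right
        refine ⟨h, ?_⟩
        rw [c3] at h' ⊢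
        have : (∑ v, ∑ w, (if C.Adj v w then (nbc C v Finset.univ : ℤ) * nbc C w Finset.univ else 0)
            : ℤ) < t * ((t : ℤ) - 1) ^ 3 + 24 := by
          exact_mod_cast h'
        exact_mod_cast this

end PartFour

section PartFive
open Classical

lemma max_principle {V : Type} [Fintype V] (N : V → Finset V) (P : V → Prop) (d ρ c : ℝ)
    (hN : ∀ v, ∀ j ∈ N v, P j)
    (hd : ∀ v, P v → ((N v).card : ℝ) ≤ d) (hρ : d < ρ)
    (hc : 0 ≤ c) (x : V → ℝ)
    (hx : ∀ v, P v → ρ * x v ≤ c + ∑ j ∈ N v, x j) :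
    ∀ v, P v → x v ≤ c / (ρ - d) := by
  intro v0 hv0
  obtain ⟨m, hm, hmax⟩ := Finset.exists_max_image (Finset.univ.filter P) x ⟨v0, by simp [hv0]⟩
  have hPm : P m := by simpa using hm
  have h1 : x v0 ≤ x m := hmax v0 (by simp [hv0])
  refine h1.trans ?_
  have hpos : 0 < ρ - d := by linarith
  by_cases h0 : x m < 0
  · exact h0.le.trans (div_nonneg hc hpos.le)
  · push Not at h0
    have h2 : ∑ j ∈ N m, x j ≤ ∑ j ∈ N m, x m := by
      apply Finset.sum_le_sum
      intro j hj
      exact hmax j (by simp [hN m j hj])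
    rw [Finset.sum_const, nsmul_eq_mul] at h2
    have h3 := mul_le_mul_of_nonneg_right (hd m hPm) h0
    have h4 := hx m hPm
    rw [le_div_iff₀ hpos]
    have h5 : x m * (ρ - d) = ρ * x m - d * x m := by ring
    rw [h5]; linarith

lemma specRad_large {n : ℕ} (G : SimpleGraph (Fin n)) (u0 : Fin n)
    (hu : ∀ v, v ≠ u0 → G.Adj u0 v) (B : ℕ) (hB : 0 < B) (hn : B ^ 2 + 1 ≤ n) :
    (B : ℝ) ≤ specRad G := by
  by_contra hlt
  push Not at hlt
  set y : Fin n → ℝ := fun i => if i = u0 then (B : ℝ) else 1 with hy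
  have h := rayleigh_le G y
  have hy0 : ∀ i, 0 ≤ y i := by
    intro i; simp only [hy]; split_ifs <;> positivity
  have hB1 : (0:ℝ) < B := by exact_mod_cast hB
  have hcard : ((Finset.univ.erase u0).card : ℝ) = n - 1 := by
    rw [Finset.card_erase_of_mem (Finset.mem_univ _), Finset.card_univ, Fintype.card_fin]
    have : 1 ≤ n := by omega
    push_cast [this]; ring
  have hsq : ∑ i, y i ^ 2 = B ^ 2 + (n - 1) := by
    rw [← Finset.add_sum_erase _ _ (Finset.mem_univ u0)]
    have : ∑ i ∈ Finset.univ.erase u0, y i ^ 2 = ∑ i ∈ Finset.univ.erase u0, (1:ℝ) := by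
      apply Finset.sum_congr rfl
      intro i hi
      have := Finset.ne_of_mem_erase hi
      simp [hy, this]
    rw [this, Finset.sum_const, nsmul_eq_mul, hcard]
    simp [hy]
  have hlow : 2 * B * ((n:ℝ) - 1) ≤ ∑ i, ∑ j, (if G.Adj i j then y i * y j else 0) := by
    rw [← Finset.add_sum_erase _ _ (Finset.mem_univ u0)]
    have e1 : ∑ j, (if G.Adj u0 j then y u0 * y j else 0) = B * ((n:ℝ) - 1) := by
      rw [← Finset.add_sum_erase _ _ (Finset.mem_univ u0)]
      have : ∑ j ∈ Finset.univ.erase u0, (if G.Adj u0 j then y u0 * y j else 0)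
          = ∑ i ∈ Finset.univ.erase u0, (B:ℝ) := by
        apply Finset.sum_congr rfl
        intro i hi
        have := Finset.ne_of_mem_erase hi
        rw [if_pos (hu i this)]
        simp [hy, this]
      rw [this, Finset.sum_const, nsmul_eq_mul, hcard]
      simp; ring
    have e2 : B * ((n:ℝ) - 1) ≤ ∑ i ∈ Finset.univ.erase u0, ∑ j, (if G.Adj i j then y i * y j else 0) := by
      have : ∑ i ∈ Finset.univ.erase u0, (B:ℝ) ≤
          ∑ i ∈ Finset.univ.erase u0, ∑ j, (if G.Adj i j then y i * y j else 0) := by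
        apply Finset.sum_le_sum
        intro i hi
        have hne := Finset.ne_of_mem_erase hi
        have := Finset.single_le_sum (f := fun j => if G.Adj i j then y i * y j else 0)
          (s := Finset.univ) (fun j _ => by
            show 0 ≤ (if G.Adj i j then y i * y j else 0)
            split_ifs
            · exact mul_nonneg (hy0 _) (hy0 _)
            · exact le_rfl) (Finset.mem_univ u0)
        refine le_trans ?_ this
        show _ ≤ (if G.Adj i u0 then y i * y u0 else 0)
        rw [if_pos (hu i hne).symm]
        simp [hy, hne]
      rw [Finset.sum_const, nsmul_eq_mul, hcard] at this
      linarith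
    rw [e1]; linarith
  have hn' : (B:ℝ) ^ 2 + 1 ≤ n := by exact_mod_cast hn
  rw [hsq] at h
  have hp : (0:ℝ) < B ^ 2 + (n - 1) := by nlinarith
  have h1 : specRad G * (B ^ 2 + (n - 1)) < B * (B ^ 2 + ((n:ℝ) - 1)) :=
    mul_lt_mul_of_pos_right hlt hp
  have h2 : (B:ℝ) * B ^ 2 ≤ B * (n - 1) := by
    apply mul_le_mul_of_nonneg_left _ hB1.le; linarith
  nlinarith

lemma sum_class (t q : ℕ) (ht : 0 < t) (hq : q ≤ t) (f : ℕ → ℝ) (p : ℕ) :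
    ∑ k ∈ Finset.range (p * t + q), f (k / t) = t * ∑ i ∈ Finset.range p, f i + q * f p := by
  have key : ∀ p r, r ≤ t → ∑ k ∈ Finset.range r, f ((p * t + k) / t) = r * f p := by
    intro p r hr
    have : ∑ k ∈ Finset.range r, f ((p * t + k) / t) = ∑ k ∈ Finset.range r, f p := by
      apply Finset.sum_congr rfl
      intro k hk
      have hk' := Finset.mem_range.1 hk
      rw [mul_comm, Nat.mul_add_div ht, Nat.div_eq_of_lt (by omega), add_zero]
    rw [this]; simp
  have h0 : ∀ p, ∑ k ∈ Finset.range (p * t), f (k / t) = t * ∑ i ∈ Finset.range p, f i := by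
    intro p
    induction p with
    | zero => simp
    | succ p ih =>
      rw [Nat.succ_mul, Finset.sum_range_add, ih, key p t le_rfl, Finset.sum_range_succ]; ring
  rw [Finset.sum_range_add, h0, key p q hq]

lemma sum_class_W {W : Type} [Fintype W] (N t p q : ℕ) (e : W ≃ Fin N) (ht : 0 < t) (hq : q ≤ t)
    (hN : N = p * t + q) (f : ℕ → ℝ) :
    ∑ w, f ((e w : ℕ) / t) = t * ∑ i ∈ Finset.range p, f i + q * f p := by
  rw [← sum_class t q ht hq f p, ← hN, ← Fin.sum_univ_eq_sum_range (fun k => f (k / t)) N]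
  exact Equiv.sum_comp e (fun k : Fin N => f ((k:ℕ) / t))

lemma sum_split_emb {n : ℕ} {W : Type} [Fintype W] (ι : W → Fin n)
    (hι : Function.Injective ι) (f : Fin n → ℝ) : ∑ j, f j = ∑ w, f (ι w) + ∑ j, (if ∃ w, ι w = j then 0 else f j) := by
  have h1 : ∑ w, f (ι w) = ∑ j, (if ∃ w, ι w = j then f j else 0) := by
    rw [← Finset.sum_filter, ← Finset.sum_image (s := Finset.univ) (g := ι) (f := f)
      (fun a _ b _ h => hι h)]
    apply Finset.sum_congr _ (fun _ _ => rfl)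
    ext j; simp
  rw [h1, ← Finset.sum_add_distrib]
  apply Finset.sum_congr rfl
  intro j _
  split_ifs <;> simp

lemma deg_outside {n : ℕ} (G : SimpleGraph (Fin n)) (K : Finset (Fin n)) (s t : ℕ) (hs : 2 ≤ s)
    (hcard : K.card = s - 1) (hdom : ∀ v, v ∉ K → ∀ u ∈ K, G.Adj u v)
    (hG : ¬ MinorOf (completeBipartiteGraph (Fin s) (Fin t)) G) (v : Fin n) (hv : v ∉ K) :
    (Finset.univ.filter (fun j => j ∉ K ∧ G.Adj v j)).card < t := by
  by_contra h
  push Not at h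
  apply hG
  refine star_minor G K s t hs hcard hdom {v} ?_ ?_ _ h ?_ ?_ ?_
  · have : Subsingleton ({v} : Set (Fin n)) := by
      constructor; rintro ⟨a, rfl⟩ ⟨b, rfl⟩; rfl
    have : Nonempty ({v} : Set (Fin n)) := ⟨⟨_, rfl⟩⟩
    exact { preconnected := SimpleGraph.Preconnected.of_subsingleton }
  · rintro x rfl; exact hv
  · intro x hx; simp at hx; exact hx.1
  · intro x hx hxv; simp at hx hxv; subst hxv; exact G.loopless.irrefl _ hx.2
  · intro x hx; simp at hx; exact ⟨v, rfl, hx.2⟩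

lemma normalized_eig {n : ℕ} (G : SimpleGraph (Fin n)) (K : Finset (Fin n)) (s t : ℕ)
    (hs : 2 ≤ s) (hcard : K.card = s - 1) (hK : G.IsClique (K : Set (Fin n)))
    (hdom : ∀ v, v ∉ K → ∀ u ∈ K, G.Adj u v)
    (hdeg : ∀ v, v ∉ K → (Finset.univ.filter (fun j => j ∉ K ∧ G.Adj v j)).card < t)
    (ρ : ℝ) (hρ : (t : ℝ) ≤ ρ) (x : Fin n → ℝ) (hx0 : x ≠ 0)
    (hx : ∀ i, ∑ j, (if G.Adj i j then x j else 0) = ρ * x i) :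
    ∃ (y : Fin n → ℝ), (∑ j ∈ K, y j = 1) ∧
      (∀ i, ∑ j, (if G.Adj i j then y j else 0) = ρ * y i) ∧
      (∀ v, v ∉ K → y v ≤ 1 / (ρ - t + 1)) := by
  obtain ⟨N, hN⟩ : ∃ N : Fin n → Finset (Fin n),
      ∀ v, N v = Finset.univ.filter (fun j => j ∉ K ∧ G.Adj v j) := ⟨_, fun _ => rfl⟩
  have hmN : ∀ v j, j ∈ N v ↔ j ∉ K ∧ G.Adj v j := by intro v j; rw [hN]; simp
  have hNK : ∀ v, ∀ j ∈ N v, j ∉ K := fun v j hj => ((hmN v j).1 hj).1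
  have ht0 : (0:ℝ) ≤ t := by positivity
  have hρ0 : 0 < ρ + 1 := by linarith
  have hKadj : ∀ u ∈ K, ∀ j, G.Adj u j ↔ j ≠ u := by
    intro u hu j
    refine ⟨fun h => h.ne', fun h => ?_⟩
    by_cases hj : j ∈ K
    · exact hK hu hj h.symm
    · exact hdom j hj u hu
  set α := (∑ j, x j) / (ρ + 1) with hα
  have hxK : ∀ u ∈ K, x u = α := by
    intro u hu
    have h1 := hx u
    have h2 : ∑ j, (if G.Adj u j then x j else 0) = ∑ j, x j - x u := by
      have : ∀ j, (if G.Adj u j then x j else 0) = x j - (if j = u then x j else 0) := by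
        intro j
        by_cases hj : j = u
        · subst hj; simp
        · simp [(hKadj u hu j).2 hj, hj]
      rw [Finset.sum_congr rfl (fun j _ => this j), Finset.sum_sub_distrib]
      simp
    rw [hα, eq_div_iff hρ0.ne']
    linarith
  have hcK : ((K.card : ℕ) : ℝ) = (s:ℝ) - 1 := by
    rw [hcard]; push_cast [show 1 ≤ s by omega]; ring
  have hs1 : (0:ℝ) < (s:ℝ) - 1 := by
    have : (2:ℝ) ≤ s := by exact_mod_cast hs
    linarith
  have hsumK : ∑ j ∈ K, x j = ((s:ℝ) - 1) * α := by
    rw [Finset.sum_congr rfl hxK, Finset.sum_const, nsmul_eq_mul, hcK]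
  have hrow : ∀ (y : Fin n → ℝ) v, v ∉ K → ∑ j, (if G.Adj v j then y j else 0) =
      ∑ j ∈ K, y j + ∑ j ∈ N v, y j := by
    intro y v hv
    have e : ∑ j ∈ K, y j = ∑ j, (if j ∈ K then y j else 0) := by
      rw [← Finset.sum_filter]; simp
    have e' : ∑ j ∈ N v, y j = ∑ j, (if j ∉ K ∧ G.Adj v j then y j else 0) := by
      rw [← Finset.sum_filter]
      apply Finset.sum_congr _ (fun _ _ => rfl)
      ext j; simp [hmN]
    rw [e, e', ← Finset.sum_add_distrib]
    apply Finset.sum_congr rfl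
    intro j _
    by_cases hj : j ∈ K
    · simp [hj, (hdom v hv j hj).symm]
    · simp [hj]
  have hd' : ∀ v, v ∉ K → ((N v).card : ℝ) ≤ (t:ℝ) - 1 := by
    intro v hv
    have := hdeg v hv
    rw [← hN] at this
    have h : (((N v).card + 1 : ℕ) : ℝ) ≤ t := by
      exact_mod_cast this
    push_cast at h
    linarith
  have hα0 : α ≠ 0 := by
    intro h0
    apply hx0
    rw [h0, mul_zero] at hsumK
    have hup := max_principle N (fun v => v ∉ K) ((t:ℝ)-1) ρ 0 hNK hd' (by linarith) le_rfl x
      (by intro v hv; rw [← hx v, hrow x v hv, hsumK])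
    have hlo := max_principle N (fun v => v ∉ K) ((t:ℝ)-1) ρ 0 hNK hd' (by linarith) le_rfl
      (fun v => - x v) (by
        intro v hv
        have h1 := hx v
        rw [hrow x v hv, hsumK] at h1
        have h2 : ∑ j ∈ N v, (- x j) = - ∑ j ∈ N v, x j := by
          rw [← Finset.sum_neg_distrib]
        show ρ * (- x v) ≤ _
        rw [h2]; linarith)
    funext v
    by_cases hv : v ∈ K
    · rw [hxK v hv, h0]; rfl
    · have h1 := hup v hv
      have h2 := hlo v hv
      simp only [zero_div] at h1 h2
      show x v = 0
      linarith
  set c := ((s:ℝ) - 1) * α with hc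
  have hc0 : c ≠ 0 := mul_ne_zero hs1.ne' hα0
  have hy1 : ∑ j ∈ K, x j / c = 1 := by
    rw [← Finset.sum_div, hsumK, div_self hc0]
  have hy2 : ∀ i, ∑ j, (if G.Adj i j then x j / c else 0) = ρ * (x i / c) := by
    intro i
    rw [← mul_div_assoc, ← hx i, Finset.sum_div]
    apply Finset.sum_congr rfl
    intro j _; split_ifs <;> simp
  refine ⟨fun i => x i / c, hy1, hy2, ?_⟩
  have := max_principle N (fun v => v ∉ K) ((t:ℝ)-1) ρ 1 hNK hd' (by linarith)
    zero_le_one (fun i => x i / c) (by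
      intro v hv
      rw [← hy2 v, hrow (fun i => x i / c) v hv, hy1])
  intro v hv
  have h := this v hv
  rwa [show ρ - ((t:ℝ) - 1) = ρ - t + 1 by ring] at h

lemma starBound_of_free {V W : Type} [Fintype V] (G : SimpleGraph V) (K : Finset V) (s t : ℕ)
    (hs : 2 ≤ s)
    (hcard : K.card = s - 1) (hdom : ∀ v, v ∉ K → ∀ u ∈ K, G.Adj u v)
    (hG : ¬ MinorOf (completeBipartiteGraph (Fin s) (Fin t)) G)
    (C : SimpleGraph W) (ι : W → V) (hι : Function.Injective ι)
    (hadj : ∀ a b, C.Adj a b ↔ G.Adj (ι a) (ι b)) (hιK : ∀ a, ι a ∉ K) : StarBound C t := by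
  intro S T hS hST hT
  by_contra h
  push Not at h
  apply hG
  refine star_minor G K s t hs hcard hdom (ι '' (S : Set W)) ?_ ?_ (T.image ι) ?_ ?_ ?_ ?_
  · let f : C.induce (S : Set W) →g G.induce (ι '' (S : Set W)) :=
      { toFun := fun a => ⟨ι a.1, a.1, a.2, rfl⟩
        map_rel' := by
          intro a b hab
          exact (hadj _ _).1 hab }
    refine hS.map f ?_
    rintro ⟨_, a, ha, rfl⟩
    exact ⟨⟨a, ha⟩, rfl⟩
  · rintro _ ⟨a, _, rfl⟩; exact hιK a
  · rw [Finset.card_image_of_injective _ hι]; exact h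
  · intro x hx
    obtain ⟨a, _, rfl⟩ := Finset.mem_image.1 hx
    exact hιK a
  · intro x hx hxS
    obtain ⟨a, ha, rfl⟩ := Finset.mem_image.1 hx
    obtain ⟨b, hb, hba⟩ := hxS
    have := hι hba
    subst this
    exact Finset.disjoint_left.1 hST hb ha
  · intro x hx
    obtain ⟨a, ha, rfl⟩ := Finset.mem_image.1 hx
    obtain ⟨b, hb, hab⟩ := hT a ha
    exact ⟨ι b, ⟨b, hb, rfl⟩, (hadj _ _).1 hab⟩

lemma assembly {n : ℕ} (s t : ℕ) (ht : 4 ≤ t) (hs : 2 ≤ s) (hst : s ≤ t)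
    (hn : (100 * t ^ 5) ^ 2 + 1 ≤ n) (G : SimpleGraph (Fin n)) (K : Finset (Fin n))
    (hG : ¬ MinorOf (completeBipartiteGraph (Fin s) (Fin t)) G)
    (hmax : ∀ G' : SimpleGraph (Fin n),
        ¬ MinorOf (completeBipartiteGraph (Fin s) (Fin t)) G' → specRad G' ≤ specRad G)
    (hcard : K.card = s - 1) (hK : G.IsClique (K : Set (Fin n)))
    (hdom : ∀ v : Fin n, v ∉ K → ∀ u ∈ K, G.Adj u v)
    {W : Type} [Fintype W] (C : SimpleGraph W) (hC : C.Connected)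
    (ι : W → Fin n) (hι : Function.Injective ι)
    (hadj : ∀ a b, C.Adj a b ↔ G.Adj (ι a) (ι b)) (hιK : ∀ a, ι a ∉ K)
    (hclosed : ∀ a u, u ∉ K → G.Adj (ι a) u → ∃ w, ι w = u) :
    Fintype.card W ≤ t + 2 := by
  by_contra hbig
  have hbig : t + 3 ≤ Fintype.card W := by omega
  have hSB := starBound_of_free G K s t hs hcard hdom hG C ι hι hadj hιK
  have ht0 : 0 < t := by omega
  -- spectral radius is large
  obtain ⟨u0, hu0⟩ : K.Nonempty := by
    rw [← Finset.card_pos]; omega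
  have hρB : (100 : ℝ) * (t:ℝ) ^ 5 ≤ specRad G := by
    have := specRad_large G u0 (fun v hv => by
      by_cases h : v ∈ K
      · exact hK hu0 h hv.symm
      · exact hdom v h u0 hu0) (100 * t ^ 5) (by positivity) hn
    exact_mod_cast this
  obtain ⟨ρ, hρdef⟩ : ∃ ρ, ρ = specRad G := ⟨_, rfl⟩
  rw [← hρdef] at hρB
  have ht4 : (4:ℝ) ≤ t := by exact_mod_cast ht
  have hρt : (t:ℝ) + 1 ≤ ρ := by
    have h1 : (1:ℝ) ≤ (t:ℝ) ^ 4 := one_le_pow₀ (by linarith)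
    have h2 : (t:ℝ) ≤ (t:ℝ) ^ 5 := by
      calc (t:ℝ) = t * 1 := by ring
        _ ≤ t * t ^ 4 := mul_le_mul_of_nonneg_left h1 (by linarith)
        _ = t ^ 5 := by ring
    linarith
  -- normalized eigenvector
  obtain ⟨x0, hx00, hx0e⟩ := exists_top_eigvec (by omega : 0 < n) G
  rw [← hρdef] at hx0e
  obtain ⟨x, hxK, hxe, hxM⟩ := normalized_eig G K s t hs hcard hK hdom
    (fun v hv => deg_outside G K s t hs hcard hdom hG v hv) ρ (by linarith) x0 hx00 hx0e
  -- parameters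
  obtain ⟨p, q, hqt, hN⟩ : ∃ p q, q < t ∧ Fintype.card W = p * t + q :=
    ⟨Fintype.card W / t, Fintype.card W % t, Nat.mod_lt _ ht0, (Nat.div_add_mod' _ _).symm⟩
  obtain ⟨N, hNdef⟩ : ∃ N, N = Fintype.card W := ⟨_, rfl⟩
  let e : W ≃ Fin N := Fintype.equivFinOfCardEq hNdef.symm
  have heN : ∀ w, ((e w : Fin N) : ℕ) < p * t + q := by
    intro w; have := (e w).2; omega
  obtain ⟨b, hb⟩ : ∃ b : W → ℕ, ∀ w, b w = (e w : ℕ) / t := ⟨_, fun _ => rfl⟩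
  have hsumb : ∀ f : ℕ → ℝ, ∑ w, f (b w) = t * ∑ i ∈ Finset.range p, f i + q * f p := by
    intro f
    rw [← sum_class_W N t p q e ht0 hqt.le (hNdef.trans hN) f]
    exact Finset.sum_congr rfl (fun w _ => by rw [hb])
  have hbp : ∀ w, b w < p ∨ (b w = p ∧ 0 < q) := by
    intro w
    have h1 := heN w
    rw [hb]
    have h2 : (e w : ℕ) / t < p + 1 := by
      rw [Nat.div_lt_iff_lt_mul ht0]
      rw [Nat.succ_mul]; omega
    by_cases h3 : (e w : ℕ) / t < p
    · exact Or.inl h3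
    · right
      refine ⟨by omega, ?_⟩
      have h4 : p ≤ (e w : ℕ) / t := by omega
      rw [Nat.le_div_iff_mul_le ht0] at h4
      omega
  obtain ⟨sz, hsz⟩ : ∃ sz : ℕ → ℝ, ∀ i, sz i = if i < p then (t:ℝ) else q := ⟨_, fun _ => rfl⟩
  have hclass : ∀ w, ∑ w', (if b w' = b w then (1:ℝ) else 0) = sz (b w) := by
    intro w
    rw [hsumb (fun k => if k = b w then (1:ℝ) else 0), hsz]
    rcases hbp w with h | ⟨h, _⟩
    · have h' : ¬ p = b w := by omega
      rw [if_pos h, if_neg h', Finset.sum_ite_eq', if_pos (Finset.mem_range.2 h)]; ring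
    · have h' : ¬ b w < p := by omega
      rw [if_neg h', if_pos h.symm, Finset.sum_ite_eq', if_neg (by simp [h])]; ring
  obtain ⟨z, hz⟩ : ∃ z : ℕ → ℝ, ∀ i, z i = 1 / (ρ - (sz i - 1)) := ⟨_, fun _ => rfl⟩
  have hqt' : (q:ℝ) ≤ t := by exact_mod_cast hqt.le
  have hzeq : ∀ i, 1 + (sz i - 1) * z i = ρ * z i := by
    intro i
    have hle : sz i ≤ t := by rw [hsz]; split_ifs <;> linarith
    have hne : ρ - (sz i - 1) ≠ 0 := by
      have : 0 < ρ - (sz i - 1) := by linarith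
      exact this.ne'
    have : (ρ - (sz i - 1)) * z i = 1 := by rw [hz]; field_simp
    linarith
  -- the modified graph
  let cls : Fin n → Option ℕ := Function.extend ι (fun w => some (b w)) (fun _ => none)
  have hclsι : ∀ w, cls (ι w) = some (b w) := fun w => hι.extend_apply _ _ w
  have hclsn : ∀ j, (¬ ∃ w, ι w = j) → cls j = none := fun j hj =>
    Function.extend_apply' (fun w => some (b w)) (fun _ => none) j hj
  have hclsK : ∀ j ∈ K, cls j = none := by
    intro j hj
    apply hclsn
    rintro ⟨w, rfl⟩
    exact hιK w hj
  obtain ⟨G', hG'⟩ : ∃ G' : SimpleGraph (Fin n), ∀ u v, G'.Adj u v ↔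
      (u ≠ v ∧ ((cls u ≠ none ∧ cls v ≠ none ∧ cls u = cls v) ∨
        ((cls u = none ∨ cls v = none) ∧ G.Adj u v))) := by
    refine ⟨{ Adj := fun u v => (u ≠ v ∧ ((cls u ≠ none ∧ cls v ≠ none ∧ cls u = cls v) ∨
        ((cls u = none ∨ cls v = none) ∧ G.Adj u v))), symm := ?_, loopless := ?_ }, fun _ _ => Iff.rfl⟩
    · constructor
      rintro u v ⟨h1, h2⟩
      refine ⟨h1.symm, ?_⟩
      rcases h2 with ⟨h3, h4, h5⟩ | ⟨h3, h4⟩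
      · exact Or.inl ⟨h4, h3, h5.symm⟩
      · exact Or.inr ⟨h3.symm, h4.symm⟩
    · exact ⟨fun u h => h.1 rfl⟩
  have hG'n : ∀ u v, (cls u = none ∨ cls v = none) → (G'.Adj u v ↔ G.Adj u v) := by
    intro u v h
    rw [hG']
    constructor
    · rintro ⟨_, ⟨h3, h4, _⟩ | ⟨_, h4⟩⟩
      · rcases h with h | h
        · exact absurd h h3
        · exact absurd h h4
      · exact h4
    · intro h4; exact ⟨h4.ne, Or.inr ⟨h, h4⟩⟩
  have hG'ι : ∀ a c, G'.Adj (ι a) (ι c) ↔ (b c = b a ∧ c ≠ a) := by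
    intro a c
    rw [hG', hclsι, hclsι]
    constructor
    · rintro ⟨h1, ⟨_, _, h2⟩ | ⟨h2, _⟩⟩
      · exact ⟨(Option.some.inj h2).symm, fun h => h1 (by rw [h])⟩
      · simp at h2
    · rintro ⟨h1, h2⟩
      exact ⟨fun h => h2 (hι h).symm, Or.inl ⟨by simp, by simp, by rw [h1]⟩⟩
  have hnotK : ∀ j, (¬ ∃ w, ι w = j) → ∀ w, (G.Adj (ι w) j ↔ j ∈ K) := by
    intro j hj w
    constructor
    · intro h
      by_contra hjK
      exact hj (hclosed w j hjK h)
    · intro h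
      exact (hdom _ (hιK w) j h).symm
  have hfree : ¬ MinorOf (completeBipartiteGraph (Fin s) (Fin t)) G' := by
    refine modified_minor_free G G' K s t hs hst hcard ?_ cls ?_ ?_ ?_ hG
    · intro u hu v hv huv
      rw [hG'n u v (Or.inl (hclsK u hu))]
      exact hK hu hv huv
    · intro u v hu hv huv
      rcases ((hG' u v).1 huv).2 with ⟨_, _, h⟩ | ⟨h, hA⟩
      · exact h
      · by_cases hu' : ∃ w, ι w = u
        · obtain ⟨w, rfl⟩ := hu'
          obtain ⟨w', rfl⟩ := hclosed w v hv hA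
          simp [hclsι] at h
        · by_cases hv' : ∃ w, ι w = v
          · obtain ⟨w, rfl⟩ := hv'
            exact absurd (hclosed w u hu hA.symm) hu'
          · rw [hclsn u hu', hclsn v hv']
    · intro u v hu hv huv
      have : cls u = none := by
        rcases hu with h | h
        · exact hclsK u h
        · exact h
      exact (hG'n u v (Or.inl this)).1 huv
    · intro i
      refine ⟨(Finset.univ.filter (fun w => b w = i)).image ι, ?_, ?_⟩
      · refine Finset.card_image_le.trans ?_
        by_cases hne : ∃ w, b w = i
        · obtain ⟨w, rfl⟩ := hne
          have h1 := hclass w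
          rw [← Finset.sum_filter, Finset.sum_const, nsmul_eq_mul, mul_one, hsz] at h1
          have h2 : ((Finset.univ.filter (fun w' => b w' = b w)).card : ℝ) ≤ t := by
            rw [h1]; split_ifs <;> linarith
          exact_mod_cast h2
        · push Not at hne
          rw [Finset.filter_false_of_mem (fun w _ => hne w)]; simp
      · intro j hj
        by_cases hj' : ∃ w, ι w = j
        · obtain ⟨w, rfl⟩ := hj'
          rw [hclsι] at hj
          exact Finset.mem_image_of_mem _ (by simpa using hj)
        · rw [hclsn j hj'] at hj; simp at hj
  -- outside sum
  have hout : ∀ (f : Fin n → ℝ) w, (∑ j, (if ∃ w, ι w = j then 0 else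
      (if G.Adj (ι w) j then f j else 0))) = ∑ j ∈ K, f j := by
    intro f w
    have e : ∑ j ∈ K, f j = ∑ j, (if j ∈ K then f j else 0) := by
      rw [← Finset.sum_filter]; simp
    rw [e]
    apply Finset.sum_congr rfl
    intro j _
    by_cases hj : ∃ w, ι w = j
    · rw [if_pos hj, if_neg]
      obtain ⟨w', rfl⟩ := hj
      exact hιK w'
    · rw [if_neg hj]
      by_cases hjK : j ∈ K
      · rw [if_pos hjK, if_pos ((hnotK j hj w).2 hjK)]
      · rw [if_neg hjK, if_neg (fun h => hjK ((hnotK j hj w).1 h))]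
  -- apply the analytic bound
  have hana := analytic_main C hC t p q ht hSB hqt hN hbig ρ hρB (fun w => x (ι w)) (by
      intro v
      have h1 := hxe (ι v)
      rw [sum_split_emb ι hι, hout x v, hxK] at h1
      have h2 : ∑ w, (if G.Adj (ι v) (ι w) then x (ι w) else 0) =
          ∑ w, (if C.Adj v w then x (ι w) else 0) := by
        apply Finset.sum_congr rfl
        intro w _
        by_cases h : C.Adj v w
        · rw [if_pos h, if_pos ((hadj v w).1 h)]
        · rw [if_neg h, if_neg (fun h' => h ((hadj v w).2 h'))]
      rw [h2] at h1
      show ρ * x (ι v) = _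
      linarith) (fun v => hxM _ (hιK v))
  -- test vector
  let y : Fin n → ℝ := Function.extend ι (fun w => z (b w)) x
  have hyι : ∀ w, y (ι w) = z (b w) := fun w => hι.extend_apply _ _ w
  have hyn : ∀ j, (¬ ∃ w, ι w = j) → y j = x j := fun j hj =>
    Function.extend_apply' (fun w => z (b w)) x j hj
  obtain ⟨Δ, hΔ⟩ : ∃ Δ, Δ = ∑ w, (y (ι w) - x (ι w)) := ⟨_, rfl⟩
  have hKn : ∀ j ∈ K, ¬ ∃ w, ι w = j := by
    rintro j hj ⟨w, rfl⟩
    exact hιK w hj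
  have hyK : ∑ j ∈ K, y j = 1 := by
    rw [← hxK]
    exact Finset.sum_congr rfl (fun j hj => hyn j (hKn j hj))
  have hΔpos : 0 < Δ := by
    rw [hΔ, Finset.sum_sub_distrib]
    have h1 : ∑ w, y (ι w) = ∑ w, z (b w) := Finset.sum_congr rfl (fun w _ => hyι w)
    have h2 : ∑ i ∈ Finset.range p, z i = p * (1 / (ρ - ((t:ℝ) - 1))) := by
      have : ∑ i ∈ Finset.range p, z i = ∑ i ∈ Finset.range p, (1 / (ρ - ((t:ℝ) - 1))) := by
        apply Finset.sum_congr rfl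
        intro i hi
        rw [hz, hsz, if_pos (Finset.mem_range.1 hi)]
      rw [this, Finset.sum_const, Finset.card_range, nsmul_eq_mul]
    have h3 : z p = 1 / (ρ - ((q:ℝ) - 1)) := by
      rw [hz, hsz, if_neg (lt_irrefl _)]
    rw [h1, hsumb, h2, h3]
    have h4 : (t:ℝ) * (p * (1 / (ρ - ((t:ℝ) - 1)))) = p * t * (1 / (ρ - ((t:ℝ) - 1))) := by ring
    rw [h4]
    linarith
  have hrows : ∀ i, ∑ j, (if G'.Adj i j then y j else 0) = ρ * y i + (if i ∈ K then Δ else 0) := by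
    intro i
    by_cases hi : ∃ w, ι w = i
    · obtain ⟨w, rfl⟩ := hi
      rw [if_neg (hιK w), sum_split_emb ι hι]
      have h1 : ∑ j, (if ∃ w, ι w = j then 0 else (if G'.Adj (ι w) j then y j else 0)) =
          ∑ j, (if ∃ w, ι w = j then 0 else (if G.Adj (ι w) j then y j else 0)) := by
        apply Finset.sum_congr rfl
        intro j _
        by_cases hj : ∃ w, ι w = j
        · rw [if_pos hj, if_pos hj]
        · rw [if_neg hj, if_neg hj]
          have := hG'n (ι w) j (Or.inr (hclsn j hj))
          by_cases h : G.Adj (ι w) j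
          · rw [if_pos h, if_pos (this.2 h)]
          · rw [if_neg h, if_neg (fun h' => h (this.1 h'))]
      rw [h1, hout y w, hyK, hyι, ← hzeq]
      have h2 : ∑ w', (if G'.Adj (ι w) (ι w') then y (ι w') else 0) =
          ∑ w', ((if b w' = b w then (1:ℝ) else 0) * z (b w) - (if w' = w then z (b w) else 0)) := by
        apply Finset.sum_congr rfl
        intro w' _
        by_cases hw : w' = w
        · subst hw
          rw [if_neg (fun h => G'.loopless.irrefl _ h)]; simp
        · by_cases hbw : b w' = b w
          · rw [if_pos ((hG'ι w w').2 ⟨hbw, hw⟩), if_pos hbw, if_neg hw, hyι, hbw]; ring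
          · rw [if_neg (fun h => hbw ((hG'ι w w').1 h).1), if_neg hbw, if_neg hw]; ring
      rw [h2, Finset.sum_sub_distrib, ← Finset.sum_mul, hclass, Finset.sum_ite_eq' Finset.univ w,
        if_pos (Finset.mem_univ _)]
      ring
    · have hA : ∀ j, G'.Adj i j ↔ G.Adj i j := fun j => hG'n i j (Or.inl (hclsn i hi))
      have h1 : ∑ j, (if G'.Adj i j then y j else 0) =
          ∑ j, ((if G.Adj i j then x j else 0) + (if G.Adj i j then y j - x j else 0)) := by
        apply Finset.sum_congr rfl
        intro j _
        by_cases h : G.Adj i j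
        · rw [if_pos h, if_pos h, if_pos ((hA j).2 h)]; ring
        · rw [if_neg h, if_neg h, if_neg (fun h' => h ((hA j).1 h'))]; ring
      rw [h1, Finset.sum_add_distrib, hxe, hyn i hi]
      congr 1
      by_cases hiK : i ∈ K
      · rw [if_pos hiK, sum_split_emb ι hι, hΔ]
        have h2 : ∑ j, (if ∃ w, ι w = j then 0 else (if G.Adj i j then y j - x j else 0)) = 0 := by
          apply Finset.sum_eq_zero
          intro j _
          by_cases hj : ∃ w, ι w = j
          · rw [if_pos hj]
          · rw [if_neg hj, hyn j hj]; simp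
        rw [h2, add_zero]
        apply Finset.sum_congr rfl
        intro w _
        rw [if_pos (hdom _ (hιK w) i hiK)]
      · rw [if_neg hiK]
        apply Finset.sum_eq_zero
        intro j _
        by_cases hj : ∃ w, ι w = j
        · rw [if_neg]
          obtain ⟨w, rfl⟩ := hj
          intro h
          exact hi (hclosed w i hiK h.symm)
        · rw [hyn j hj]; simp
  have hray := rayleigh_le G' y
  have htot : ∑ i, ∑ j, (if G'.Adj i j then y i * y j else 0) = ρ * ∑ i, y i ^ 2 + Δ := by
    have h1 : ∀ i, ∑ j, (if G'.Adj i j then y i * y j else 0) =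
        ρ * y i ^ 2 + Δ * (if i ∈ K then y i else 0) := by
      intro i
      have h2 : ∑ j, (if G'.Adj i j then y i * y j else 0) =
          y i * ∑ j, (if G'.Adj i j then y j else 0) := by
        rw [Finset.mul_sum]
        apply Finset.sum_congr rfl
        intro j _
        split_ifs <;> simp
      rw [h2, hrows]
      split_ifs <;> ring
    rw [Finset.sum_congr rfl (fun i _ => h1 i), Finset.sum_add_distrib, ← Finset.mul_sum,
      ← Finset.mul_sum]
    have e : ∑ i, (if i ∈ K then y i else 0) = 1 := by
      rw [← hyK, ← Finset.sum_filter]; simp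
    rw [e, mul_one]
  have hle : specRad G' ≤ ρ := by rw [hρdef]; exact hmax G' hfree
  have hsq : 0 ≤ ∑ i, y i ^ 2 := Finset.sum_nonneg (fun i _ => sq_nonneg _)
  have := mul_le_mul_of_nonneg_right hle hsq
  rw [htot] at hray
  linarith

end PartFive

/-- Theorem 3.3: every component of G⋆ − K has at most t+2 vertices. -/
theorem component_order_le_t_plus_two (s t : ℕ) (ht : 4 ≤ t) (hs : 2 ≤ s) (hst : s ≤ t) :
    ∃ n₀ : ℕ, ∀ n : ℕ, n₀ ≤ n →
    ∀ (G : SimpleGraph (Fin n)) (K : Finset (Fin n)),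
      ¬ MinorOf (completeBipartiteGraph (Fin s) (Fin t)) G →
      (∀ G' : SimpleGraph (Fin n),
        ¬ MinorOf (completeBipartiteGraph (Fin s) (Fin t)) G' → specRad G' ≤ specRad G) →
      K.card = s - 1 → G.IsClique (↑K : Set (Fin n)) →
      (∀ v : Fin n, v ∉ K → ∀ u ∈ K, G.Adj u v) →
      ∀ c : (G.comap (Subtype.val : {v : Fin n // v ∉ K} → Fin n)).ConnectedComponent,
        c.supp.ncard ≤ t + 2 := by
  refine ⟨(100 * t ^ 5) ^ 2 + 1, fun n hn G K hG hmax hcard hK hdom c => ?_⟩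
  classical
  letI : Fintype c.supp := Fintype.ofFinite _
  rw [← Nat.card_coe_set_eq, Nat.card_eq_fintype_card]
  refine assembly s t ht hs hst hn G K hG hmax hcard hK hdom
    ((G.comap (Subtype.val : {v : Fin n // v ∉ K} → Fin n)).induce c.supp)
    c.connected_toSimpleGraph (fun w => w.1.1) ?_ ?_ ?_ ?_
  · intro a b hab
    exact Subtype.ext (Subtype.ext hab)
  · intro a b
    exact Iff.rfl
  · intro a
    exact a.1.2
  · intro a u hu hau
    refine ⟨⟨⟨u, hu⟩, ?_⟩, rfl⟩
    have ha : (G.comap (Subtype.val : {v : Fin n // v ∉ K} → Fin n)).connectedComponentMk a.1 = c := a.2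
    show (G.comap (Subtype.val : {v : Fin n // v ∉ K} → Fin n)).connectedComponentMk ⟨u, hu⟩ = c
    rw [← ha]
    apply SimpleGraph.ConnectedComponent.connectedComponentMk_eq_of_adj
    exact hau.symm
end
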